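/- arXiv:2404.15950 — 4 statements merged into one kernel-verified Lean document; each statement's English description precedes it below -/
import Mathlib

section
/- Let w be a nice vertex of G (with respect to the number of robots k), let C_1, C_2, C_3 be three connected subgraphs witnessing that w is nice, and let H_w be a haven for w. Then there is a universal constant c > 0 such that for any set of robots S ⊆ R currently located in H_w with configuration ι, and for any configuration ι' of S with respect to H_w, the configuration ι' can be reached from ι via a sequence of at most c·k³ robot moves, all of which take place inside H_w (i.e., there is a schedule within H_w, of total traveled length at most c·k³, that takes every robot of S from its ι-position to its ι'-position). -/
open SimpleGraph

/-- A GCMP instance on a graph `G` with `k` robots: `isM i` holds iff robot `i` belongs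
to the set `M` of robots with destinations (otherwise it is a free robot of `F`);
`start` gives the starting vertices (pairwise distinct), and `dest` gives the
destination vertices of the robots in `M` (pairwise distinct on `M`). -/
structure Inst (V : Type) (G : SimpleGraph V) (k : ℕ) where
  isM : Fin k → Prop
  start : Fin k → V
  dest : Fin k → V
  start_inj : Function.Injective start
  dest_injOn : Set.InjOn dest {i | isM i}

/-- A schedule for a GCMP instance: positions `pos j i` of robot `i` at time `j ∈ [0,T]`,
each robot follows a route (stay or move along an edge), starting at its starting vertex,
robots of `M` ending at their destinations, and the routes are pairwise non-conflicting
(no two robots on the same vertex at the same time, and no edge swap). -/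
structure Sched {V : Type} {G : SimpleGraph V} {k : ℕ} (I : Inst V G k) where
  T : ℕ
  pos : ℕ → Fin k → V
  init : ∀ i, pos 0 i = I.start i
  final : ∀ i, I.isM i → pos T i = I.dest i
  step : ∀ j, j < T → ∀ i, pos (j + 1) i = pos j i ∨ G.Adj (pos j i) (pos (j + 1) i)
  noVertexConflict : ∀ j, j ≤ T → Function.Injective fun i => pos j i
  noSwap : ∀ j, j < T → ∀ i i', i ≠ i' →
      ¬(pos (j + 1) i = pos j i' ∧ pos (j + 1) i' = pos j i)

/-- The (traveled) length of the route of robot `i` in schedule `S`: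
the number of time steps at which robot `i` moves. -/
noncomputable def routeLength {V : Type} {G : SimpleGraph V} {k : ℕ} {I : Inst V G k}
    (S : Sched I) (i : Fin k) : ℕ :=
  {j : ℕ | j < S.T ∧ S.pos j i ≠ S.pos (j + 1) i}.ncard

/-- The total traveled length (energy) of a schedule. -/
noncomputable def totalLength {V : Type} {G : SimpleGraph V} {k : ℕ} {I : Inst V G k}
    (S : Sched I) : ℕ :=
  ∑ i : Fin k, routeLength S i

/-- A schedule is optimal if it has minimum total traveled length. -/
def Optimal {V : Type} {G : SimpleGraph V} {k : ℕ} {I : Inst V G k}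
    (S : Sched I) : Prop :=
  ∀ S' : Sched I, totalLength S ≤ totalLength S'

/-- A vertex `w` of `G` is *nice* with respect to `k` if there are three connected
subgraphs `C1, C2, C3` of `G` whose vertex sets pairwise intersect exactly in `{w}`,
with `|V(C1)| ≥ k+1`, `|V(C2)| ≥ k+1` and `|V(C3)| ≥ 2`. -/
def IsNice {V : Type} (G : SimpleGraph V) (k : ℕ) (w : V) : Prop :=
  ∃ C1 C2 C3 : G.Subgraph,
    C1.Connected ∧ C2.Connected ∧ C3.Connected ∧
    C1.verts ∩ C2.verts = {w} ∧ C1.verts ∩ C3.verts = {w} ∧ C2.verts ∩ C3.verts = {w} ∧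
    k + 1 ≤ C1.verts.ncard ∧ k + 1 ≤ C2.verts.ncard ∧ 2 ≤ C3.verts.ncard

/-- `H` is the haven of the nice vertex `w` built from the witnessing connected subgraphs
`C1, C2, C3` and a neighbor `x` of `w` lying in `C3`: it consists of those vertices of
`{x} ∪ V(C1) ∪ V(C2)` whose distance from `w` within (the subgraph induced by)
`{x} ∪ V(C1) ∪ V(C2)` is at most `k`. -/
def IsHavenWith {V : Type} (G : SimpleGraph V) (k : ℕ) (w : V)
    (C1 C2 C3 : G.Subgraph) (x : V) (H : Set V) : Prop :=
  C1.Connected ∧ C2.Connected ∧ C3.Connected ∧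
  C1.verts ∩ C2.verts = {w} ∧ C1.verts ∩ C3.verts = {w} ∧ C2.verts ∩ C3.verts = {w} ∧
  k + 1 ≤ C1.verts.ncard ∧ k + 1 ≤ C2.verts.ncard ∧ 2 ≤ C3.verts.ncard ∧
  x ∈ C3.verts ∧ G.Adj w x ∧
  ∃ hw : w ∈ ({x} ∪ C1.verts ∪ C2.verts : Set V),
    H = {u : V | ∃ hu : u ∈ ({x} ∪ C1.verts ∪ C2.verts : Set V),
          (G.induce ({x} ∪ C1.verts ∪ C2.verts : Set V)).dist ⟨w, hw⟩ ⟨u, hu⟩ ≤ k}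

/-- `H` is a haven for `w` (for some choice of witnesses). -/
def IsHaven {V : Type} (G : SimpleGraph V) (k : ℕ) (w : V) (H : Set V) : Prop :=
  ∃ (C1 C2 C3 : G.Subgraph) (x : V), IsHavenWith G k w C1 C2 C3 x H


namespace HavenAux
open SimpleGraph

variable {V R : Type}

def Good (H : Set V) (f : R → V) : Prop := Function.Injective f ∧ ∀ r, f r ∈ H

def Move (G : SimpleGraph V) (H : Set V) (f g : R → V) : Prop :=
  Good H f ∧ Good H g ∧ ∃ r, G.Adj (f r) (g r) ∧ ∀ s, s ≠ r → g s = f s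

inductive Reach (G : SimpleGraph V) (H : Set V) : ℕ → (R → V) → (R → V) → Prop
  | refl (n : ℕ) (f : R → V) : Reach G H n f f
  | cons {n : ℕ} {f g h : R → V} : Move G H f g → Reach G H n g h → Reach G H (n+1) f h

theorem Move.symm {G : SimpleGraph V} {H : Set V} {f g : R → V} (h : Move G H f g) :
    Move G H g f := by
  obtain ⟨h1, h2, r, h3, h4⟩ := h
  exact ⟨h2, h1, r, h3.symm, fun s hs => (h4 s hs).symm⟩

theorem Move.comp {G : SimpleGraph V} {H : Set V} {f g : R → V} (h : Move G H f g)
    (σ : Equiv.Perm R) : Move G H (f ∘ σ) (g ∘ σ) := by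
  obtain ⟨h1, h2, r, h3, h4⟩ := h
  refine ⟨⟨h1.1.comp σ.injective, fun r => h1.2 _⟩, ⟨h2.1.comp σ.injective, fun r => h2.2 _⟩,
    σ.symm r, by simpa using h3, fun s hs => ?_⟩
  apply h4
  intro h; apply hs; simp [← h]

theorem Reach.mono {G : SimpleGraph V} {H : Set V} {n : ℕ} {f g : R → V}
    (h : Reach G H n f g) : ∀ {m : ℕ}, n ≤ m → Reach G H m f g := by
  induction h with
  | refl n f => intro m _; exact Reach.refl m f
  | cons h1 h2 ih =>
    intro m hm
    obtain ⟨m, rfl⟩ : ∃ m', m = m' + 1 := ⟨m - 1, by omega⟩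
    exact Reach.cons h1 (ih (by omega))

theorem Reach.trans {G : SimpleGraph V} {H : Set V} {n m : ℕ} {f g h : R → V}
    (h1 : Reach G H n f g) (h2 : Reach G H m g h) : Reach G H (n + m) f h := by
  induction h1 with
  | refl n f => exact h2.mono (by omega)
  | cons h1 _ ih => exact (Reach.cons h1 (ih h2)).mono (by omega)

theorem Move.reach {G : SimpleGraph V} {H : Set V} {f g : R → V}
    (h1 : Move G H f g) : Reach G H 1 f g := Reach.cons h1 (Reach.refl 0 _)

theorem Reach.symm {G : SimpleGraph V} {H : Set V} {n : ℕ} {f g : R → V}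
    (h1 : Reach G H n f g) : Reach G H n g f := by
  induction h1 with
  | refl n f => exact Reach.refl _ _
  | cons h1 _ ih => exact ih.trans h1.symm.reach

theorem Reach.comp {G : SimpleGraph V} {H : Set V} {n : ℕ} {f g : R → V}
    (h1 : Reach G H n f g) (σ : Equiv.Perm R) : Reach G H n (f ∘ σ) (g ∘ σ) := by
  induction h1 with
  | refl n f => exact Reach.refl _ _
  | cons h1 _ ih => exact Reach.cons (h1.comp σ) ih

theorem Reach.seq {G : SimpleGraph V} {H : Set V} {n : ℕ} {f g : R → V}
    (h1 : Reach G H n f g) : ∃ (T : ℕ) (pos : ℕ → R → V), T ≤ n ∧ pos 0 = f ∧ pos T = g ∧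
      ∀ j, j < T → Move G H (pos j) (pos (j+1)) := by
  induction h1 with
  | refl n f => exact ⟨0, fun _ => f, by simp⟩
  | @cons n f g h h1 _ ih =>
    obtain ⟨T, pos, a, b, c, d⟩ := ih
    refine ⟨T+1, fun j => if j = 0 then f else pos (j-1), by omega, by simp, by simpa using c, ?_⟩
    intro j hj
    rcases j with _ | j
    · simpa [b] using h1
    · simpa using d j (by omega)

open Classical in
theorem move1 {G : SimpleGraph V} {H : Set V} {f : R → V} (hf : Good H f) (r : R) (v : V)
    (ha : G.Adj (f r) v) (hv : v ∈ H) (hr : v ∉ Set.range f) :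
    Move G H f (Function.update f r v) ∧ Good H (Function.update f r v) ∧
    Set.range (Function.update f r v) = insert v (Set.range f \ {f r}) := by
  have hg : Good H (Function.update f r v) := by
    constructor
    · intro s t hst
      by_cases h1 : s = r <;> by_cases h2 : t = r
      · rw [h1, h2]
      · subst h1; simp [Function.update_of_ne h2] at hst
        exact absurd ⟨t, hst.symm⟩ hr
      · subst h2; simp [Function.update_of_ne h1] at hst
        exact absurd ⟨s, hst⟩ hr
      · simp [Function.update_of_ne h1, Function.update_of_ne h2] at hst
        exact hf.1 hst
    · intro s
      by_cases h1 : s = r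
      · subst h1; simpa
      · simpa [Function.update_of_ne h1] using hf.2 s
  refine ⟨⟨hf, hg, r, by simpa, fun s hs => Function.update_of_ne hs _ _⟩, hg, ?_⟩
  ext z
  simp only [Set.mem_range, Set.mem_insert_iff, Set.mem_sdiff, Set.mem_singleton_iff]
  constructor
  · rintro ⟨s, rfl⟩
    by_cases h1 : s = r
    · subst h1; simp
    · right
      rw [Function.update_of_ne h1]
      exact ⟨⟨s, rfl⟩, fun h => h1 (hf.1 h)⟩
  · rintro (rfl | ⟨⟨s, rfl⟩, h⟩)
    · exact ⟨r, by simp⟩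
    · exact ⟨s, Function.update_of_ne (fun h' => h (by rw [h'])) _ _⟩

open Classical in
theorem push {G : SimpleGraph V} {H : Set V} {u h : V} (p : G.Walk u h) :
    ∀ (f : R → V), Good H f → (∀ z ∈ p.support, z ∈ H) → u ∈ Set.range f → h ∉ Set.range f →
    ∃ g, Reach G H p.length f g ∧ Good H g ∧ Set.range g = insert h (Set.range f \ {u}) ∧
      ∀ r, f r ∉ p.support → g r = f r := by
  induction p with
  | nil => intro f _ _ h1 h2; exact absurd h1 h2
  | @cons u v h a p ih =>
    intro f hf hp hu hh
    have hvp : v ∈ p.support := p.start_mem_support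
    have hpH : ∀ z ∈ p.support, z ∈ H := fun z hz => hp z (by simp [hz])
    have huv : u ≠ v := a.ne
    have huh : u ≠ h := by rintro rfl; exact hh hu
    by_cases hv : v ∈ Set.range f
    · obtain ⟨g, g1, g2, g3, g4⟩ := ih f hf hpH hv hh
      have hvh : v ≠ h := by rintro rfl; exact hh hv
      obtain ⟨r, hr⟩ : u ∈ Set.range g := by rw [g3]; right; exact ⟨hu, huv⟩
      obtain ⟨m1, m2, m3⟩ := move1 g2 r v (by rw [hr]; exact a) (hpH v hvp) (by
        rw [g3]; simp [hvh])
      refine ⟨_, g1.trans m1.reach, m2, ?_, ?_⟩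
      · rw [m3, g3, hr]
        ext z
        simp only [Set.mem_insert_iff, Set.mem_sdiff, Set.mem_singleton_iff]
        by_cases z1 : z = v
        · subst z1; simp [hv, huv.symm]
        · by_cases z2 : z = h
          · subst z2; simp [huh.symm]
          · simp [z1, z2]
      · intro s hs
        simp only [Walk.support_cons, List.mem_cons, not_or] at hs
        have hgs := g4 s hs.2
        rw [Function.update_of_ne, hgs]
        rintro rfl
        exact hs.1 (by rw [← hgs, hr])
    · obtain ⟨r, hr⟩ := hu
      obtain ⟨m1, m2, m3⟩ := move1 hf r v (by rw [hr]; exact a) (hpH v hvp) hv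
      have hs' : ∀ s, f s ∉ (Walk.cons a p).support → Function.update f r v s = f s := by
        intro s hs
        rw [Function.update_of_ne]
        rintro rfl
        apply hs; simp [hr]
      by_cases hvh : v = h
      · subst hvh
        refine ⟨_, m1.reach.mono (by simp), m2, by rw [m3, hr], hs'⟩
      · obtain ⟨g, g1, g2, g3, g4⟩ := ih _ m2 hpH (by rw [m3]; simp) (by
          rw [m3]; simp only [Set.mem_insert_iff, Set.mem_sdiff, not_or]
          exact ⟨fun h => hvh h.symm, fun h => hh h.1⟩)
        refine ⟨g, (m1.reach.trans g1).mono (by simp; omega), g2, ?_, ?_⟩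
        · rw [g3, m3, hr]
          ext z
          simp only [Set.mem_insert_iff, Set.mem_sdiff, Set.mem_singleton_iff]
          by_cases z1 : z = v
          · subst z1; simp [hv]
          · simp [z1]
        · intro s hs
          rw [g4, hs' s hs]
          rw [hs' s hs]
          intro h; apply hs; simp [h]

theorem clear {G : SimpleGraph V} {H : Set V} {u h : V} (p : G.Walk u h)
    (f : R → V) (hf : Good H f) (hp : ∀ z ∈ p.support, z ∈ H) (hh : h ∉ Set.range f) :
    ∃ g, Reach G H p.length f g ∧ Good H g ∧ u ∉ Set.range g ∧
      Set.range g ⊆ insert h (Set.range f) ∧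
      ∀ r, f r ∉ p.support → g r = f r := by
  by_cases hu : u ∈ Set.range f
  · obtain ⟨g, g1, g2, g3, g4⟩ := push p f hf hp hu hh
    have huh : u ≠ h := by rintro rfl; exact hh hu
    refine ⟨g, g1, g2, by rw [g3]; simp [huh], ?_, g4⟩
    rw [g3]
    exact Set.insert_subset_insert Set.sdiff_subset
  · exact ⟨f, Reach.refl _ _, hf, hu, Set.subset_insert _ _, fun _ _ => rfl⟩

theorem gather [Fintype R] {G : SimpleGraph V} {H : Set V} (D : ℕ)
    (hD : ∀ u ∈ H, ∀ v ∈ H, ∃ p : G.Walk u v, p.length ≤ D ∧ ∀ z ∈ p.support, z ∈ H)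
    (B : Set V) (hB : B ⊆ H) (hc : Fintype.card R ≤ B.ncard) :
    ∀ (m : ℕ) (f : R → V), Good H f → (Set.range f \ B).ncard = m →
      ∃ g, Reach G H (D * m) f g ∧ Good H g ∧ Set.range g ⊆ B := by
  intro m
  induction m with
  | zero =>
    intro f hf hm
    refine ⟨f, Reach.refl _ _, hf, ?_⟩
    rw [Set.ncard_eq_zero ((Set.finite_range f).sdiff)] at hm
    exact Set.sdiff_eq_empty.mp hm
  | succ m ih =>
    intro f hf hm
    obtain ⟨u, hu⟩ : (Set.range f \ B).Nonempty := by
      apply Set.nonempty_of_ncard_ne_zero; omega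
    have hcf : (Set.range f).ncard = Fintype.card R := by
      rw [← Set.image_univ, Set.ncard_image_of_injective _ hf.1, Set.ncard_univ,
        Nat.card_eq_fintype_card]
    obtain ⟨h, hh⟩ : (B \ Set.range f).Nonempty := by
      by_contra hne
      rw [Set.not_nonempty_iff_eq_empty, Set.sdiff_eq_empty] at hne
      have := Set.eq_of_subset_of_ncard_le hne (by omega) (Set.finite_range f)
      rw [this] at hu
      exact hu.2 hu.1
    obtain ⟨r, hr⟩ := hu.1
    obtain ⟨p, p1, p2⟩ := hD u (by rw [← hr]; exact hf.2 r) h (hB hh.1)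
    obtain ⟨g, g1, g2, g3, g4⟩ := push p f hf p2 hu.1 hh.2
    obtain ⟨g', k1, k2, k3⟩ := ih g g2 (by
      have : Set.range g \ B = (Set.range f \ B) \ {u} := by
        rw [g3]; ext z
        simp only [Set.mem_sdiff, Set.mem_insert_iff, Set.mem_singleton_iff]
        constructor
        · rintro ⟨rfl | h1, h2⟩
          · exact absurd hh.1 h2
          · tauto
        · tauto
      rw [this, Set.ncard_sdiff_singleton_of_mem hu, hm]; rfl)
    exact ⟨g', (g1.trans k1).mono (by rw [mul_add]; omega), k2, k3⟩

open Classical in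
theorem bring [Fintype R] {G : SimpleGraph V} {H : Set V} {k : ℕ} {w v : V} (V1 V2 : Set V)
    (h1H : V1 ⊆ H) (h2H : V2 ⊆ H) (h12 : V1 ∩ V2 = {w})
    (hV2 : k + 1 ≤ V2.ncard) (hR : Fintype.card R ≤ k)
    (hp2 : ∀ u ∈ V2, ∃ p : G.Walk w u, p.length ≤ k ∧ ∀ z ∈ p.support, z ∈ V2)
    (p : G.Walk v w) (c : R) : p.IsPath → p.length ≤ k → (∀ z ∈ p.support, z ∈ V1) →
    ∀ f : R → V, Good H f → f c = v →
    ∃ g, Reach G H (p.length * (2 * k + 1)) f g ∧ Good H g ∧ g c = w ∧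
      Set.range g ⊆ Set.range f ∪ (V1 ∪ V2) ∧ ∀ r, f r ∉ V1 ∪ V2 → g r = f r := by
  induction p with
  | nil => intro _ _ _ f hf hc; exact ⟨f, Reach.refl _ _, hf, hc, by simp, by simp⟩
  | @cons v v1 w a p ih =>
    intro hpath hlen hp f hf hc
    rw [Walk.cons_isPath_iff] at hpath
    have hpV : ∀ z ∈ p.support, z ∈ V1 := fun z hz => hp z (by simp [hz])
    have hv1 : v1 ∈ V1 := hpV _ p.start_mem_support
    have hvV : v ∈ V1 := hp v (by simp)
    simp only [Walk.length_cons] at hlen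
    have hcf : (Set.range f).ncard = Fintype.card R := by
      rw [← Set.image_univ, Set.ncard_image_of_injective _ hf.1, Set.ncard_univ,
        Nat.card_eq_fintype_card]
    obtain ⟨h, hh, hhf⟩ : (V2 \ Set.range f).Nonempty := by
      by_contra hne
      rw [Set.not_nonempty_iff_eq_empty, Set.sdiff_eq_empty] at hne
      have := Set.ncard_le_ncard hne (Set.finite_range f)
      omega
    obtain ⟨q, q1, q2⟩ := hp2 h hh
    have hsup : ∀ z ∈ (p.append q).support, z ∈ V1 ∪ V2 := by
      intro z hz
      rw [Walk.mem_support_append_iff] at hz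
      exact hz.imp (hpV z) (q2 z)
    obtain ⟨g, g1, g2, g3, g4, g5⟩ := clear (p.append q) f hf
      (fun z hz => (hsup z hz).elim (fun h => h1H h) (fun h => h2H h)) hhf
    have hgc : g c = v := by
      rw [g5 c, hc]
      rw [hc, Walk.mem_support_append_iff]
      rintro (h | h)
      · exact hpath.2 h
      · have : v ∈ V1 ∩ V2 := ⟨hvV, q2 v h⟩
        rw [h12] at this
        rw [Set.mem_singleton_iff] at this
        subst this
        exact hpath.2 p.end_mem_support
    obtain ⟨m1, m2, m3⟩ := move1 g2 c v1 (by rw [hgc]; exact a) (h1H hv1) g3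
    obtain ⟨g', k1, k2, k3, k4, k5⟩ := ih h12 hp2 hpath.1 (by omega) hpV _ m2 (by simp)
    refine ⟨g', ((g1.trans m1.reach).trans k1).mono ?_, k2, k3, ?_, ?_⟩
    · simp only [Walk.length_append, Walk.length_cons]
      rw [add_mul]; omega
    · refine k4.trans ?_
      rw [m3]
      intro z hz
      rcases hz with (rfl | hz) | hz
      · exact Or.inr (Or.inl hv1)
      · rcases g4 hz.1 with rfl | hz
        · exact Or.inr (Or.inr hh)
        · exact Or.inl hz
      · exact Or.inr hz
    · intro r hr
      have e1 : g r = f r := g5 r (fun h => hr (hsup _ h))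
      have e2 : Function.update g c v1 r = f r := by
        rw [Function.update_of_ne, e1]
        rintro rfl
        apply hr; rw [hc]; exact Or.inl hvV
      rw [k5, e2]
      rwa [e2]

open Classical in
theorem clearNbr [Fintype R] {G : SimpleGraph V} {H : Set V} {k : ℕ} {w : V} (V1 : Set V)
    (h1H : V1 ⊆ H) (hV1 : k + 1 ≤ V1.ncard) (hR : Fintype.card R ≤ k)
    (hp1 : ∀ u ∈ V1, ∃ p : G.Walk w u, p.IsPath ∧ p.length ≤ k ∧ ∀ z ∈ p.support, z ∈ V1)
    (f : R → V) (hf : Good H f) (hw : w ∈ Set.range f) :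
    ∃ g y, Reach G H k f g ∧ Good H g ∧ y ∈ V1 ∧ G.Adj w y ∧ y ∉ Set.range g ∧
      Set.range g ⊆ Set.range f ∪ (V1 \ {w}) ∧ ∀ r, (f r ∉ V1 ∨ f r = w) → g r = f r := by
  have hcf : (Set.range f).ncard = Fintype.card R := by
    rw [← Set.image_univ, Set.ncard_image_of_injective _ hf.1, Set.ncard_univ,
      Nat.card_eq_fintype_card]
  obtain ⟨h, hh, hhf⟩ : (V1 \ Set.range f).Nonempty := by
    by_contra hne
    rw [Set.not_nonempty_iff_eq_empty, Set.sdiff_eq_empty] at hne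
    have := Set.ncard_le_ncard hne (Set.finite_range f)
    omega
  obtain ⟨p, p1, p2, p3⟩ := hp1 h hh
  cases p with
  | nil => exact absurd hw hhf
  | @cons _ y _ a p =>
    rw [Walk.cons_isPath_iff] at p1
    simp only [Walk.length_cons] at p2
    have p4 : ∀ z ∈ p.support, z ∈ V1 := fun z hz => p3 z (by simp [hz])
    obtain ⟨g, g1, g2, g3, g4, g5⟩ := clear p f hf (fun z hz => h1H (p4 z hz)) hhf
    refine ⟨g, y, g1.mono (by omega), g2, p4 _ p.start_mem_support, a, g3, ?_, ?_⟩
    · refine g4.trans ?_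
      rintro z (rfl | hz)
      · refine Or.inr ⟨hh, ?_⟩
        rintro rfl
        exact hhf hw
      · exact Or.inl hz
    · intro r hr
      apply g5
      rcases hr with hr | hr
      · exact fun h => hr (p4 _ h)
      · rw [hr]; exact p1.2

open Classical in
theorem localSwap {G : SimpleGraph V} {H : Set V} {w x y z : V} (f : R → V) (hf : Good H f)
    (a b : R) (ha : f a = x) (hb : f b = w) (hab : a ≠ b)
    (hx : G.Adj w x) (hy : G.Adj w y) (hz : G.Adj w z)
    (hyH : y ∈ H) (hzH : z ∈ H) (hyz : y ≠ z)
    (hyf : y ∉ Set.range f) (hzf : z ∉ Set.range f) :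
    Reach G H 6 f (f ∘ Equiv.swap a b) := by
  have hxH : x ∈ H := ha ▸ hf.2 a
  have hwH : w ∈ H := hb ▸ hf.2 b
  have hxy : x ≠ y := fun h => hyf ⟨a, ha.trans h⟩
  have hxz : x ≠ z := fun h => hzf ⟨a, ha.trans h⟩
  let c : V → V → R → V := fun p q r => if r = a then p else if r = b then q else f r
  have hoth : ∀ r, r ≠ a → r ≠ b → f r ≠ w ∧ f r ≠ x ∧ f r ≠ y ∧ f r ≠ z := by
    intro r h1 h2
    exact ⟨fun h => h2 (hf.1 (h.trans hb.symm)), fun h => h1 (hf.1 (h.trans ha.symm)),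
      fun h => hyf ⟨r, h⟩, fun h => hzf ⟨r, h⟩⟩
  have hgood : ∀ p q, p ≠ q → (p = w ∨ p = x ∨ p = y ∨ p = z) →
      (q = w ∨ q = x ∨ q = y ∨ q = z) → Good H (c p q) := by
    intro p q hpq hp hq
    have hpo : ∀ r, r ≠ a → r ≠ b → f r ≠ p := by
      intro r h1 h2
      obtain ⟨e1, e2, e3, e4⟩ := hoth r h1 h2
      rcases hp with rfl | rfl | rfl | rfl <;> assumption
    have hqo : ∀ r, r ≠ a → r ≠ b → f r ≠ q := by
      intro r h1 h2
      obtain ⟨e1, e2, e3, e4⟩ := hoth r h1 h2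
      rcases hq with rfl | rfl | rfl | rfl <;> assumption
    constructor
    · intro r s hrs
      simp only [c] at hrs
      by_cases r1 : r = a <;> by_cases s1 : s = a <;> by_cases r2 : r = b <;>
        by_cases s2 : s = b <;> simp only [r1, s1, r2, s2, if_true, if_false] at hrs ⊢ <;>
        first
        | exact hf.1 hrs
        | exact absurd hrs hpq
        | exact absurd hrs.symm hpq
        | exact absurd hrs.symm (hpo _ s1 s2)
        | exact absurd hrs (hpo _ r1 r2)
        | exact absurd hrs.symm (hqo _ s1 s2)
        | exact absurd hrs (hqo _ r1 r2)
        | grind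
    · intro r
      simp only [c]
      split_ifs
      · rcases hp with rfl | rfl | rfl | rfl <;> assumption
      · rcases hq with rfl | rfl | rfl | rfl <;> assumption
      · exact hf.2 r
  have hma : ∀ p q p', Good H (c p q) → Good H (c p' q) → G.Adj p p' →
      Move G H (c p q) (c p' q) := by
    intro p q p' h1 h2 h3
    refine ⟨h1, h2, a, by simpa [c] using h3, fun s hs => by simp [c, hs]⟩
  have hmb : ∀ p q q', Good H (c p q) → Good H (c p q') → G.Adj q q' →
      Move G H (c p q) (c p q') := by
    intro p q q' h1 h2 h3
    refine ⟨h1, h2, b, by simpa [c, hab.symm] using h3, fun s hs => by simp [c, hs]⟩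
  have e0 : f = c x w := by
    funext r
    simp only [c]
    split_ifs with h1 h2
    · rw [h1, ha]
    · rw [h2, hb]
    · rfl
  have e1 : f ∘ Equiv.swap a b = c w x := by
    funext r
    simp only [c, Function.comp]
    split_ifs with h1 h2
    · rw [h1, Equiv.swap_apply_left, hb]
    · rw [h2, Equiv.swap_apply_right, ha]
    · rw [Equiv.swap_apply_of_ne_of_ne h1 h2]
  rw [e1]
  have g0 := hgood x w hx.ne' (by simp) (by simp)
  have g1 := hgood x y hxy (by simp) (by simp)
  have g2 := hgood w y hy.ne (by simp) (by simp)
  have g3 := hgood z y hyz.symm (by simp) (by simp)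
  have g4 := hgood z w hz.ne' (by simp) (by simp)
  have g5 := hgood z x hxz.symm (by simp) (by simp)
  have g6 := hgood w x hx.ne (by simp) (by simp)
  have := Reach.cons (hmb _ _ _ g0 g1 hy) <| Reach.cons (hma _ _ _ g1 g2 hx.symm) <|
    Reach.cons (hma _ _ _ g2 g3 hz) <| Reach.cons (hmb _ _ _ g3 g4 hy.symm) <|
    Reach.cons (hmb _ _ _ g4 g5 hx) <| Reach.cons (hma _ _ _ g5 g6 hz.symm) (Reach.refl 0 _)
  rw [← e0] at this
  exact this

structure Setup (G : SimpleGraph V) (H : Set V) (k : ℕ) (w x : V) (V1 V2 : Set V) : Prop where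
  k1 : 1 ≤ k
  h1 : V1 ⊆ H
  h2 : V2 ⊆ H
  hx : x ∈ H
  x1 : x ∉ V1
  x2 : x ∉ V2
  h12 : V1 ∩ V2 = {w}
  wx : G.Adj w x
  c1 : V1.ncard = k + 1
  c2 : V2.ncard = k + 1
  p1 : ∀ u ∈ V1, ∃ p : G.Walk w u, p.IsPath ∧ p.length ≤ k ∧ ∀ z ∈ p.support, z ∈ V1
  p2 : ∀ u ∈ V2, ∃ p : G.Walk w u, p.IsPath ∧ p.length ≤ k ∧ ∀ z ∈ p.support, z ∈ V2
  pH : ∀ u ∈ H, ∃ p : G.Walk w u, p.length ≤ k ∧ ∀ z ∈ p.support, z ∈ H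

theorem Setup.diam {G : SimpleGraph V} {H : Set V} {k : ℕ} {w x : V} {V1 V2 : Set V}
    (h : Setup G H k w x V1 V2) : ∀ u ∈ H, ∀ v ∈ H, ∃ p : G.Walk u v, p.length ≤ 2 * k ∧
      ∀ z ∈ p.support, z ∈ H := by
  intro u hu v hv
  obtain ⟨p, p1, p2⟩ := h.pH u hu
  obtain ⟨q, q1, q2⟩ := h.pH v hv
  refine ⟨p.reverse.append q, by simp; omega, fun z hz => ?_⟩
  rw [Walk.mem_support_append_iff, Walk.support_reverse, List.mem_reverse] at hz
  exact hz.elim (p2 z) (q2 z)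

theorem Setup.bring' [Fintype R] {G : SimpleGraph V} {H : Set V} {k : ℕ} {w x : V}
    {V1 V2 : Set V}
    (h : Setup G H k w x V1 V2) (hR : Fintype.card R ≤ k) (f : R → V) (hf : Good H f) (c : R)
    (hc : f c ∈ V1 ∪ V2) :
    ∃ g, Reach G H (k * (2 * k + 1)) f g ∧ Good H g ∧ g c = w ∧
      Set.range g ⊆ Set.range f ∪ (V1 ∪ V2) ∧ ∀ r, f r ∉ V1 ∪ V2 → g r = f r := by
  rcases hc with hc | hc
  · obtain ⟨p, q1, q2, q3⟩ := h.p1 _ hc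
    obtain ⟨g, g1, g2⟩ := bring V1 V2 h.h1 h.h2 h.h12 h.c2.ge hR
      (fun u hu => (h.p2 u hu).imp fun p hp => hp.2) p.reverse c q1.reverse (by simpa using q2)
      (by simpa using q3) f hf rfl
    exact ⟨g, g1.mono (Nat.mul_le_mul_right _ (by simpa using q2)), g2⟩
  · obtain ⟨p, q1, q2, q3⟩ := h.p2 _ hc
    obtain ⟨g, g1, g2⟩ := bring V2 V1 h.h2 h.h1 (by rw [Set.inter_comm]; exact h.h12) h.c1.ge hR
      (fun u hu => (h.p1 u hu).imp fun p hp => hp.2) p.reverse c q1.reverse (by simpa using q2)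
      (by simpa using q3) f hf rfl
    rw [Set.union_comm V2 V1] at g2
    exact ⟨g, g1.mono (Nat.mul_le_mul_right _ (by simpa using q2)), g2⟩

open Classical in
theorem Setup.swap [Fintype R] {G : SimpleGraph V} {H : Set V} {k : ℕ} {w x : V}
    {V1 V2 : Set V}
    (h : Setup G H k w x V1 V2) (hR : Fintype.card R ≤ k) (f : R → V) (hf : Good H f) (a b : R)
    (hab : a ≠ b) : Reach G H (30 * k ^ 2) f (f ∘ Equiv.swap a b) := by
  have hx12 : x ∉ V1 ∪ V2 := fun hh => hh.elim h.x1 h.x2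
  have hw1 : w ∈ V1 := (h.h12.ge (Set.mem_singleton w)).1
  have hk := h.k1
  -- gather everything inside V1
  obtain ⟨f1, r1, gd1, ra1⟩ := gather (2 * k) h.diam V1 h.h1 (by rw [h.c1]; omega) _ f hf rfl
  have hm : (Set.range f \ V1).ncard ≤ k := by
    refine (Set.ncard_le_ncard Set.sdiff_subset (Set.finite_range f)).trans ?_
    rw [← Set.image_univ, Set.ncard_image_of_injective _ hf.1, Set.ncard_univ,
      Nat.card_eq_fintype_card]
    exact hR
  have r1' : Reach G H (2 * k * k) f f1 := r1.mono (Nat.mul_le_mul_left _ hm)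
  obtain ⟨f2, r2, gd2, a2, ra2, -⟩ := h.bring' hR f1 gd1 a (Or.inl (ra1 ⟨a, rfl⟩))
  have ra2' : Set.range f2 ⊆ V1 ∪ V2 := by
    refine ra2.trans ?_
    rintro z (hz | hz)
    · exact Or.inl (ra1 hz)
    · exact hz
  obtain ⟨m3, gd3, -⟩ := move1 gd2 a x (by rw [a2]; exact h.wx) h.hx (fun hh => hx12 (ra2' hh))
  obtain ⟨f4, r4, gd4, b4, -, u4⟩ := h.bring' hR _ gd3 b (by
    rw [Function.update_of_ne hab.symm]; exact ra2' ⟨b, rfl⟩)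
  have a4 : f4 a = x := by
    rw [u4 a (by simpa using hx12)]; simp
  obtain ⟨f5, y, r5, gd5, y5, wy, yf5, -, u5⟩ := clearNbr V1 h.h1 h.c1.ge hR h.p1 f4 gd4 ⟨b, b4⟩
  have b5 : f5 b = w := by rw [u5 b (Or.inr b4), b4]
  have a5 : f5 a = x := by rw [u5 a (Or.inl (by rw [a4]; exact h.x1)), a4]
  obtain ⟨f6, z, r6, gd6, z6, wz, zf6, ra6, u6⟩ :=
    clearNbr V2 h.h2 h.c2.ge hR h.p2 f5 gd5 ⟨b, b5⟩
  have b6 : f6 b = w := by rw [u6 b (Or.inr b5), b5]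
  have a6 : f6 a = x := by rw [u6 a (Or.inl (by rw [a5]; exact h.x2)), a5]
  have hy2 : y ∉ V2 := by
    intro hh
    have : y ∈ V1 ∩ V2 := ⟨y5, hh⟩
    rw [h.h12, Set.mem_singleton_iff] at this
    exact wy.ne this.symm
  have yf6 : y ∉ Set.range f6 := by
    intro hh
    rcases ra6 hh with hh | hh
    · exact yf5 hh
    · exact hy2 hh.1
  have hyz : y ≠ z := by rintro rfl; exact hy2 z6
  have r7 := localSwap f6 gd6 a b a6 b6 hab h.wx wy wz (h.h1 y5) (h.h2 z6) hyz yf6 zf6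
  have rr := ((((r1'.trans r2).trans m3.reach).trans r4).trans r5).trans r6
  refine ((rr.trans r7).trans (rr.symm.comp (Equiv.swap a b))).mono ?_
  nlinarith

open Classical in
theorem Setup.perm [Fintype R] {G : SimpleGraph V} {H : Set V} {k : ℕ} {w x : V}
    {V1 V2 : Set V}
    (h : Setup G H k w x V1 V2) (hR : Fintype.card R ≤ k) (f' : R → V) (hf' : Good H f') :
    ∀ (m : ℕ) (g : R → V), Good H g → Set.range g = Set.range f' →
      {r | g r ≠ f' r}.ncard ≤ m → Reach G H (30 * k ^ 2 * m) g f' := by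
  intro m
  induction m with
  | zero =>
    intro g hg hr hm
    have : {r | g r ≠ f' r} = ∅ := by
      rw [← Set.ncard_eq_zero (Set.toFinite _)]; omega
    have e : g = f' := by
      funext r
      by_contra hne
      exact (this.le hne : r ∈ (∅ : Set R))
    rw [e]; exact Reach.refl _ _
  | succ m ih =>
    intro g hg hr hm
    by_cases e : g = f'
    · rw [e]; exact Reach.refl _ _
    · obtain ⟨r, hne⟩ := Function.ne_iff.mp e
      obtain ⟨s, hs⟩ : f' r ∈ Set.range g := by rw [hr]; exact ⟨r, rfl⟩
      have hrs : r ≠ s := by rintro rfl; exact hne hs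
      have hss : g s ≠ f' s := by
        rw [hs]; exact fun h => hrs (hf'.1 h)
      have q := h.swap hR g hg r s hrs
      have q2 := ih (g ∘ Equiv.swap r s)
        ⟨hg.1.comp (Equiv.injective _), fun _ => hg.2 _⟩
        (by rw [(Equiv.surjective _).range_comp, hr]) (by
          have hsub : {t | (g ∘ Equiv.swap r s) t ≠ f' t} ⊆ {t | g t ≠ f' t} \ {r} := by
            intro t ht
            simp only [Function.comp, Set.mem_ofPred_eq] at ht
            by_cases t1 : t = r
            · subst t1
              rw [Equiv.swap_apply_left] at ht
              exact absurd hs ht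
            · refine ⟨?_, t1⟩
              by_cases t2 : t = s
              · subst t2; exact hss
              · rw [Equiv.swap_apply_of_ne_of_ne t1 t2] at ht
                exact ht
          have := Set.ncard_le_ncard hsub (Set.toFinite _)
          rw [Set.ncard_sdiff_singleton_of_mem hne] at this
          omega)
      exact (q.trans q2).mono (by rw [mul_add]; omega)

theorem Setup.main [Fintype R] {G : SimpleGraph V} {H : Set V} {k : ℕ} {w x : V}
    {V1 V2 : Set V}
    (h : Setup G H k w x V1 V2) (hR : Fintype.card R ≤ k) (f f' : R → V) (hf : Good H f)
    (hf' : Good H f') : Reach G H (32 * k ^ 3) f f' := by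
  have hcard : ∀ f : R → V, Good H f → (Set.range f).ncard = Fintype.card R := by
    intro f hf
    rw [← Set.image_univ, Set.ncard_image_of_injective _ hf.1, Set.ncard_univ,
        Nat.card_eq_fintype_card]
  obtain ⟨g, r1, gg, hr⟩ := gather (2 * k) h.diam (Set.range f')
    (by rintro _ ⟨r, rfl⟩; exact hf'.2 r) (hcard _ hf').ge _ f hf rfl
  have hm : (Set.range f \ Set.range f').ncard ≤ k := by
    refine (Set.ncard_le_ncard Set.sdiff_subset (Set.finite_range f)).trans ?_
    rw [hcard f hf]; exact hR
  have hr' : Set.range g = Set.range f' := Set.eq_of_subset_of_ncard_le hr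
    (by rw [hcard _ hf', hcard _ gg]) (Set.finite_range _)
  have r2 := h.perm hR f' hf' k g gg hr' (by
    refine (Set.ncard_le_ncard (Set.subset_univ _) (Set.toFinite _)).trans ?_
    rw [Set.ncard_univ, Nat.card_eq_fintype_card]; exact hR)
  refine (r1.trans r2).mono ?_
  have : 2 * k * (Set.range f \ Set.range f').ncard ≤ 2 * k * k := Nat.mul_le_mul_left _ hm
  have hk := h.k1
  have : 2 * k * k ≤ 2 * k * k * k := Nat.le_mul_of_pos_right _ hk
  nlinarith

theorem projWalk {U : Type} {K : SimpleGraph U} {G : SimpleGraph V} (φ : K →g G) {a b : U}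
    (p : K.Walk a b) : ∃ q : G.Walk (φ a) (φ b), q.length = p.length ∧
      ∀ z ∈ q.support, ∃ y ∈ p.support, φ y = z := by
  refine ⟨p.map φ, Walk.length_map _ _, ?_⟩
  intro z hz
  rw [Walk.support_map, List.mem_map] at hz
  exact hz

theorem subWalk {G : SimpleGraph V} (C : G.Subgraph) (hC : C.Connected) {u v : V}
    (hu : u ∈ C.verts) (hv : v ∈ C.verts) :
    ∃ p : G.Walk u v, ∀ z ∈ p.support, z ∈ C.verts := by
  obtain ⟨p⟩ := hC.coe.preconnected ⟨u, hu⟩ ⟨v, hv⟩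
  obtain ⟨q, -, hq⟩ := projWalk C.hom p
  refine ⟨q, ?_⟩
  intro z hz
  obtain ⟨y, -, rfl⟩ := hq z hz
  exact y.2

theorem grow {G : SimpleGraph V} (C : G.Subgraph) (hC : C.Connected) {w : V}
    (hw : w ∈ C.verts) : ∀ n : ℕ, n + 1 ≤ C.verts.ncard → ∃ W : Set V, W ⊆ C.verts ∧
      W.ncard = n + 1 ∧ w ∈ W ∧ ∀ u ∈ W, ∃ p : G.Walk w u, ∀ z ∈ p.support, z ∈ W := by
  intro n
  induction n with
  | zero =>
    intro _
    refine ⟨{w}, by simpa, by simp, by simp, ?_⟩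
    rintro u rfl
    exact ⟨Walk.nil, by simp⟩
  | succ n ih =>
    intro hn
    obtain ⟨W, h1, h2, h3, h4⟩ := ih (by omega)
    have hfin : W.Finite := Set.finite_of_ncard_ne_zero (by omega)
    obtain ⟨c, hc, hcW⟩ : (C.verts \ W).Nonempty := by
      by_contra hne
      rw [Set.not_nonempty_iff_eq_empty, Set.sdiff_eq_empty] at hne
      have := Set.ncard_le_ncard hne hfin
      omega
    obtain ⟨p, hp⟩ := subWalk C hC hw hc
    obtain ⟨d, d1, d2, d3⟩ := p.exists_boundary_dart W h3 hcW
    refine ⟨insert d.snd W, ?_, ?_, Or.inr h3, ?_⟩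
    · exact Set.insert_subset (hp _ (p.dart_snd_mem_support_of_mem_darts d1)) h1
    · rw [Set.ncard_insert_of_notMem d3 hfin, h2]
    · rintro u (rfl | hu)
      · obtain ⟨q, hq⟩ := h4 _ d2
        refine ⟨q.concat d.adj, ?_⟩
        intro z hz
        rw [Walk.support_concat] at hz
        simp only [List.mem_append, List.mem_singleton] at hz
        rcases hz with hz | hz
        · exact Or.inr (hq z hz)
        · exact Or.inl hz
      · obtain ⟨q, hq⟩ := h4 _ hu
        exact ⟨q, fun z hz => Or.inr (hq z hz)⟩

open Classical in
theorem grow' {G : SimpleGraph V} (C : G.Subgraph) (hC : C.Connected) {w : V}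
    (hw : w ∈ C.verts) (n : ℕ) (hn : n + 1 ≤ C.verts.ncard) : ∃ W : Set V, W ⊆ C.verts ∧
      W.ncard = n + 1 ∧ w ∈ W ∧ ∀ u ∈ W, ∃ p : G.Walk w u, p.IsPath ∧ p.length ≤ n ∧
        ∀ z ∈ p.support, z ∈ W := by
  obtain ⟨W, h1, h2, h3, h4⟩ := grow C hC hw n hn
  have hfin : W.Finite := Set.finite_of_ncard_ne_zero (by omega)
  refine ⟨W, h1, h2, h3, fun u hu => ?_⟩
  obtain ⟨p, hp⟩ := h4 u hu
  have hs : ∀ z ∈ p.bypass.support, z ∈ W := fun z hz => hp z (p.support_bypass_subset_support hz)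
  refine ⟨p.bypass, p.bypass_isPath, ?_, hs⟩
  have hsub : ((p.bypass.support.toFinset : Finset V) : Set V) ⊆ W := by
    intro z hz
    exact hs z (by simpa using hz)
  have := Set.ncard_le_ncard hsub hfin
  rw [Set.ncard_coe_finset, List.toFinset_card_of_nodup p.bypass_isPath.support_nodup,
    Walk.length_support] at this
  omega

theorem dist_le_of_walk {G : SimpleGraph V} {U : Set V} {w u : V} (hw : w ∈ U) (hu : u ∈ U)
    (p : G.Walk w u) (hp : ∀ z ∈ p.support, z ∈ U) :
    (G.induce U).dist ⟨w, hw⟩ ⟨u, hu⟩ ≤ p.length := by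
  have h := SimpleGraph.dist_le (p.induce U hp)
  have e : (p.induce U hp).length + 1 = p.length + 1 := by
    rw [← Walk.length_support, ← Walk.length_support, Walk.support_induce]
    simp
  omega

open Classical in
theorem setup_of_haven {G : SimpleGraph V} {k : ℕ} {w x : V} {C1 C2 C3 : G.Subgraph}
    {H : Set V} (hk : 1 ≤ k) (h : IsHavenWith G k w C1 C2 C3 x H) :
    ∃ V1 V2, Setup G H k w x V1 V2 := by
  obtain ⟨hC1, hC2, hC3, h12, h13, h23, n1, n2, n3, hx3, hwx, hw, rfl⟩ := h
  have w1 : w ∈ C1.verts := (h12.ge (Set.mem_singleton w)).1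
  have w2 : w ∈ C2.verts := (h12.ge (Set.mem_singleton w)).2
  have xC1 : x ∉ C1.verts := fun hh => hwx.ne (h13.le ⟨hh, hx3⟩ : x = w).symm
  have xC2 : x ∉ C2.verts := fun hh => hwx.ne (h23.le ⟨hh, hx3⟩ : x = w).symm
  obtain ⟨V1, a1, a2, a3, a4⟩ := grow' C1 hC1 w1 k n1
  obtain ⟨V2, b1, b2, b3, b4⟩ := grow' C2 hC2 w2 k n2
  have s1 : C1.verts ⊆ {x} ∪ C1.verts ∪ C2.verts := fun z hz => Or.inl (Or.inr hz)
  have s2 : C2.verts ⊆ {x} ∪ C1.verts ∪ C2.verts := fun z hz => Or.inr hz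
  have sx : x ∈ {x} ∪ C1.verts ∪ C2.verts := Or.inl (Or.inl rfl)
  have hreach : ∀ u (hu : u ∈ {x} ∪ C1.verts ∪ C2.verts),
      (G.induce ({x} ∪ C1.verts ∪ C2.verts : Set V)).Reachable ⟨w, hw⟩ ⟨u, hu⟩ := by
    intro u hu
    have hu' := hu
    rcases hu' with (hux | hu1) | hu2
    · have hux : u = x := hux
      subst hux
      exact SimpleGraph.Adj.reachable (by simpa using hwx)
    · obtain ⟨p, hp⟩ := subWalk C1 hC1 w1 hu1
      exact ⟨p.induce _ (fun z hz => s1 (hp z hz))⟩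
    · obtain ⟨p, hp⟩ := subWalk C2 hC2 w2 hu2
      exact ⟨p.induce _ (fun z hz => s2 (hp z hz))⟩
  refine ⟨V1, V2, hk, ?_, ?_, ?_, fun hh => xC1 (a1 hh), fun hh => xC2 (b1 hh), ?_, hwx, a2, b2,
    a4, b4, ?_⟩
  · intro u hu
    obtain ⟨p, -, p2, p3⟩ := a4 u hu
    exact ⟨s1 (a1 hu), (dist_le_of_walk hw _ p (fun z hz => s1 (a1 (p3 z hz)))).trans p2⟩
  · intro u hu
    obtain ⟨p, -, p2, p3⟩ := b4 u hu
    exact ⟨s2 (b1 hu), (dist_le_of_walk hw _ p (fun z hz => s2 (b1 (p3 z hz)))).trans p2⟩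
  · refine ⟨sx, (dist_le_of_walk hw sx (Walk.cons hwx Walk.nil) ?_).trans (by simpa using hk)⟩
    intro z hz
    simp only [Walk.support_cons, Walk.support_nil, List.mem_cons, List.not_mem_nil, or_false]
      at hz
    rcases hz with rfl | rfl
    · exact hw
    · exact sx
  · ext z
    constructor
    · intro hz
      exact h12.le ⟨a1 hz.1, b1 hz.2⟩
    · intro hz
      have hz : z = w := hz
      subst hz
      exact ⟨a3, b3⟩
  · rintro u ⟨hu, hd⟩
    obtain ⟨p, hp⟩ := (hreach u hu).exists_walk_length_eq_dist
    obtain ⟨q, hq1, hq⟩ := projWalk (Embedding.induce _).toHom p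
    refine ⟨q, hq1.le.trans (hp.le.trans hd), ?_⟩
    intro z hz
    obtain ⟨y, hy, rfl⟩ := hq z hz
    refine ⟨y.2, ?_⟩
    have h1 := SimpleGraph.dist_le (p.takeUntil y hy)
    have h2 := p.length_takeUntil_le hy
    exact (h1.trans h2).trans (by omega)

theorem total_le [Fintype R] {G : SimpleGraph V} {H : Set V} (T : ℕ) (pos : ℕ → R → V)
    (h : ∀ j, j < T → Move G H (pos j) (pos (j+1))) :
    ∑ i : R, {j : ℕ | j < T ∧ pos j i ≠ pos (j + 1) i}.ncard ≤ T := by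
  classical
  have e : ∀ i, {j : ℕ | j < T ∧ pos j i ≠ pos (j + 1) i}.ncard =
      ∑ j ∈ Finset.range T, if pos j i ≠ pos (j+1) i then 1 else 0 := by
    intro i
    rw [← Finset.card_filter, ← Set.ncard_coe_finset]
    congr 1
    ext j; simp
  simp only [e]
  rw [Finset.sum_comm]
  calc _ ≤ ∑ j ∈ Finset.range T, 1 := by
        apply Finset.sum_le_sum
        intro j hj
        rw [← Finset.card_filter, Finset.card_le_one]
        obtain ⟨-, -, r, -, hr⟩ := h j (Finset.mem_range.mp hj)
        have key : ∀ a, pos j a ≠ pos (j+1) a → a = r := by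
          intro a ha
          by_contra hne
          exact ha (hr a hne).symm
        intro a ha b hb
        simp only [Finset.mem_filter] at ha hb
        rw [key a ha.2, key b hb.2]
    _ = T := by simp

end HavenAux

/-- **haven reconfiguration.** There is a universal constant `c > 0` such that:
for every GCMP instance with `k` robots, every nice vertex `w` with witnessing connected
subgraphs `C1, C2, C3` and haven `H`, every set `S` of robots located in `H` with
configuration `ι`, and every configuration `ι'` of `S` with respect to `H`, the
configuration `ι'` can be reached from `ι` by a schedule taking place entirely inside `H`
whose total traveled length is at most `c * k ^ 3`. -/
theorem haven_reconfiguration :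
    ∃ c : ℕ, 0 < c ∧
      ∀ (V : Type) (G : SimpleGraph V) (k : ℕ) (_I : Inst V G k)
        (w : V) (C1 C2 C3 : G.Subgraph) (x : V) (H : Set V),
        IsHavenWith G k w C1 C2 C3 x H →
        ∀ (S : Finset (Fin k)) (ι ι' : Fin k → V),
          Set.InjOn ι ↑S → Set.InjOn ι' ↑S →
          (∀ i ∈ S, ι i ∈ H) → (∀ i ∈ S, ι' i ∈ H) →
          ∃ (T : ℕ) (pos : ℕ → Fin k → V),
            (∀ i ∈ S, pos 0 i = ι i) ∧
            (∀ i ∈ S, pos T i = ι' i) ∧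
            (∀ j, j ≤ T → ∀ i ∈ S, pos j i ∈ H) ∧
            (∀ j, j < T → ∀ i ∈ S,
              pos (j + 1) i = pos j i ∨ G.Adj (pos j i) (pos (j + 1) i)) ∧
            (∀ j, j ≤ T → Set.InjOn (pos j) ↑S) ∧
            (∀ j, j < T → ∀ i ∈ S, ∀ i' ∈ S, i ≠ i' →
              ¬(pos (j + 1) i = pos j i' ∧ pos (j + 1) i' = pos j i)) ∧
            (∑ i ∈ S, {j : ℕ | j < T ∧ pos j i ≠ pos (j + 1) i}.ncard) ≤ c * k ^ 3 := by
  classical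
  refine ⟨32, by norm_num, ?_⟩
  intro V G k _ w C1 C2 C3 x H hH S ι ι' hι hι' hιH hιH'
  rcases Nat.eq_zero_or_pos k with hk | hk
  · subst hk
    exact ⟨0, fun _ => ι, by simp, fun i => i.elim0, by simp [hιH], by simp, by simp [hι],
      by simp, by simp⟩
  obtain ⟨V1, V2, hs⟩ := HavenAux.setup_of_haven hk hH
  have hf : HavenAux.Good H (fun i : S => ι i) :=
    ⟨fun a b hab => Subtype.ext (hι a.2 b.2 hab), fun a => hιH a a.2⟩
  have hf' : HavenAux.Good H (fun i : S => ι' i) :=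
    ⟨fun a b hab => Subtype.ext (hι' a.2 b.2 hab), fun a => hιH' a a.2⟩
  have hc : Fintype.card S ≤ k := by
    rw [Fintype.card_coe]
    simpa using Finset.card_le_univ S
  obtain ⟨T, pos, hT, h0, h1, hm⟩ := (hs.main hc _ _ hf hf').seq
  have hg : ∀ j, j ≤ T → HavenAux.Good H (pos j) := by
    intro j hj
    rcases j with _ | j
    · rw [h0]; exact hf
    · exact (hm j (by omega)).2.1
  have e : ∀ j i (hi : i ∈ S),
      (fun (j : ℕ) (i : Fin k) => if h : i ∈ S then pos j ⟨i, h⟩ else w) j i = pos j ⟨i, hi⟩ := by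
    intro j i hi; simp [hi]
  refine ⟨T, fun j i => if h : i ∈ S then pos j ⟨i, h⟩ else w, ?_, ?_, ?_, ?_, ?_, ?_, ?_⟩
  · intro i hi; rw [e 0 i hi, h0]
  · intro i hi; rw [e T i hi, h1]
  · intro j hj i hi; rw [e j i hi]; exact (hg j hj).2 _
  · intro j hj i hi
    rw [e j i hi, e (j+1) i hi]
    obtain ⟨-, -, r, hr, hr'⟩ := hm j hj
    by_cases hir : (⟨i, hi⟩ : S) = r
    · right; rw [hir]; exact hr
    · left; exact hr' _ hir
  · intro j hj a ha b hb hab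
    rw [e j a ha, e j b hb] at hab
    exact congrArg Subtype.val ((hg j hj).1 hab)
  · intro j hj i hi i' hi' hne
    rw [e j i hi, e (j+1) i hi, e j i' hi', e (j+1) i' hi']
    rintro ⟨q1, q2⟩
    obtain ⟨-, -, r, hr, hr'⟩ := hm j hj
    by_cases hir : (⟨i, hi⟩ : S) = r
    · have hir' : (⟨i', hi'⟩ : S) ≠ r := by
        rw [← hir]; intro h; exact hne (congrArg Subtype.val h).symm
      rw [hr' _ hir'] at q2
      exact hne (congrArg Subtype.val ((hg j hj.le).1 q2)).symm
    · rw [hr' _ hir] at q1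
      exact hne (congrArg Subtype.val ((hg j hj.le).1 q1))
  · refine le_trans ?_ hT
    refine le_trans (le_of_eq ?_) (HavenAux.total_le T pos hm)
    rw [← Finset.sum_coe_sort S]
    apply Finset.sum_congr rfl
    rintro ⟨i, hi⟩ -
    congr 1
    ext j
    simp [hi]
end

section
/- Let G be a graph and k ∈ ℕ. If a vertex w of G has degree at least 3 and is contained in a simple cycle of length at least 2k+2, then w is nice (with respect to k). -/
open SimpleGraph

lemma nice_aux_single {V : Type} (G : SimpleGraph V) (v : V) : (G.induce {v}).Connected := by
  have := SimpleGraph.Preconnected.of_subsingleton (G := G.induce {v})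
  exact ⟨this⟩

lemma nice_aux_Ico {V : Type} (G : SimpleGraph V) (f : ℕ → V) (a n : ℕ)
    (h : ∀ i, i < a + n → G.Adj (f i) (f (i+1))) :
    (G.induce (f '' Set.Icc a (a+n))).Connected := by
  induction n with
  | zero =>
    have e : f '' Set.Icc a (a+0) = {f a} := by simp
    rw [e]
    exact nice_aux_single G _
  | succ n ih =>
    have e : f '' Set.Icc a (a+(n+1)) = f '' Set.Icc a (a+n) ∪ {f (a+n+1)} := by
      rw [← Set.image_singleton, ← Set.image_union]
      congr 1
      ext i
      simp only [Set.mem_Icc, Set.mem_union, Set.mem_singleton_iff]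
      omega
    rw [e]
    have ih := ih (fun i hi => h i (by omega))
    refine SimpleGraph.connected_induce_union (v := f (a+n)) (w := f (a+n+1)) ih.preconnected
      (nice_aux_single G _).preconnected ?_ ?_ ?_
    · exact ⟨a+n, by simp, rfl⟩
    · simp
    · exact h _ (by omega)

lemma nice_aux_S {V : Type} (G : SimpleGraph V) (f : ℕ → V) (N : ℕ)
    (h : ∀ i, i < N → G.Adj (f i) (f (i+1))) (a b : ℕ) (hb : b ≤ N)
    (hj : b ≤ a ∨ ∃ j, a ≤ j ∧ j < b ∧ G.Adj (f 0) (f j)) :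
    ((⊤ : G.Subgraph).induce (f '' insert 0 (Set.Ico a b))).Connected := by
  rw [← SimpleGraph.connected_induce_iff]
  rcases hj with hj | ⟨j, h1, h2, h3⟩
  · have e : f '' insert 0 (Set.Ico a b) = {f 0} := by
      rw [Set.Ico_eq_empty (by omega)]
      simp
    rw [e]
    exact nice_aux_single G _
  · have e : f '' insert 0 (Set.Ico a b) = {f 0} ∪ f '' Set.Icc a (a+(b-a-1)) := by
      rw [← Set.image_singleton, ← Set.image_union]
      congr 1
      ext i
      simp only [Set.mem_Icc, Set.mem_union, Set.mem_singleton_iff, Set.mem_insert_iff, Set.mem_Ico]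
      omega
    rw [e]
    refine SimpleGraph.connected_induce_union (v := f 0) (w := f j)
      (nice_aux_single G _).preconnected
      (nice_aux_Ico G f a _ (fun i hi => h i (by omega))).preconnected ?_ ?_ h3
    · simp
    · exact ⟨j, ⟨h1, by omega⟩, rfl⟩

lemma nice_aux_inter {V : Type} (f : ℕ → V) (n : ℕ) (hn : 0 < n)
    (hf : Set.InjOn f (Set.Iio n)) (a b c d : ℕ) (ha : 1 ≤ a) (hb : b ≤ n) (hd : d ≤ n)
    (hc : 1 ≤ c) (h : b ≤ c ∨ d ≤ a) :
    f '' insert 0 (Set.Ico a b) ∩ f '' insert 0 (Set.Ico c d) = {f 0} := by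
  rw [← hf.image_inter, ← Set.image_singleton]
  · congr 1
    ext i
    simp only [Set.mem_inter_iff, Set.mem_singleton_iff, Set.mem_insert_iff, Set.mem_Ico]
    omega
  all_goals
    intro i
    simp only [Set.mem_insert_iff, Set.mem_Ico, Set.mem_Iio]
    omega

lemma nice_aux_card {V : Type} (f : ℕ → V) (n : ℕ) (hn : 0 < n)
    (hf : Set.InjOn f (Set.Iio n)) (a b : ℕ) (ha : 1 ≤ a) (hb : b ≤ n) :
    (f '' insert 0 (Set.Ico a b)).ncard = b - a + 1 := by
  rw [Set.InjOn.ncard_image, Set.ncard_insert_of_notMem]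
  · congr 1
    rw [← Finset.coe_Ico, Set.ncard_coe_finset, Nat.card_Ico]
  · simp; omega
  · refine hf.mono ?_
    intro i
    simp only [Set.mem_insert_iff, Set.mem_Ico, Set.mem_Iio]
    omega

/-- If a vertex `w` of `G` has degree at least `3` and lies on a simple
cycle of length at least `2k+2`, then `w` is nice (with respect to `k`). -/
theorem degree_three_on_long_cycle_is_nice {V : Type} (G : SimpleGraph V) (k : ℕ) (w : V)
    (hdeg : 3 ≤ (G.neighborSet w).ncard)
    (hcyc : ∃ c : G.Walk w w, c.IsCycle ∧ 2 * k + 2 ≤ c.length) :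
    IsNice G k w := by
  obtain ⟨c, hc, hlen⟩ := hcyc
  have h3 := hc.three_le_length
  obtain ⟨n, hn⟩ : ∃ n, n = c.length := ⟨_, rfl⟩
  obtain ⟨f, hfdef⟩ : ∃ f : ℕ → V, f = c.getVert := ⟨_, rfl⟩
  have f0 : f 0 = w := by simp [hfdef]
  have fn : f n = w := by simp [hfdef, hn]
  have hadj : ∀ i, i < n → G.Adj (f i) (f (i+1)) := by
    intro i hi; rw [hfdef]; exact c.adj_getVert_succ (by omega)
  have hf : Set.InjOn f (Set.Iio n) := by
    rw [hfdef]
    refine hc.getVert_injOn'.mono ?_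
    intro i hi
    simp only [Set.mem_Iio, Set.mem_setOf_eq] at *
    omega
  rw [← hn] at hlen h3
  have a1 : G.Adj (f 0) (f 1) := hadj 0 (by omega)
  have an : G.Adj (f 0) (f (n-1)) := by
    have := hadj (n-1) (by omega)
    rw [show n - 1 + 1 = n by omega, fn, ← f0] at this
    exact this.symm
  obtain ⟨u, hu, hu'⟩ : ∃ u ∈ G.neighborSet w, u ∉ ({f 1, f (n-1)} : Set V) := by
    refine Set.exists_mem_notMem_of_ncard_lt_ncard ?_ (Set.toFinite _)
    have := Set.ncard_insert_le (f 1) {f (n-1)}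
    rw [Set.ncard_singleton] at this
    omega
  rw [SimpleGraph.mem_neighborSet, ← f0] at hu
  simp only [Set.mem_insert_iff, Set.mem_singleton_iff, not_or] at hu'
  rw [← f0]
  have conn := nice_aux_S G f n hadj
  have inter := nice_aux_inter f n (by omega) hf
  have card := nice_aux_card f n (by omega) hf
  have main : ∀ a b a' b' a'' b'' : ℕ, 1 ≤ a → 1 ≤ a' → 1 ≤ a'' → b ≤ n → b' ≤ n → b'' ≤ n →
      (b ≤ a' ∨ b' ≤ a) → (b ≤ a'' ∨ b'' ≤ a) → (b' ≤ a'' ∨ b'' ≤ a') →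
      k ≤ b - a → k ≤ b' - a' → 1 ≤ b'' - a'' →
      (b ≤ a ∨ ∃ j, a ≤ j ∧ j < b ∧ G.Adj (f 0) (f j)) →
      (b' ≤ a' ∨ ∃ j, a' ≤ j ∧ j < b' ∧ G.Adj (f 0) (f j)) →
      (b'' ≤ a'' ∨ ∃ j, a'' ≤ j ∧ j < b'' ∧ G.Adj (f 0) (f j)) → IsNice G k (f 0) := by
    intro a b a' b' a'' b'' h1 h2 h3 h4 h5 h6 h7 h8 h9 h10 h11 h12 h13 h14 h15
    refine ⟨_, _, _, conn a b h4 h13, conn a' b' h5 h14, conn a'' b'' h6 h15, ?_, ?_, ?_, ?_, ?_, ?_⟩ <;>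
      simp only [SimpleGraph.Subgraph.induce_verts]
    · exact inter _ _ _ _ h1 h4 h5 h2 h7
    · exact inter _ _ _ _ h1 h4 h6 h3 h8
    · exact inter _ _ _ _ h2 h5 h6 h3 h9
    · rw [card _ _ h1 h4]; omega
    · rw [card _ _ h2 h5]; omega
    · rw [card _ _ h3 h6]; omega
  have conn1 : k + 1 ≤ 1 ∨ ∃ j, 1 ≤ j ∧ j < k + 1 ∧ G.Adj (f 0) (f j) := by
    by_cases hk : k = 0
    · left; omega
    · right; exact ⟨1, le_rfl, by omega, a1⟩
  by_cases hon : ∃ j, j < n ∧ f j = u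
  · obtain ⟨j, hjn, rfl⟩ := hon
    have j0 : j ≠ 0 := by rintro rfl; exact G.loopless.irrefl _ hu
    have j1 : j ≠ 1 := by rintro rfl; exact hu'.1 rfl
    have j2 : j ≠ n - 1 := by rintro rfl; exact hu'.2 rfl
    by_cases hjk : j ≤ k + 1
    · exact main 2 (k+2) (k+2) n 1 2 (by omega) (by omega) (by omega) (by omega) (by omega)
        (by omega) (by omega) (by omega) (by omega) (by omega) (by omega) (by omega)
        (.inr ⟨j, by omega, by omega, hu⟩) (.inr ⟨n-1, by omega, by omega, an⟩)
        (.inr ⟨1, by omega, by omega, a1⟩)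
    · exact main 1 (k+1) (k+1) (n-1) (n-1) n (by omega) (by omega) (by omega) (by omega) (by omega)
        (by omega) (by omega) (by omega) (by omega) (by omega) (by omega) (by omega)
        conn1 (.inr ⟨j, by omega, by omega, hu⟩)
        (.inr ⟨n-1, by omega, by omega, an⟩)
  · have key : ∀ a b, b ≤ n → f '' insert 0 (Set.Ico a b) ∩ {f 0, u} = {f 0} := by
      intro a b hb
      ext x
      simp only [Set.mem_inter_iff, Set.mem_insert_iff, Set.mem_singleton_iff]
      constructor
      · rintro ⟨⟨i, hi, rfl⟩, h | h⟩
        · exact h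
        · simp only [Set.mem_insert_iff, Set.mem_Ico] at hi
          exact absurd ⟨i, by omega, h⟩ hon
      · rintro rfl
        exact ⟨⟨0, by simp, rfl⟩, .inl rfl⟩
    refine ⟨_, _, G.subgraphOfAdj hu, conn 1 (k+1) (by omega) conn1,
      conn (k+1) n le_rfl (.inr ⟨n-1, by omega, by omega, an⟩),
      SimpleGraph.Subgraph.subgraphOfAdj_connected hu, ?_, ?_, ?_, ?_, ?_, ?_⟩ <;>
      simp only [SimpleGraph.Subgraph.induce_verts, SimpleGraph.subgraphOfAdj_verts]
    · exact inter _ _ _ _ (by omega) (by omega) (by omega) (by omega) (by omega)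
    · exact key _ _ (by omega)
    · exact key _ _ (by omega)
    · rw [card _ _ (by omega) (by omega)]; omega
    · rw [card _ _ (by omega) (by omega)]; omega
    · rw [Set.ncard_pair hu.ne]
end

section
/- There is a universal constant c > 0 such that the following holds. Let I be a GCMP instance with k robots, let v be a nice vertex of G, let H_v be a haven for v, and let S be a schedule for I. Then there exists a schedule S' for I such that: (1) each robot enters H_v at most once and leaves H_v at most once in S', and moreover if a robot starts in H_v and leaves it, it never re-enters H_v; (2) the total traveled length of all robots outside of H_v in S' is at most the total traveled length of all robots outside of H_v in S; and (3) the total traveled length of all robots inside H_v in S' is at most c·k⁴. -/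
open SimpleGraph

/-- The number of times robot `i` enters the vertex set `H` in schedule `S`. -/
noncomputable def entersCount {V : Type} {G : SimpleGraph V} {k : ℕ} {I : Inst V G k}
    (S : Sched I) (H : Set V) (i : Fin k) : ℕ :=
  {j : ℕ | j < S.T ∧ S.pos j i ∉ H ∧ S.pos (j + 1) i ∈ H}.ncard

/-- The number of times robot `i` leaves the vertex set `H` in schedule `S`. -/
noncomputable def leavesCount {V : Type} {G : SimpleGraph V} {k : ℕ} {I : Inst V G k}
    (S : Sched I) (H : Set V) (i : Fin k) : ℕ :=
  {j : ℕ | j < S.T ∧ S.pos j i ∈ H ∧ S.pos (j + 1) i ∉ H}.ncard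

/-- The total traveled length of all robots inside `H` (moves with both endpoints in `H`). -/
noncomputable def lengthInside {V : Type} {G : SimpleGraph V} {k : ℕ} {I : Inst V G k}
    (S : Sched I) (H : Set V) : ℕ :=
  ∑ i : Fin k,
    {j : ℕ | j < S.T ∧ S.pos j i ≠ S.pos (j + 1) i ∧
      S.pos j i ∈ H ∧ S.pos (j + 1) i ∈ H}.ncard

/-- The total traveled length of all robots outside `H` (moves with an endpoint not in `H`). -/
noncomputable def lengthOutside {V : Type} {G : SimpleGraph V} {k : ℕ} {I : Inst V G k}
    (S : Sched I) (H : Set V) : ℕ :=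
  ∑ i : Fin k,
    {j : ℕ | j < S.T ∧ S.pos j i ≠ S.pos (j + 1) i ∧
      (S.pos j i ∉ H ∨ S.pos (j + 1) i ∉ H)}.ncard

namespace HavenProof

open Classical in
/-- moves inside `H`, at most `n` of them -/
inductive Rch {V : Type} {k : ℕ} (G : SimpleGraph V) (H : Set V) :
    ℕ → (Fin k → V) → (Fin k → V) → Prop
  | refl (n : ℕ) (p : Fin k → V) : Rch G H n p p
  | step {n : ℕ} {p q : Fin k → V} (i : Fin k) (v : V) (h1 : p i ∈ H) (h2 : v ∈ H)
      (h3 : G.Adj (p i) v) (h4 : ∀ i', p i' ≠ v) (h5 : ∀ i', i' ≠ i → p i' ≠ p i)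
      (h : Rch G H n (Function.update p i v) q) : Rch G H (n + 1) p q

section
variable {V : Type} {k : ℕ} {G : SimpleGraph V} {H : Set V}

lemma Rch.mono {n m : ℕ} {p q : Fin k → V} (h : Rch G H n p q) (hm : n ≤ m) :
    Rch G H m p q := by
  induction h generalizing m with
  | refl n p => exact Rch.refl _ _
  | step i v h1 h2 h3 h4 h5 h ih =>
    obtain ⟨m, rfl⟩ : ∃ m', m = m' + 1 := ⟨m - 1, by omega⟩
    exact Rch.step i v h1 h2 h3 h4 h5 (ih (by omega))

lemma Rch.trans {n m : ℕ} {p q r : Fin k → V} (h : Rch G H n p q) (h' : Rch G H m q r) :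
    Rch G H (n + m) p r := by
  induction h with
  | refl n p => exact h'.mono (by omega)
  | step i v h1 h2 h3 h4 h5 h ih =>
    exact (Rch.step i v h1 h2 h3 h4 h5 (ih h')).mono (by omega)

lemma Rch.symm {n : ℕ} {p q : Fin k → V} (h : Rch G H n p q) : Rch G H n q p := by
  induction h with
  | refl n p => exact Rch.refl _ _
  | @step n p q i v h1 h2 h3 h4 h5 h ih =>
    refine ih.trans (Rch.step (n := 0) i (p i) ?_ h1 ?_ ?_ ?_ ?_)
    · simpa using h2
    · simpa using h3.symm
    · intro i'
      by_cases hi : i' = i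
      · subst hi; simpa using h3.ne'
      · simpa [hi] using h5 i' hi
    · intro i' hi
      simpa [hi] using h4 i'
    · simpa using Rch.refl 0 p

lemma Rch.single {p : Fin k → V} (i : Fin k) (v : V) (h1 : p i ∈ H) (h2 : v ∈ H)
    (h3 : G.Adj (p i) v) (h4 : ∀ i', p i' ≠ v) (h5 : ∀ i', i' ≠ i → p i' ≠ p i) :
    Rch G H 1 p (Function.update p i v) :=
  Rch.step (n := 0) i v h1 h2 h3 h4 h5 (Rch.refl _ _)

lemma Rch.inj {n : ℕ} {p q : Fin k → V} (h : Rch G H n p q) (hp : Function.Injective p) :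
    Function.Injective q := by
  induction h with
  | refl n p => exact hp
  | @step n p q i v h1 h2 h3 h4 h5 h ih =>
    apply ih
    intro a b hab
    by_cases ha : a = i <;> by_cases hb : b = i
    · rw [ha, hb]
    · rw [ha, Function.update_self, Function.update_of_ne hb] at hab
      exact absurd hab.symm (h4 b)
    · rw [hb, Function.update_self, Function.update_of_ne ha] at hab
      exact absurd hab (h4 a)
    · rw [Function.update_of_ne ha, Function.update_of_ne hb] at hab
      exact hp hab

lemma Rch.pres {n : ℕ} {p q : Fin k → V} (h : Rch G H n p q) (i : Fin k) :
    (p i ∈ H → q i ∈ H) ∧ (p i ∉ H → q i = p i) := by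
  induction h with
  | refl n p => exact ⟨id, fun _ => rfl⟩
  | @step n p q j v h1 h2 h3 h4 h5 h ih =>
    by_cases hi : i = j
    · subst hi
      simp only [Function.update_self] at ih
      exact ⟨fun _ => ih.1 h2, fun h => absurd h1 h⟩
    · simpa [hi] using ih

lemma walk_down (y : ℕ → V) (hy : ∀ j, j ≤ k → y j ∈ H)
    (hadj : ∀ j, 1 ≤ j → j ≤ k → ∃ l, l < j ∧ G.Adj (y l) (y j)) (p : Fin k → V) (a : Fin k)
    (j : ℕ) : j ≤ k → (∀ i, i ≠ a → ∀ l, l ≤ j → p i ≠ y l) →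
      Rch G H j (Function.update p a (y j)) (Function.update p a (y 0)) := by
  induction j using Nat.strong_induction_on with
  | _ j ih =>
    intro hj hp
    rcases Nat.eq_zero_or_pos j with rfl | h0
    · exact Rch.refl _ _
    obtain ⟨l, hl, hA⟩ := hadj j h0 hj
    have := ih l hl (by omega) (fun i hi l' hl' => hp i hi l' (by omega))
    obtain ⟨j, rfl⟩ : ∃ m', j = m' + 1 := ⟨j - 1, by omega⟩
    refine Rch.step a (y l) (by simpa using hy _ hj) (hy _ (by omega)) (by simpa using hA.symm)
      ?_ ?_ ?_
    · intro i'
      by_cases hi : i' = a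
      · subst hi; simpa using hA.ne'
      · simpa [hi] using hp i' hi l (by omega)
    · intro i' hi
      simpa [hi] using hp i' hi _ le_rfl
    · simpa using this.mono (by omega)

lemma upd_range {p : Fin k → V} (hp : Function.Injective p) (i : Fin k) (c : V)
    (hc : c ∉ Set.range p) :
    Set.range (Function.update p i c) = insert c (Set.range p \ {p i}) := by
  ext z
  simp only [Set.mem_range, Set.mem_insert_iff, Set.mem_sdiff, Set.mem_singleton_iff]
  constructor
  · rintro ⟨j, rfl⟩
    by_cases h : j = i
    · subst h; simp
    · right; simp [h]; exact fun h' => h (hp h')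
  · rintro (rfl | ⟨⟨j, rfl⟩, h⟩)
    · exact ⟨i, by simp⟩
    · refine ⟨j, ?_⟩
      have : j ≠ i := by rintro rfl; exact h rfl
      simp [this]

lemma shift {a b : V} (q : G.Walk a b) : (∀ z ∈ q.support, z ∈ H) →
    ∀ p : Fin k → V, Function.Injective p → a ∈ Set.range p → b ∉ Set.range p →
    ∃ p', Rch G H q.length p p' ∧ Set.range p' = insert b (Set.range p \ {a}) := by
  induction q with
  | nil => intro _ p _ h1 h2; exact absurd h1 h2
  | @cons a c b hac q ih =>
    intro hq p hp ha hb
    have hqa : a ∈ H := hq a (by simp)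
    have hqs : ∀ z ∈ q.support, z ∈ H := fun z hz => hq z (by simp [hz])
    have hqc : c ∈ H := hqs c (by simp)
    by_cases hc : c ∈ Set.range p
    · obtain ⟨p1, h1, h2⟩ := ih hqs p hp hc hb
      have hinj := h1.inj hp
      have hbc : b ≠ c := by rintro rfl; exact hb hc
      obtain ⟨i, hi⟩ : a ∈ Set.range p1 := by rw [h2]; exact Or.inr ⟨ha, hac.ne⟩
      have hc1 : c ∉ Set.range p1 := by
        rw [h2]; simp [hbc.symm]
      refine ⟨Function.update p1 i c, ?_, ?_⟩
      · refine h1.trans (Rch.single i c (hi ▸ hqa) hqc (hi ▸ hac) (fun i' h => hc1 ⟨i', h⟩)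
          (fun i' h h' => h (hinj h')))
      · rw [upd_range hinj i c hc1, h2, hi]
        ext z
        have := hac.ne
        have hab : a ≠ b := by rintro rfl; exact hb ha
        simp only [Set.mem_insert_iff, Set.mem_sdiff, Set.mem_singleton_iff]
        grind
    · obtain ⟨i, hi⟩ := ha
      have hs : Rch G H 1 p (Function.update p i c) :=
        Rch.single i c (hi ▸ hqa) hqc (hi ▸ hac) (fun i' h => hc ⟨i', h⟩)
          (fun i' h h' => h (hp h'))
      have hinj := hs.inj hp
      have hr := upd_range hp i c hc
      by_cases hbc : b = c
      · subst hbc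
        refine ⟨_, hs.mono (by simp), ?_⟩
        rw [hr, hi]
      · obtain ⟨p1, h1, h2⟩ := ih hqs _ hinj ⟨i, by simp⟩ (by
          rw [hr]; simp only [Set.mem_insert_iff, Set.mem_sdiff, Set.mem_singleton_iff]; tauto)
        refine ⟨p1, (hs.trans h1).mono (by simp; omega), ?_⟩
        rw [h2, hr, hi]
        ext z
        simp only [Set.mem_insert_iff, Set.mem_sdiff, Set.mem_singleton_iff]
        grind

/-- abstract haven data -/
structure Hv (G : SimpleGraph V) (H : Set V) (k : ℕ) (w x : V) (y1 y2 : ℕ → V) : Prop where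
  z1 : y1 0 = w
  z2 : y2 0 = w
  m1 : ∀ j, j ≤ k → y1 j ∈ H
  m2 : ∀ j, j ≤ k → y2 j ∈ H
  a1 : ∀ j, 1 ≤ j → j ≤ k → ∃ l, l < j ∧ G.Adj (y1 l) (y1 j)
  a2 : ∀ j, 1 ≤ j → j ≤ k → ∃ l, l < j ∧ G.Adj (y2 l) (y2 j)
  i1 : ∀ j l, j ≤ k → l ≤ k → y1 j = y1 l → j = l
  i2 : ∀ j l, j ≤ k → l ≤ k → y2 j = y2 l → j = l
  d : ∀ j l, j ≤ k → l ≤ k → y1 j = y2 l → j = 0 ∧ l = 0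
  xm : x ∈ H
  wx : G.Adj w x
  x1 : ∀ j, j ≤ k → y1 j ≠ x
  x2 : ∀ j, j ≤ k → y2 j ≠ x
  con : ∀ u ∈ H, ∀ u' ∈ H, ∃ q : G.Walk u u', q.length ≤ 2 * k ∧ ∀ z ∈ q.support, z ∈ H

lemma exists_seq (C : G.Subgraph) (hC : C.Connected) (w : V) (hw : w ∈ C.verts) (k : ℕ)
    (hk : k + 1 ≤ C.verts.ncard) : ∀ n, n ≤ k → ∃ y : ℕ → V, y 0 = w ∧
      (∀ j, j ≤ n → y j ∈ C.verts) ∧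
      (∀ j, 1 ≤ j → j ≤ n → ∃ l, l < j ∧ G.Adj (y l) (y j)) ∧
      (∀ j l, j ≤ n → l ≤ n → y j = y l → j = l) := by
  intro n
  induction n with
  | zero =>
    intro _
    exact ⟨fun _ => w, rfl, fun _ _ => hw, fun j h1 h2 => by omega, fun j l h1 h2 _ => by omega⟩
  | succ n ih =>
    intro hn
    obtain ⟨y, h0, hm, ha, hi⟩ := ih (by omega)
    have hfin : C.verts.Finite := Set.finite_of_ncard_pos (by omega)
    set A : Set V := y '' Set.Iic n with hA
    have hAc : A.ncard < C.verts.ncard := by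
      have : A.ncard ≤ (Set.Iic n).ncard := Set.ncard_image_le (Set.finite_Iic n)
      have h2 : (Set.Iic n).ncard = n + 1 := by
        rw [Set.ncard_eq_toFinset_card']; simp
      omega
    obtain ⟨z, hz, hzA⟩ := Set.exists_mem_notMem_of_ncard_lt_ncard hAc
      ((Set.finite_Iic n).image y)
    have hpre := hC.coe.preconnected ⟨w, hw⟩ ⟨z, hz⟩
    obtain ⟨q⟩ := hpre
    obtain ⟨d, hd, hd1, hd2⟩ := q.exists_boundary_dart {u | u.1 ∈ A} ⟨0, by simp, h0⟩ hzA
    obtain ⟨l, hl, hl'⟩ := hd1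
    have hadj : C.Adj d.fst.1 d.snd.1 := d.adj
    have hl : l ≤ n := hl
    refine ⟨fun j => if j ≤ n then y j else d.snd.1, by simp [h0], ?_, ?_, ?_⟩
    · intro j hj
      by_cases h : j ≤ n
      · simpa [h] using hm j h
      · simp [h]
    · intro j h1 h2
      by_cases h : j ≤ n
      · obtain ⟨l', hl1, hl2⟩ := ha j h1 h
        exact ⟨l', hl1, by simpa [h, show l' ≤ n by omega] using hl2⟩
      · exact ⟨l, by omega, by simpa [h, hl, hl'] using hadj.adj_sub⟩
    · intro j l hj hl
      have hnA : ∀ j, j ≤ n → y j ≠ d.snd.1 := fun j hj h => hd2 ⟨j, hj, h⟩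
      by_cases h : j ≤ n <;> by_cases h' : l ≤ n <;> simp [h, h']
      · exact hi j l h h'
      · intro h''; exact absurd h'' (hnA j h)
      · intro h''; exact absurd h''.symm (hnA l h')
      · omega

lemma lift_walk {U : Set V} {a b : U} (q : (G.induce U).Walk a b) :
    ∃ q' : G.Walk a.1 b.1, q'.length = q.length ∧
      ∀ z ∈ q'.support, ∃ h : z ∈ U, (⟨z, h⟩ : U) ∈ q.support := by
  induction q with
  | @nil u => exact ⟨SimpleGraph.Walk.nil, by simp, by simp⟩
  | @cons a c b hac q ih =>
    obtain ⟨q', h1, h2⟩ := ih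
    refine ⟨SimpleGraph.Walk.cons (by simpa using hac) q', by simp [h1], ?_⟩
    intro z hz
    rw [SimpleGraph.Walk.support_cons, List.mem_cons] at hz
    rcases hz with rfl | hz
    · exact ⟨a.2, by simp⟩
    · obtain ⟨h, h'⟩ := h2 z hz
      exact ⟨h, by simp [h']⟩

lemma exists_hv (hk0 : 1 ≤ k) {w : V} (h : IsHaven G k w H) : ∃ x y1 y2, Hv G H k w x y1 y2 := by
  obtain ⟨C1, C2, C3, x, c1, c2, c3, e12, e13, e23, n1, n2, n3, hx, hwx, hw, rfl⟩ := h
  have w1 : w ∈ C1.verts := by have : w ∈ C1.verts ∩ C2.verts := by rw [e12]; rfl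
                               exact this.1
  have w2 : w ∈ C2.verts := by have : w ∈ C1.verts ∩ C2.verts := by rw [e12]; rfl
                               exact this.2
  have hxw : x ≠ w := hwx.ne'
  have x1 : x ∉ C1.verts := fun h => hxw (by
    have : x ∈ C1.verts ∩ C3.verts := ⟨h, hx⟩
    rw [e13] at this; exact this)
  have x2 : x ∉ C2.verts := fun h => hxw (by
    have : x ∈ C2.verts ∩ C3.verts := ⟨h, hx⟩
    rw [e23] at this; exact this)
  obtain ⟨y1, z1, m1, a1, i1⟩ := exists_seq C1 c1 w w1 k n1 k le_rfl
  obtain ⟨y2, z2, m2, a2, i2⟩ := exists_seq C2 c2 w w2 k n2 k le_rfl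
  set U : Set V := {x} ∪ C1.verts ∪ C2.verts with hU
  have key : ∀ y : ℕ → V, y 0 = w → ∀ (hyU : ∀ j, j ≤ k → y j ∈ U),
      (∀ j, 1 ≤ j → j ≤ k → ∃ l, l < j ∧ G.Adj (y l) (y j)) →
      ∀ j (hj : j ≤ k), ∃ q : (G.induce U).Walk ⟨w, hw⟩ ⟨y j, hyU j hj⟩, q.length ≤ j := by
    intro y z hyU ha j
    induction j using Nat.strong_induction_on with
    | _ j ih =>
      intro hj
      rcases Nat.eq_zero_or_pos j with rfl | h0
      · subst z; exact ⟨SimpleGraph.Walk.nil, by simp⟩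
      · obtain ⟨l, hl, hA⟩ := ha j h0 hj
        obtain ⟨q, hq⟩ := ih l hl (by omega)
        refine ⟨q.concat (by simpa using hA), ?_⟩
        rw [SimpleGraph.Walk.length_concat]; omega
  have s1 : C1.verts ⊆ U := fun z hz => Or.inl (Or.inr hz)
  have s2 : C2.verts ⊆ U := fun z hz => Or.inr hz
  have reach : ∀ C : G.Subgraph, C.Connected → w ∈ C.verts → ∀ hs : C.verts ⊆ U,
      ∀ u (hu : u ∈ C.verts), (G.induce U).Reachable ⟨w, hw⟩ ⟨u, hs hu⟩ := by
    intro C hC hwC hs u hu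
    let f : C.coe →g G.induce U := ⟨fun z => ⟨z.1, hs z.2⟩, fun {a b} h => by
      have : C.Adj a.1 b.1 := h
      simpa using this.adj_sub⟩
    exact (hC.coe.preconnected ⟨w, hwC⟩ ⟨u, hu⟩).map f
  have reachU : ∀ u (hu : u ∈ U), (G.induce U).Reachable ⟨w, hw⟩ ⟨u, hu⟩ := by
    rintro u ((hu | hu) | hu)
    · have : u = x := hu
      subst this
      exact SimpleGraph.Adj.reachable (by simpa using hwx)
    · exact reach C1 c1 w1 s1 u hu
    · exact reach C2 c2 w2 s2 u hu
  have con0 : ∀ u, (∃ hu : u ∈ U, (G.induce U).dist ⟨w, hw⟩ ⟨u, hu⟩ ≤ k) →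
      ∃ q : G.Walk w u, q.length ≤ k ∧ ∀ z ∈ q.support, ∃ hu : z ∈ U,
        (G.induce U).dist ⟨w, hw⟩ ⟨z, hu⟩ ≤ k := by
    classical
    rintro u ⟨hu, hd⟩
    obtain ⟨q, hq⟩ := (reachU u hu).exists_walk_length_eq_dist
    obtain ⟨q', hl, hs⟩ := lift_walk q
    refine ⟨q', by omega, ?_⟩
    · intro z hz
      obtain ⟨hzU, hz'⟩ := hs z hz
      refine ⟨hzU, ?_⟩
      have h1 := SimpleGraph.dist_le (q.takeUntil _ hz')
      have h2 := q.length_takeUntil_le_length hz'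
      exact h1.trans (h2.trans (by omega))
  refine ⟨x, y1, y2, z1, z2, ?_, ?_, a1, a2, i1, i2, ?_, ?_, hwx, ?_, ?_, ?_⟩
  · intro j hj
    obtain ⟨q, hq⟩ := key y1 z1 (fun j hj => s1 (m1 j hj)) a1 j hj
    exact ⟨_, (SimpleGraph.dist_le q).trans (hq.trans hj)⟩
  · intro j hj
    obtain ⟨q, hq⟩ := key y2 z2 (fun j hj => s2 (m2 j hj)) a2 j hj
    exact ⟨_, (SimpleGraph.dist_le q).trans (hq.trans hj)⟩
  · intro j l hj hl h
    have : y1 j ∈ C1.verts ∩ C2.verts := ⟨m1 j hj, h ▸ m2 l hl⟩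
    rw [e12] at this
    have hjw : y1 j = w := this
    exact ⟨i1 j 0 hj (by omega) (by rw [hjw, z1]), i2 l 0 hl (by omega) (by rw [← h, hjw, z2])⟩
  · refine ⟨Or.inl (Or.inl rfl), ?_⟩
    have hA : (G.induce U).Adj ⟨w, hw⟩ ⟨x, Or.inl (Or.inl rfl)⟩ := by simpa using hwx
    exact (SimpleGraph.dist_le hA.toWalk).trans (by simpa using hk0)
  · intro j hj h; exact x1 (h ▸ m1 j hj)
  · intro j hj h; exact x2 (h ▸ m2 j hj)
  · intro u hu u' hu'
    obtain ⟨q, hq, hqs⟩ := con0 u hu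
    obtain ⟨q', hq', hqs'⟩ := con0 u' hu'
    refine ⟨q.reverse.append q', ?_, ?_⟩
    · rw [SimpleGraph.Walk.length_append, SimpleGraph.Walk.length_reverse]; omega
    · intro z hz
      rw [SimpleGraph.Walk.mem_support_append_iff, SimpleGraph.Walk.support_reverse,
        List.mem_reverse] at hz
      exact hz.elim (hqs z) (hqs' z)

/-- stack the robots of the list on the vertices `y k, y (k-1), ...` (head on top) -/
def put (y : ℕ → V) : List (Fin k) → (Fin k → V) → (Fin k → V)
  | [], q => q
  | a :: L, q => Function.update (put y L q) a (y (k - L.length))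

lemma put_notMem (y : ℕ → V) (L : List (Fin k)) (q : Fin k → V) (a : Fin k) (h : a ∉ L) :
    put y L q a = q a := by
  induction L with
  | nil => rfl
  | cons c L ih =>
    simp only [List.mem_cons, not_or] at h
    simp [put, h.1, ih h.2]

lemma put_mem (y : ℕ → V) (L : List (Fin k)) (q : Fin k → V) (a : Fin k) (h : a ∈ L) :
    ∃ d, d < L.length ∧ put y L q a = y (k - d) := by
  induction L with
  | nil => simp at h
  | cons c L ih =>
    by_cases hc : a = c
    · subst hc
      exact ⟨L.length, by simp, by simp [put]⟩
    · have h' : a ∈ L := by simpa [hc] using h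
      obtain ⟨d, h1, h2⟩ := ih h'
      exact ⟨d, by simp; omega, by simp [put, hc, h2]⟩

lemma put_upd (y : ℕ → V) (L : List (Fin k)) (q : Fin k → V) (a : Fin k) (v : V) (h : a ∉ L) :
    put y L (Function.update q a v) = Function.update (put y L q) a v := by
  induction L with
  | nil => rfl
  | cons c L ih =>
    simp only [List.mem_cons, not_or] at h
    simp only [put]
    rw [ih h.2, Function.update_comm h.1]

variable {w x : V} {y1 y2 : ℕ → V}

lemma nd_len {L : List (Fin k)} (h : L.Nodup) : L.length ≤ k := by
  simpa using h.length_le_card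

lemma avoid (hv : Hv G H k w x y1 y2) {a : Fin k} {L1 L2 : List (Fin k)} {b : Fin k → V}
    (hn : (a :: (L1 ++ L2)).Nodup)
    (hB : ∀ i, i ≠ a → i ∉ L1 → i ∉ L2 → b i ∉ H ∨ b i = x) (i : Fin k) (hi : i ≠ a) (l : ℕ) :
    (l ≤ k - L1.length → put y1 L1 (put y2 L2 b) i ≠ y1 l) ∧
    (l ≤ k - L2.length → put y1 L1 (put y2 L2 b) i ≠ y2 l) ∧
    ((∀ i, i ≠ a → i ∉ L1 → i ∉ L2 → b i ∉ H) → put y1 L1 (put y2 L2 b) i ≠ x) := by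
  have hlen := nd_len hn
  simp at hlen
  by_cases h1 : i ∈ L1
  · obtain ⟨d, hd, he⟩ := put_mem y1 L1 (put y2 L2 b) i h1
    rw [he]
    refine ⟨fun hl h => ?_, fun hl h => ?_, fun _ h => ?_⟩
    · have := hv.i1 _ _ (by omega) (by omega) h; omega
    · have := hv.d _ _ (by omega) (by omega) h; omega
    · exact hv.x1 _ (by omega) h
  rw [put_notMem y1 L1 _ i h1]
  by_cases h2 : i ∈ L2
  · obtain ⟨d, hd, he⟩ := put_mem y2 L2 b i h2
    rw [he]
    refine ⟨fun hl h => ?_, fun hl h => ?_, fun _ h => ?_⟩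
    · have := hv.d _ _ (by omega) (by omega) h.symm; omega
    · have := hv.i2 _ _ (by omega) (by omega) h; omega
    · exact hv.x2 _ (by omega) h
  rw [put_notMem y2 L2 _ i h2]
  refine ⟨fun hl h => ?_, fun hl h => ?_, fun h' h => ?_⟩
  · rcases hB i hi h1 h2 with h3 | h3
    · exact h3 (h ▸ hv.m1 l (by omega))
    · exact hv.x1 l (by omega) (h ▸ h3)
  · rcases hB i hi h1 h2 with h3 | h3
    · exact h3 (h ▸ hv.m2 l (by omega))
    · exact hv.x2 l (by omega) (h ▸ h3)
  · exact h' i hi h1 h2 (h ▸ hv.xm)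

lemma pop1 (hv : Hv G H k w x y1 y2) {a : Fin k} {L1 L2 : List (Fin k)} {b : Fin k → V}
    (hn : (a :: (L1 ++ L2)).Nodup)
    (hB : ∀ i, i ≠ a → i ∉ L1 → i ∉ L2 → b i ∉ H ∨ b i = x) :
    Rch G H k (put y1 (a :: L1) (put y2 L2 b))
      (Function.update (put y1 L1 (put y2 L2 b)) a w) := by
  have := walk_down y1 hv.m1 hv.a1 (put y1 L1 (put y2 L2 b)) a (k - L1.length) (by omega)
    (fun i hi l hl => (avoid hv hn hB i hi l).1 hl)
  rw [hv.z1] at this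
  exact this.mono (by omega)

lemma pop2 (hv : Hv G H k w x y1 y2) {a : Fin k} {L1 L2 : List (Fin k)} {b : Fin k → V}
    (hn : (a :: (L1 ++ L2)).Nodup)
    (hB : ∀ i, i ≠ a → i ∉ L1 → i ∉ L2 → b i ∉ H ∨ b i = x) :
    Rch G H k (put y1 L1 (put y2 (a :: L2) b))
      (Function.update (put y1 L1 (put y2 L2 b)) a w) := by
  have := walk_down y2 hv.m2 hv.a2 (put y1 L1 (put y2 L2 b)) a (k - L2.length) (by omega)
    (fun i hi l hl => (avoid hv hn hB i hi l).2.1 hl)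
  rw [hv.z2] at this
  have ha : a ∉ L1 := by simp at hn; tauto
  have e : put y1 L1 (put y2 (a :: L2) b) =
      Function.update (put y1 L1 (put y2 L2 b)) a (y2 (k - L2.length)) := by
    rw [← put_upd _ _ _ _ _ ha]; rfl
  rw [e]
  exact this.mono (by omega)

lemma popx (hv : Hv G H k w x y1 y2) {a : Fin k} {L1 L2 : List (Fin k)} {b : Fin k → V}
    (hn : (a :: (L1 ++ L2)).Nodup)
    (hB : ∀ i, i ≠ a → i ∉ L1 → i ∉ L2 → b i ∉ H) :
    Rch G H 1 (Function.update (put y1 L1 (put y2 L2 b)) a w)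
      (put y1 L1 (put y2 L2 (Function.update b a x))) := by
  have ha : a ∉ L1 ∧ a ∉ L2 := by simp at hn; tauto
  have hav := avoid hv hn (fun i h1 h2 h3 => Or.inl (hB i h1 h2 h3))
  rw [put_upd _ _ _ _ _ ha.2, put_upd _ _ _ _ _ ha.1]
  have := Rch.single (G := G) (H := H) (p := Function.update (put y1 L1 (put y2 L2 b)) a w) a x
    (by simpa using hv.z1 ▸ hv.m1 0 (by omega)) hv.xm (by simpa using hv.wx) ?_ ?_
  · simpa using this
  · intro i
    by_cases hi : i = a
    · subst hi; simpa using hv.wx.ne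
    · simpa [hi] using (hav i hi 0).2.2 hB
  · intro i hi
    simpa [hi, hv.z1] using (hav i hi 0).1 (by omega)

lemma moveAll (hv : Hv G H k w x y1 y2) {b : Fin k → V} (L1 : List (Fin k)) (A : List (Fin k)) :
    ∀ L2 : List (Fin k), (A ++ L1 ++ L2).Nodup →
    (∀ i, i ∉ A → i ∉ L1 → i ∉ L2 → b i ∉ H ∨ b i = x) →
    Rch G H (2 * k * A.length) (put y1 (A ++ L1) (put y2 L2 b))
      (put y1 L1 (put y2 (A.reverse ++ L2) b)) := by
  induction A with
  | nil => intro L2 _ _; exact Rch.refl _ _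
  | cons a A ih =>
    intro L2 hn hB
    have hn1 : (a :: ((A ++ L1) ++ L2)).Nodup := by simpa using hn
    have hB1 : ∀ i, i ≠ a → i ∉ A ++ L1 → i ∉ L2 → b i ∉ H ∨ b i = x := by
      intro i h1 h2 h3
      simp at h2
      exact hB i (by simp [h1, h2.1]) h2.2 h3
    have s1 := pop1 hv hn1 hB1
    have s2 := (pop2 hv hn1 hB1).symm
    have s3 := ih (a :: L2) (by
      refine (List.Perm.nodup_iff ?_).1 hn1
      exact List.perm_middle.symm) (by
      intro i h1 h2 h3
      simp at h3
      exact hB i (by simp [h1, h3.1]) h2 h3.2)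
    have := (s1.trans s2).trans s3
    simp only [List.reverse_cons, List.append_assoc, List.cons_append, List.nil_append] at this ⊢
    refine this.mono ?_
    simp only [List.length_cons]
    nlinarith

lemma sel (hv : Hv G H k w x y1 y2) (hk : 1 ≤ k) {b : Fin k → V} (A B C : List (Fin k))
    (r : Fin k) (hn : (A ++ r :: B ++ C).Nodup)
    (hB : ∀ i, i ∉ A ++ r :: B ++ C → b i ∉ H) :
    Rch G H (4 * k * k) (put y1 (A ++ r :: B ++ C) b) (put y1 (A ++ B ++ r :: C) b) := by
  have hlen := nd_len hn
  have hnr : (r :: (A ++ B ++ C)).Nodup := by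
    refine (List.Perm.nodup_iff ?_).1 hn
    rw [List.append_assoc, List.append_assoc]; exact List.perm_middle
  -- A to second stack
  have s1 := moveAll hv (b := b) (r :: (B ++ C)) A [] (by simpa using hn) (by
    intro i h1 h2 _; left; apply hB; simp at h2 ⊢; tauto)
  have s2 := pop1 hv (b := b) (a := r) (L1 := B ++ C) (L2 := A.reverse) (by
      refine (List.Perm.nodup_iff ?_).1 hnr
      refine List.Perm.cons _ ?_
      rw [List.append_assoc]
      exact List.perm_append_comm.trans (List.Perm.append_left _ (List.reverse_perm A).symm)) (by
    intro i h1 h2 h3; left; apply hB; simp at h2 h3 ⊢; tauto)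
  have s3 := popx hv (b := b) (a := r) (L1 := B ++ C) (L2 := A.reverse) (by
      refine (List.Perm.nodup_iff ?_).1 hnr
      refine List.Perm.cons _ ?_
      rw [List.append_assoc]
      exact List.perm_append_comm.trans (List.Perm.append_left _ (List.reverse_perm A).symm)) (by
    intro i h1 h2 h3; apply hB; simp at h2 h3 ⊢; tauto)
  have s4 := moveAll hv (b := Function.update b r x) C B A.reverse (by
      refine (List.Perm.nodup_iff ?_).1 hnr.of_cons
      rw [List.append_assoc]
      exact List.perm_append_comm.trans (List.Perm.append_left _ (List.reverse_perm A).symm)) (by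
    intro i h1 h2 h3
    by_cases hi : i = r
    · right; simp [hi]
    · left; simp only [Function.update_of_ne hi]; apply hB; simp at h3 ⊢; tauto)
  rw [← List.reverse_append] at s4
  have hn5 : (r :: (C ++ (A ++ B).reverse)).Nodup := by
      refine (List.Perm.nodup_iff ?_).1 hnr
      refine List.Perm.cons _ ?_
      exact List.perm_append_comm.trans (List.Perm.append_left _ (List.reverse_perm _).symm)
  have s5 := (popx hv (b := b) (a := r) (L1 := C) (L2 := (A ++ B).reverse) hn5 (by
    intro i h1 h2 h3; apply hB; simp at h2 h3 ⊢; tauto)).symm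
  have s6 := (pop1 hv (b := b) (a := r) (L1 := C) (L2 := (A ++ B).reverse) hn5 (by
    intro i h1 h2 h3; left; apply hB; simp at h2 h3 ⊢; tauto)).symm
  have s7 := (moveAll hv (b := b) (r :: C) (A ++ B) [] (by
      refine (List.Perm.nodup_iff ?_).1 hnr
      simpa using (List.perm_middle (a := r) (l₁ := A ++ B) (l₂ := C)).symm) (by
    intro i h1 h2 _; left; apply hB; simp at h1 h2 ⊢; tauto)).symm
  simp only [List.append_nil] at s1 s7
  have := (((((s1.trans s2).trans s3).trans s4).trans s5).trans s6).trans s7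
  simp only [put] at this
  simp only [List.append_assoc, List.cons_append] at this ⊢
  refine this.mono ?_
  simp at hlen ⊢
  have : A.length + B.length + 1 ≤ k := by omega
  nlinarith

lemma sort (hv : Hv G H k w x y1 y2) (hk : 1 ≤ k) {b : Fin k → V} (D : List (Fin k)) :
    ∀ P C : List (Fin k), P.Perm D → (P ++ C).Nodup → (∀ i, i ∉ P ++ C → b i ∉ H) →
    Rch G H (4 * k * k * D.length) (put y1 (P ++ C) b) (put y1 (D ++ C) b) := by
  induction D using List.reverseRecOn with
  | nil =>
    intro P C hP _ _
    rw [hP.eq_nil]; exact Rch.refl _ _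
  | append_singleton D r ih =>
    intro P C hP hn hB
    obtain ⟨A, B, rfl⟩ := List.append_of_mem (hP.mem_iff.2 (by simp : r ∈ D ++ [r]))
    have s1 := sel hv hk A B C r hn hB
    have hp : (A ++ r :: B ++ C).Perm (A ++ B ++ r :: C) := by
      have h1 : (A ++ r :: B ++ C).Perm (r :: (A ++ B ++ C)) := by
        rw [List.append_assoc, List.append_assoc]; exact List.perm_middle
      exact h1.trans List.perm_middle.symm
    have s2 := ih (A ++ B) (r :: C) (by
      have h1 : (r :: (A ++ B)).Perm (r :: D) :=
        List.perm_middle.symm.trans (hP.trans (List.perm_append_singleton r D))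
      exact h1.cons_inv) (hp.nodup_iff.1 hn) (by
      intro i hi; exact hB i (fun h => hi (hp.mem_iff.1 h)))
    have := s1.trans s2
    simp only [List.append_assoc, List.cons_append, List.nil_append] at this ⊢
    refine this.mono ?_
    simp only [List.length_append, List.length_cons, List.length_nil]
    nlinarith

lemma mklist (y : ℕ → V) (hy : ∀ j l, j ≤ k → l ≤ k → y j = y l → j = l) (p q : Fin k → V)
    (hp : Function.Injective p) (m : ℕ) : m ≤ k → (∀ d, d < m → ∃ i, p i = y (k - d)) →
    ∃ L : List (Fin k), L.length = m ∧ L.Nodup ∧ (∀ i, i ∈ L ↔ ∃ d, d < m ∧ p i = y (k - d)) ∧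
      ∀ i ∈ L, put y L q i = p i := by
  induction m with
  | zero => intro _ _; exact ⟨[], rfl, by simp, by simp, by simp⟩
  | succ m ih =>
    intro hm h
    obtain ⟨L, h1, h2, h3, h4⟩ := ih (by omega) (fun d hd => h d (by omega))
    obtain ⟨a, ha⟩ := h m (by omega)
    have haL : a ∉ L := by
      intro h'
      obtain ⟨d, hd, he⟩ := (h3 a).1 h'
      have := hy _ _ (by omega) (by omega) (ha.symm.trans he); omega
    refine ⟨a :: L, by simp [h1], by simp [haL, h2], ?_, ?_⟩
    · intro i
      rw [List.mem_cons, h3]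
      constructor
      · rintro (rfl | ⟨d, hd, he⟩)
        · exact ⟨m, by omega, ha⟩
        · exact ⟨d, by omega, he⟩
      · rintro ⟨d, hd, he⟩
        by_cases hdm : d = m
        · subst hdm; left; exact hp (he.trans ha.symm)
        · right; exact ⟨d, by omega, he⟩
    · intro i hi
      by_cases hia : i = a
      · subst hia; simp [put, h1, ha]
      · have : i ∈ L := by simpa [hia] using hi
        simp [put, hia, h4 i this]

open Classical in
lemma gather (hv : Hv G H k w x y1 y2) (Y : Finset V) (hY : ∀ z ∈ Y, z ∈ H) (n : ℕ) :
    ∀ p : Fin k → V, Function.Injective p →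
      Y.card = (Finset.univ.filter (fun i => p i ∈ H)).card →
      (Y \ Finset.univ.image p).card ≤ n →
      ∃ p', Rch G H (2 * k * n) p p' ∧ ∀ z ∈ Y, z ∈ Set.range p' := by
  induction n with
  | zero =>
    intro p hp hc hn
    refine ⟨p, Rch.refl _ _, fun z hz => ?_⟩
    have he : Y \ Finset.univ.image p = ∅ := Finset.card_eq_zero.1 (by omega)
    by_contra hz'
    have : z ∈ Y \ Finset.univ.image p := by
      simp only [Finset.mem_sdiff, hz, Finset.mem_image, Finset.mem_univ, true_and]
      exact hz'
    rw [he] at this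
    exact absurd this (Finset.notMem_empty z)
  | succ n ih =>
    intro p hp hc hn
    by_cases hall : ∀ z ∈ Y, z ∈ Set.range p
    · exact ⟨p, Rch.refl _ _, hall⟩
    push Not at hall
    obtain ⟨b, hb, hbr⟩ := hall
    obtain ⟨a, ha, haY⟩ : ∃ a ∈ (Finset.univ.filter (fun i => p i ∈ H)).image p, a ∉ Y := by
      by_contra hcon
      push Not at hcon
      have hsub : (Finset.univ.filter (fun i => p i ∈ H)).image p ⊆ Y := hcon
      have heq := Finset.eq_of_subset_of_card_le hsub (by
        rw [Finset.card_image_of_injective _ hp, hc])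
      rw [← heq] at hb
      simp only [Finset.mem_image] at hb
      obtain ⟨i, _, hi⟩ := hb
      exact hbr ⟨i, hi⟩
    simp only [Finset.mem_image, Finset.mem_filter, Finset.mem_univ, true_and] at ha
    obtain ⟨i0, hi0, rfl⟩ := ha
    obtain ⟨q, hq, hqs⟩ := hv.con (p i0) hi0 b (hY b hb)
    obtain ⟨p1, h1, h2⟩ := shift q hqs p hp ⟨i0, rfl⟩ hbr
    have hfe : (Finset.univ.filter (fun i => p1 i ∈ H)) =
        (Finset.univ.filter (fun i => p i ∈ H)) := by
      ext i
      simp only [Finset.mem_filter, Finset.mem_univ, true_and]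
      have := h1.pres i
      have := h1.symm.pres i
      tauto
    obtain ⟨p2, h3, h4⟩ := ih p1 (h1.inj hp) (by rw [hfe, hc]) (by
      have hss : (Y \ Finset.univ.image p1) ⊆ (Y \ Finset.univ.image p).erase b := by
        intro z hz
        simp only [Finset.mem_sdiff, Finset.mem_image, Finset.mem_univ, true_and,
          Finset.mem_erase] at hz ⊢
        have hz2 : z ∉ Set.range p1 := hz.2
        rw [h2] at hz2
        simp only [Set.mem_insert_iff, Set.mem_sdiff, Set.mem_singleton_iff, not_or] at hz2
        refine ⟨hz2.1, hz.1, fun h => hz2.2 ⟨h, ?_⟩⟩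
        rintro rfl; exact haY hz.1
      have hbm : b ∈ Y \ Finset.univ.image p := by
        simp only [Finset.mem_sdiff, hb, Finset.mem_image, Finset.mem_univ, true_and]
        exact hbr
      have := Finset.card_le_card hss
      rw [Finset.card_erase_of_mem hbm] at this
      omega)
    refine ⟨p2, (h1.trans h3).mono ?_, h4⟩
    nlinarith

open Classical in
lemma tostack (hv : Hv G H k w x y1 y2) (p : Fin k → V) (hp : Function.Injective p) :
    ∃ L : List (Fin k), L.Nodup ∧ (∀ i, i ∈ L ↔ p i ∈ H) ∧
      Rch G H (2 * k * k) p (put y1 L p) := by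
  set m := (Finset.univ.filter (fun i => p i ∈ H)).card with hm
  have hmk : m ≤ k := by simpa using Finset.card_le_univ (Finset.univ.filter (fun i => p i ∈ H))
  set Y : Finset V := (Finset.range m).image (fun d => y1 (k - d)) with hYd
  have hYc : Y.card = m := by
    rw [hYd, Finset.card_image_of_injOn, Finset.card_range]
    intro d hd d' hd' h
    simp at hd hd'
    have := hv.i1 _ _ (by omega) (by omega) h
    omega
  have hYH : ∀ z ∈ Y, z ∈ H := by
    intro z hz
    simp only [hYd, Finset.mem_image, Finset.mem_range] at hz
    obtain ⟨d, _, rfl⟩ := hz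
    exact hv.m1 _ (by omega)
  obtain ⟨p1, h1, h2⟩ := gather hv Y hYH k p hp hYc
    ((Finset.card_le_card Finset.sdiff_subset).trans (by omega))
  have hinj := h1.inj hp
  obtain ⟨L, l1, l2, l3, l4⟩ := mklist y1 hv.i1 p1 p hinj m hmk (by
    intro d hd
    exact h2 _ (Finset.mem_image.2 ⟨d, by simpa using hd, rfl⟩))
  have hsub : L.toFinset ⊆ Finset.univ.filter (fun i => p i ∈ H) := by
    intro i hi
    rw [List.mem_toFinset, l3] at hi
    obtain ⟨d, hd, he⟩ := hi
    simp only [Finset.mem_filter, Finset.mem_univ, true_and]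
    have h3 := h1.pres i
    have : p1 i ∈ H := by rw [he]; exact hv.m1 _ (by omega)
    by_contra hcon
    exact hcon (h3.2 hcon ▸ this)
  have heq := Finset.eq_of_subset_of_card_le hsub (by
    rw [List.toFinset_card_of_nodup l2, l1])
  have hmem : ∀ i, i ∈ L ↔ p i ∈ H := by
    intro i
    rw [← List.mem_toFinset, heq]; simp
  refine ⟨L, l2, hmem, ?_⟩
  have : put y1 L p = p1 := by
    funext i
    by_cases hi : i ∈ L
    · exact l4 i hi
    · rw [put_notMem _ _ _ _ hi, (h1.pres i).2 (fun h => hi ((hmem i).2 h))]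
  rw [this]; exact h1

lemma put_congr (y : ℕ → V) (L : List (Fin k)) (p q : Fin k → V) (h : ∀ i, i ∉ L → p i = q i) :
    put y L p = put y L q := by
  suffices hs : ∀ i, (i ∈ L ∨ p i = q i) → put y L p i = put y L q i from
    funext fun i => hs i (by by_cases hi : i ∈ L; exacts [Or.inl hi, Or.inr (h i hi)])
  clear h
  induction L with
  | nil => intro i hi; simpa [put] using hi
  | cons a L ih =>
    intro i hi
    by_cases hia : i = a
    · subst hia; simp [put]
    · simp only [put, Function.update_of_ne hia]
      exact ih i (by simpa [hia] using hi)

lemma reconf (hv : Hv G H k w x y1 y2) (hk : 1 ≤ k) (p r : Fin k → V)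
    (hp : Function.Injective p) (hr : Function.Injective r)
    (h1 : ∀ i, p i ∈ H → r i ∈ H) (h2 : ∀ i, p i ∉ H → r i = p i) :
    Rch G H (8 * k ^ 3) p r := by
  obtain ⟨L, l1, l2, l3⟩ := tostack hv p hp
  obtain ⟨L', l1', l2', l3'⟩ := tostack hv r hr
  have hpr : ∀ i, p i ∈ H ↔ r i ∈ H := fun i =>
    ⟨h1 i, fun h => by by_contra hc; exact hc (h2 i hc ▸ h)⟩
  have hperm : L.Perm L' := (List.perm_ext_iff_of_nodup l1 l1').2 fun i => by
    rw [l2, l2', hpr]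
  have s := sort hv hk (b := p) L' L [] hperm (by simpa using l1) (by
    intro i hi; simp at hi; rwa [l2] at hi)
  simp only [List.append_nil] at s
  have e : put y1 L' p = put y1 L' r := put_congr _ _ _ _ fun i hi =>
    (h2 i (fun h => hi ((l2' i).2 (h1 i h)))).symm
  rw [e] at s
  refine ((l3.trans s).trans l3'.symm).mono ?_
  have := nd_len l1'
  have h3 : 4 * k * k * L'.length ≤ 4 * k * k * k := Nat.mul_le_mul_left _ this
  have h4 : k * k ≤ k * k * k := Nat.le_mul_of_pos_right _ (by omega)
  have h5 : k ^ 3 = k * k * k := by ring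
  nlinarith

def Good (G : SimpleGraph V) (p q : Fin k → V) : Prop :=
  (∀ i, q i = p i ∨ G.Adj (p i) (q i)) ∧ ∀ i i', i ≠ i' → ¬(q i = p i' ∧ q i' = p i)

def Val (G : SimpleGraph V) (T : ℕ) (pos : ℕ → Fin k → V) : Prop :=
  (∀ j, j < T → Good G (pos j) (pos (j + 1))) ∧ ∀ j, j ≤ T → Function.Injective (pos j)

open Classical in
noncomputable def cn (P : V → V → Prop) (T : ℕ) (pos : ℕ → Fin k → V) (i : Fin k) : ℕ :=
  ∑ j ∈ Finset.range T, if P (pos j i) (pos (j + 1) i) then 1 else 0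

lemma cn_ncard (P : V → V → Prop) (T : ℕ) (pos : ℕ → Fin k → V) (i : Fin k) :
    {j : ℕ | j < T ∧ P (pos j i) (pos (j + 1) i)}.ncard = cn P T pos i := by
  classical
  have : {j : ℕ | j < T ∧ P (pos j i) (pos (j + 1) i)} =
      ((Finset.range T).filter fun j => P (pos j i) (pos (j + 1) i) : Finset ℕ) := by
    ext j; simp
  rw [this, Set.ncard_coe_finset, cn, Finset.card_filter]

open Classical in
lemma append1 {T : ℕ} {pos : ℕ → Fin k → V} {q : Fin k → V} (hv : Val G T pos)
    (hg : Good G (pos T) q) (hq : Function.Injective q) :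
    ∃ pos', Val G (T + 1) pos' ∧ pos' 0 = pos 0 ∧ pos' (T + 1) = q ∧
      ∀ P i, cn P (T + 1) pos' i = cn P T pos i + if P (pos T i) (q i) then 1 else 0 := by
  refine ⟨fun j => if j ≤ T then pos j else q, ⟨?_, ?_⟩, by simp, by simp, ?_⟩
  · intro j hj
    by_cases h : j < T
    · simpa [h.le, Nat.succ_le_of_lt h] using hv.1 j h
    · have : j = T := by omega
      subst this; simpa using hg
  · intro j hj
    by_cases h : j ≤ T
    · simpa [h] using hv.2 j h
    · simpa [h] using hq
  · intro P i
    simp only [cn]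
    rw [Finset.sum_range_succ]
    congr 1
    · refine Finset.sum_congr rfl fun j hj => ?_
      have : j < T := by simpa using hj
      simp [this.le, Nat.succ_le_of_lt this]
    · simp

def Ins (H : Set V) (a b : V) : Prop := a ≠ b ∧ a ∈ H ∧ b ∈ H
def Out (H : Set V) (a b : V) : Prop := a ≠ b ∧ (a ∉ H ∨ b ∉ H)
def Ent (H : Set V) (a b : V) : Prop := a ∉ H ∧ b ∈ H
def Lea (H : Set V) (a b : V) : Prop := a ∈ H ∧ b ∉ H

lemma appendR {n : ℕ} {p q : Fin k → V} (h : Rch G H n p q) :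
    ∀ {T : ℕ} {pos : ℕ → Fin k → V}, Val G T pos → pos T = p →
    ∃ T' pos', Val G T' pos' ∧ pos' 0 = pos 0 ∧ pos' T' = q ∧
      (∀ i, cn (Ent H) T' pos' i = cn (Ent H) T pos i) ∧
      (∀ i, cn (Lea H) T' pos' i = cn (Lea H) T pos i) ∧
      (∀ i, cn (Out H) T' pos' i = cn (Out H) T pos i) ∧
      ∑ i, cn (Ins H) T' pos' i ≤ ∑ i, cn (Ins H) T pos i + n := by
  classical
  induction h with
  | refl n p =>
    intro T pos hv he
    exact ⟨T, pos, hv, rfl, he, fun _ => rfl, fun _ => rfl, fun _ => rfl, by omega⟩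
  | @step n p q a v h1 h2 h3 h4 h5 h ih =>
    intro T pos hv he
    have hinj : Function.Injective p := he ▸ hv.2 T le_rfl
    have hi' := (Rch.single a v h1 h2 h3 h4 h5).inj hinj
    have hg : Good G p (Function.update p a v) := by
      constructor
      · intro i
        by_cases hi : i = a
        · subst hi; right; simpa using h3
        · left; simp [hi]
      · rintro i i' hii ⟨e1, e2⟩
        by_cases hi : i = a
        · have : i' ≠ a := fun h => hii (hi.trans h.symm)
          rw [Function.update_of_ne this] at e2
          exact hii (hinj e2).symm
        · rw [Function.update_of_ne hi] at e1
          exact hii (hinj e1)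
    obtain ⟨pos1, g1, g2, g3, g4⟩ := append1 hv (he.symm ▸ hg) hi'
    obtain ⟨T', pos', k1, k2, k3, k4, k5, k6, k7⟩ := ih g1 g3
    have same : ∀ i, Function.update p a v i = p i ∨ (p i ∈ H ∧ Function.update p a v i ∈ H) := by
      intro i
      by_cases hi : i = a
      · subst hi; right; simp [h1, h2]
      · left; simp [hi]
    refine ⟨T', pos', k1, k2.trans g2, k3, ?_, ?_, ?_, ?_⟩
    · intro i
      rw [k4, g4, he, if_neg, add_zero]
      rintro ⟨c1, c2⟩
      rcases same i with h | h
      · exact c1 (h ▸ c2)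
      · exact c1 h.1
    · intro i
      rw [k5, g4, he, if_neg, add_zero]
      rintro ⟨c1, c2⟩
      rcases same i with h | h
      · exact c2 (h ▸ c1)
      · exact c2 h.2
    · intro i
      rw [k6, g4, he, if_neg, add_zero]
      rintro ⟨c1, c2⟩
      rcases same i with h | h
      · exact c1 h.symm
      · tauto
    · refine k7.trans ?_
      have : ∑ i, cn (Ins H) (T + 1) pos1 i ≤ ∑ i, cn (Ins H) T pos i + 1 := by
        simp only [g4, Finset.sum_add_distrib]
        gcongr
        calc _ ≤ ∑ i : Fin k, if i = a then 1 else 0 := by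
              refine Finset.sum_le_sum fun i _ => ?_
              by_cases hi : i = a
              · rw [if_pos hi]; split_ifs <;> simp
              · rw [if_neg hi, if_neg]
                rintro ⟨c, _⟩
                rw [he] at c; simp [hi] at c
          _ = 1 := by simp
      omega

variable {I : Inst V G k} (S : Sched I)

def Fst (H : Set V) (j : ℕ) (i : Fin k) : Prop := ∃ s, s ≤ j ∧ S.pos s i ∈ H
def Lst (H : Set V) (j : ℕ) (i : Fin k) : Prop := ∃ s, j ≤ s ∧ s ≤ S.T ∧ S.pos s i ∈ H
def Inf (H : Set V) (j : ℕ) (i : Fin k) : Prop := Fst S H j i ∧ Lst S H j i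

open Classical in
noncomputable def cA (H : Set V) (j : ℕ) (i : Fin k) : ℕ :=
  if Fst S H j i ∧ S.pos 0 i ∉ H then 1 else 0
open Classical in
noncomputable def cB (H : Set V) (j : ℕ) (i : Fin k) : ℕ :=
  if Lst S H j i then 0 else 1

lemma fl_facts (j : ℕ) (hj : j < S.T) (i : Fin k) :
    (Fst S H j i → Fst S H (j + 1) i) ∧ (Lst S H (j + 1) i → Lst S H j i) ∧
    (Fst S H (j + 1) i → Fst S H j i ∨ S.pos (j + 1) i ∈ H) ∧
    (Lst S H j i → Lst S H (j + 1) i ∨ S.pos j i ∈ H) ∧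
    (S.pos j i ∈ H → Fst S H j i ∧ Lst S H j i) ∧
    (S.pos (j + 1) i ∈ H → Fst S H (j + 1) i ∧ Lst S H (j + 1) i) ∧
    (S.pos 0 i ∈ H → Fst S H j i) := by
  refine ⟨?_, ?_, ?_, ?_, ?_, ?_, ?_⟩
  · rintro ⟨s, h1, h2⟩; exact ⟨s, by omega, h2⟩
  · rintro ⟨s, h1, h2, h3⟩; exact ⟨s, by omega, h2, h3⟩
  · rintro ⟨s, h1, h2⟩
    by_cases h : s = j + 1
    · right; exact h ▸ h2
    · left; exact ⟨s, by omega, h2⟩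
  · rintro ⟨s, h1, h2, h3⟩
    by_cases h : s = j
    · right; exact h ▸ h3
    · left; exact ⟨s, by omega, h2, h3⟩
  · intro h; exact ⟨⟨j, le_rfl, h⟩, ⟨j, le_rfl, hj.le, h⟩⟩
  · intro h; exact ⟨⟨j + 1, le_rfl, h⟩, ⟨j + 1, le_rfl, hj, h⟩⟩
  · intro h; exact ⟨0, by omega, h⟩

def Inv (H : Set V) (j : ℕ) (T : ℕ) (pos : ℕ → Fin k → V) (e : ℕ) : Prop :=
  Val G T pos ∧ pos 0 = S.pos 0 ∧ (∀ i, Inf S H j i → pos T i ∈ H) ∧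
  (∀ i, ¬ Inf S H j i → pos T i = S.pos j i) ∧
  (∀ i, cn (Ent H) T pos i ≤ cA S H j i) ∧ (∀ i, cn (Lea H) T pos i ≤ cB S H j i) ∧
  (∀ i, cn (Out H) T pos i ≤ cn (Out H) j S.pos i) ∧
  ∑ i, cn (Ins H) T pos i ≤ 8 * k ^ 3 * ((∑ i, (cA S H j i + cB S H j i)) + e)

def Ready (H : Set V) (j : ℕ) (p : Fin k → V) : Prop :=
  (∀ i, Inf S H j i → ¬ Inf S H (j + 1) i → p i = S.pos j i) ∧
  ∀ i i', Inf S H j i → Inf S H (j + 1) i → ¬ Inf S H j i' → Inf S H (j + 1) i' →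
    p i ≠ S.pos (j + 1) i'

lemma exists_target (hv : Hv G H k w x y1 y2) (j : ℕ) (hj : j < S.T) (p : Fin k → V)
    (h1 : ∀ i, Inf S H j i → p i ∈ H) (h2 : ∀ i, ¬ Inf S H j i → p i = S.pos j i) :
    ∃ r : Fin k → V, Function.Injective r ∧ (∀ i, p i ∈ H → r i ∈ H) ∧
      (∀ i, p i ∉ H → r i = p i) ∧ Ready S H j r := by
  classical
  set g : Fin k → V := fun i => if Inf S H j i then S.pos j i else S.pos (j + 1) i with hg
  set W : Finset V := (Finset.Icc 1 k).image y1 ∪ (Finset.Icc 1 k).image y2 with hW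
  have hWc : W.card = 2 * k := by
    rw [hW, Finset.card_union_of_disjoint, Finset.card_image_of_injOn, Finset.card_image_of_injOn]
    · simp; omega
    · intro a ha b hb h; simp at ha hb; exact hv.i2 _ _ (by omega) (by omega) h
    · intro a ha b hb h; simp at ha hb; exact hv.i1 _ _ (by omega) (by omega) h
    · rw [Finset.disjoint_left]
      intro z hz hz'
      simp only [Finset.mem_image, Finset.mem_Icc] at hz hz'
      obtain ⟨a, ha, rfl⟩ := hz
      obtain ⟨b, hb, h⟩ := hz'
      have := hv.d a b (by omega) (by omega) h.symm
      omega
  have hWH : ∀ z ∈ W, z ∈ H := by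
    intro z hz
    simp only [hW, Finset.mem_union, Finset.mem_image, Finset.mem_Icc] at hz
    rcases hz with ⟨a, ha, rfl⟩ | ⟨a, ha, rfl⟩
    · exact hv.m1 a (by omega)
    · exact hv.m2 a (by omega)
  have hcard : k ≤ (W \ Finset.univ.image g).card := by
    have h3 := Finset.le_card_sdiff (Finset.univ.image g) W
    have h4 : (Finset.univ.image g).card ≤ k := by
      simpa using Finset.card_image_le (s := Finset.univ) (f := g)
    omega
  obtain ⟨f⟩ := Function.Embedding.nonempty_of_card_le (α := Fin k)
    (β := ↥(W \ Finset.univ.image g)) (by simpa using hcard)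
  have fH : ∀ i, (f i).1 ∈ H := fun i => hWH _ (Finset.mem_sdiff.1 (f i).2).1
  have fg : ∀ i i', (f i).1 ≠ g i' := fun i i' h =>
    (Finset.mem_sdiff.1 (f i).2).2 (Finset.mem_image.2 ⟨i', by simp, h.symm⟩)
  have finj : ∀ i i', (f i).1 = (f i').1 → i = i' := fun i i' h => f.injective (Subtype.ext h)
  have hcross : ∀ i i', (f i).1 ≠ S.pos j i' := by
    intro i i' h
    have h3 : Inf S H j i' := (fl_facts S j hj i').2.2.2.2.1 (h ▸ fH i)
    exact fg i i' (by simp only [hg, if_pos h3]; exact h)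
  refine ⟨fun i => if Inf S H j i ∧ Inf S H (j + 1) i then (f i).1 else S.pos j i,
    ?_, ?_, ?_, ?_, ?_⟩
  · intro i i' h
    simp only at h
    split_ifs at h with a b b
    · exact finj _ _ h
    · exact absurd h (hcross _ _)
    · exact absurd h.symm (hcross _ _)
    · exact S.noVertexConflict j hj.le h
  · intro i hi
    have hI : Inf S H j i := by
      by_contra hc
      rw [h2 i hc] at hi
      exact hc ((fl_facts S j hj i).2.2.2.2.1 hi)
    simp only
    split_ifs with a
    · exact fH i
    · have := fl_facts (H := H) S j hj i
      simp only [Inf] at hI a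
      grind
  · intro i hi
    have hI : ¬ Inf S H j i := fun h => hi (h1 i h)
    simp [hI, h2 i hI]
  · intro i a b
    simp [b]
  · intro i i' a b c d
    simp only [a, b, and_self, if_true]
    intro h
    exact fg i i' (by simp only [hg, if_neg c]; exact h)

lemma doStep (j : ℕ) (hj : j < S.T) {T : ℕ} {pos : ℕ → Fin k → V} {e : ℕ}
    (hI : Inv S H j T pos e) (hR : Ready S H j (pos T))
    (he : e = 0 ∨ ∃ i, ¬ (Inf S H j i ↔ Inf S H (j + 1) i)) (he1 : e ≤ 1) :
    ∃ T' pos', Inv S H (j + 1) T' pos' 0 := by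
  classical
  obtain ⟨v1, v2, v3, v4, v5, v6, v7, v8⟩ := hI
  have hinj := v1.2 T le_rfl
  set p := pos T with hp
  set q : Fin k → V := fun i => if Inf S H j i ∧ Inf S H (j + 1) i then p i else S.pos (j + 1) i
    with hq
  have F := fun i => fl_facts (H := H) S j hj i
  have qs : ∀ i, Inf S H j i → Inf S H (j + 1) i → q i = p i := fun i a b => by simp [hq, a, b]
  have qn : ∀ i, ¬ (Inf S H j i ∧ Inf S H (j + 1) i) → q i = S.pos (j + 1) i := fun i a => by
    simp only [hq, if_neg a]
  have pn : ∀ i, ¬ (Inf S H j i ∧ Inf S H (j + 1) i) → p i = S.pos j i := fun i a => by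
    by_cases h : Inf S H j i
    · exact hR.1 i h (fun h' => a ⟨h, h'⟩)
    · exact v4 i h
  have cross : ∀ i i', (Inf S H j i ∧ Inf S H (j + 1) i) → ¬ (Inf S H j i' ∧ Inf S H (j + 1) i') →
      p i ≠ S.pos (j + 1) i' := by
    intro i i' a b h
    have h1 : S.pos (j + 1) i' ∈ H := h ▸ v3 i a.1
    have h2 : Inf S H (j + 1) i' := (F i').2.2.2.2.2.1 h1
    exact hR.2 i i' a.1 a.2 (fun h3 => b ⟨h3, h2⟩) h2 h
  have qinj : Function.Injective q := by
    intro i i' h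
    by_cases a : Inf S H j i ∧ Inf S H (j + 1) i <;>
      by_cases b : Inf S H j i' ∧ Inf S H (j + 1) i'
    · rw [qs i a.1 a.2, qs i' b.1 b.2] at h; exact hinj h
    · rw [qs i a.1 a.2, qn i' b] at h; exact absurd h (cross i i' a b)
    · rw [qn i a, qs i' b.1 b.2] at h; exact absurd h.symm (cross i' i b a)
    · rw [qn i a, qn i' b] at h; exact S.noVertexConflict (j + 1) hj h
  have hg : Good G p q := by
    constructor
    · intro i
      by_cases a : Inf S H j i ∧ Inf S H (j + 1) i
      · left; exact qs i a.1 a.2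
      · rw [qn i a, pn i a]; exact S.step j hj i
    · rintro i i' hii ⟨e1, e2⟩
      by_cases a : Inf S H j i ∧ Inf S H (j + 1) i
      · rw [qs i a.1 a.2] at e1; exact hii (hinj e1)
      · by_cases b : Inf S H j i' ∧ Inf S H (j + 1) i'
        · rw [qs i' b.1 b.2] at e2; exact hii (hinj e2).symm
        · rw [qn i a, pn i' b] at e1
          rw [qn i' b, pn i a] at e2
          exact S.noSwap j hj i i' hii ⟨e1, e2⟩
  have pH : ∀ i, p i ∈ H ↔ Inf S H j i := fun i => ⟨fun h => by
    by_contra hc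
    rw [v4 i hc] at h
    exact hc ((F i).2.2.2.2.1 h), v3 i⟩
  have qH : ∀ i, q i ∈ H ↔ Inf S H (j + 1) i := fun i => by
    by_cases a : Inf S H j i ∧ Inf S H (j + 1) i
    · rw [qs i a.1 a.2, pH]; grind
    · rw [qn i a]
      have := F i
      simp only [Inf] at a ⊢
      grind
  have cAm : ∀ i, cA S H j i ≤ cA S H (j + 1) i := fun i => by
    have := F i
    simp only [cA]
    split_ifs <;> first | omega | (exfalso; grind)
  have cBm : ∀ i, cB S H j i ≤ cB S H (j + 1) i := fun i => by
    have := F i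
    simp only [cB]
    split_ifs <;> first | omega | (exfalso; grind)
  have cA1 : ∀ i, ¬ Inf S H j i → Inf S H (j + 1) i → cA S H j i + 1 ≤ cA S H (j + 1) i := by
    intro i a b
    have := F i
    simp only [Inf] at a b
    simp only [cA]
    rw [if_neg (by grind), if_pos (by grind)]
  have cB1 : ∀ i, Inf S H j i → ¬ Inf S H (j + 1) i → cB S H j i + 1 ≤ cB S H (j + 1) i := by
    intro i a b
    have := F i
    simp only [Inf] at a b
    simp only [cB]
    rw [if_pos (by grind), if_neg (by grind)]
  obtain ⟨pos', g1, g2, g3, g4⟩ := append1 v1 hg qinj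
  refine ⟨T + 1, pos', g1, g2.trans v2, ?_, ?_, ?_, ?_, ?_, ?_⟩
  · intro i hi; rw [g3]; exact (qH i).2 hi
  · intro i hi; rw [g3]; exact qn i (fun h => hi h.2)
  · intro i
    rw [g4]
    by_cases h : Ent H (pos T i) (q i)
    · rw [if_pos h]
      have h1 : ¬ Inf S H j i := fun h' => h.1 ((pH i).2 h')
      exact (Nat.add_le_add_right (v5 i) 1).trans (cA1 i h1 ((qH i).1 h.2))
    · rw [if_neg h]; exact (v5 i).trans (cAm i)
  · intro i
    rw [g4]
    by_cases h : Lea H (pos T i) (q i)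
    · rw [if_pos h]
      have h1 : ¬ Inf S H (j + 1) i := fun h' => h.2 ((qH i).2 h')
      exact (Nat.add_le_add_right (v6 i) 1).trans (cB1 i ((pH i).1 h.1) h1)
    · rw [if_neg h]; exact (v6 i).trans (cBm i)
  · intro i
    rw [g4]
    have : cn (Out H) (j + 1) S.pos i = cn (Out H) j S.pos i +
        if Out H (S.pos j i) (S.pos (j + 1) i) then 1 else 0 := by
      simp only [cn]; rw [Finset.sum_range_succ]
    rw [this]
    refine Nat.add_le_add (v7 i) ?_
    by_cases a : Inf S H j i ∧ Inf S H (j + 1) i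
    · rw [if_neg]
      · exact Nat.zero_le _
      · rintro ⟨h, _⟩; exact h (qs i a.1 a.2).symm
    · rw [qn i a, ← hp, pn i a]
  · have h0 : ∑ i, cn (Ins H) (T + 1) pos' i = ∑ i, cn (Ins H) T pos i := by
      refine Finset.sum_congr rfl fun i _ => ?_
      rw [g4, if_neg, add_zero]
      rintro ⟨a, b, c⟩
      exact a (qs i ((pH i).1 b) ((qH i).1 c)).symm
    rw [h0]
    refine v8.trans (Nat.mul_le_mul_left _ ?_)
    have hle : ∀ i, cA S H j i + cB S H j i ≤ cA S H (j + 1) i + cB S H (j + 1) i :=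
      fun i => Nat.add_le_add (cAm i) (cBm i)
    rcases he with rfl | ⟨i, hi⟩
    · exact Nat.add_le_add_right (Finset.sum_le_sum fun i _ => hle i) 0
    · have : ∑ i, (cA S H j i + cB S H j i) < ∑ i, (cA S H (j + 1) i + cB S H (j + 1) i) := by
        refine Finset.sum_lt_sum (fun i _ => hle i) ⟨i, by simp, ?_⟩
        by_cases a : Inf S H j i
        · have := cB1 i a (by grind)
          have := cAm i
          omega
        · have := cA1 i a (by grind)
          have := cBm i
          omega
      omega

lemma stages (hv : Hv G H k w x y1 y2) (hk : 1 ≤ k) (j : ℕ) :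
    j ≤ S.T → ∃ T pos, Inv S H j T pos 0 := by
  induction j with
  | zero =>
    intro _
    refine ⟨0, fun _ => S.pos 0, ⟨by intro j hj; omega, fun j _ => S.noVertexConflict 0 (by omega)⟩,
      rfl, ?_, fun _ _ => rfl, ?_, ?_, ?_, ?_⟩
    · rintro i ⟨⟨s, h1, h2⟩, _⟩
      have : s = 0 := by omega
      exact this ▸ h2
    all_goals simp [cn]
  | succ j ih =>
    intro hj
    obtain ⟨T, pos, hI⟩ := ih (by omega)
    by_cases hev : ∃ i, ¬ (Inf S H j i ↔ Inf S H (j + 1) i)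
    · obtain ⟨v1, v2, v3, v4, v5, v6, v7, v8⟩ := hI
      obtain ⟨r, r1, r2, r3, r4⟩ := exists_target S hv j hj (pos T) v3 v4
      have hR := reconf hv hk (pos T) r (v1.2 T le_rfl) r1 r2 r3
      obtain ⟨T', pos', k1, k2, k3, k4, k5, k6, k7⟩ := appendR hR v1 rfl
      refine doStep S j hj (T := T') (pos := pos') (e := 1)
        ⟨k1, k2.trans v2, ?_, ?_, ?_, ?_, ?_, ?_⟩ (k3 ▸ r4) (Or.inr hev) le_rfl
      · intro i hi; rw [k3]; exact r2 i (v3 i hi)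
      · intro i hi
        have : pos T i ∉ H := by
          rw [v4 i hi]
          exact fun h => hi ((fl_facts S j hj i).2.2.2.2.1 h)
        rw [k3, r3 i this, v4 i hi]
      · intro i; rw [k4]; exact v5 i
      · intro i; rw [k5]; exact v6 i
      · intro i; rw [k6]; exact v7 i
      · rw [add_zero] at v8
        rw [mul_add, mul_one]
        omega
    · refine doStep S j hj hI ⟨?_, ?_⟩ (Or.inl rfl) (by omega)
      · intro i a b; exact absurd ⟨i, by tauto⟩ hev
      · intro i i' a b c d; exact absurd ⟨i', by tauto⟩ hev

lemma main (hv : Hv G H k w x y1 y2) (hk : 1 ≤ k) :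
    ∃ S' : Sched I,
      ((∀ i : Fin k, entersCount S' H i ≤ 1 ∧ leavesCount S' H i ≤ 1) ∧
        (∀ i : Fin k, S'.pos 0 i ∈ H → entersCount S' H i = 0)) ∧
      lengthOutside S' H ≤ lengthOutside S H ∧
      lengthInside S' H ≤ 24 * k ^ 4 := by
  obtain ⟨T, pos, v1, v2, v3, v4, v5, v6, v7, v8⟩ := stages (H := H) S hv hk S.T le_rfl
  have hI : ∀ i, Inf S H S.T i ↔ S.pos S.T i ∈ H := by
    intro i
    constructor
    · rintro ⟨_, ⟨s, h1, h2, h3⟩⟩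
      have : s = S.T := by omega
      exact this ▸ h3
    · intro h; exact ⟨⟨_, le_rfl, h⟩, ⟨_, le_rfl, le_rfl, h⟩⟩
  have hR := reconf hv hk (pos T) (S.pos S.T) (v1.2 T le_rfl) (S.noVertexConflict S.T le_rfl)
    (by
      intro i hi
      by_contra hc
      exact hc (v4 i (fun h => hc ((hI i).1 h)) ▸ hi))
    (by
      intro i hi
      exact (v4 i (fun h => hi (v3 i h))).symm)
  obtain ⟨T', pos', k1, k2, k3, k4, k5, k6, k7⟩ := appendR hR v1 rfl
  let S' : Sched I :=
    { T := T'
      pos := pos'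
      init := fun i => by rw [k2, v2]; exact S.init i
      final := fun i hi => by rw [k3]; exact S.final i hi
      step := fun j hj i => (k1.1 j hj).1 i
      noVertexConflict := fun j hj => k1.2 j hj
      noSwap := fun j hj i i' h => (k1.1 j hj).2 i i' h }
  have eE : ∀ i, entersCount S' H i = cn (Ent H) T pos i := fun i =>
    (cn_ncard (Ent H) T' pos' i).trans (k4 i)
  have eL : ∀ i, leavesCount S' H i = cn (Lea H) T pos i := fun i =>
    (cn_ncard (Lea H) T' pos' i).trans (k5 i)
  have cAle : ∀ i, cA S H S.T i ≤ 1 := fun i => by unfold cA; split_ifs <;> omega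
  have cBle : ∀ i, cB S H S.T i ≤ 1 := fun i => by unfold cB; split_ifs <;> omega
  refine ⟨S', ⟨fun i => ⟨?_, ?_⟩, fun i hi => ?_⟩, ?_, ?_⟩
  · rw [eE]; exact (v5 i).trans (cAle i)
  · rw [eL]; exact (v6 i).trans (cBle i)
  · rw [eE]
    have h0 : S.pos 0 i ∈ H := by
      have : pos' 0 i ∈ H := hi
      rwa [k2, v2] at this
    have := v5 i
    have h1 : cA S H S.T i = 0 := by unfold cA; rw [if_neg]; tauto
    omega
  · refine Finset.sum_le_sum fun i _ => ?_
    have e1 := cn_ncard (Out H) T' pos' i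
    have e2 := cn_ncard (Out H) S.T S.pos i
    have h3 : cn (Out H) T' pos' i ≤ cn (Out H) S.T S.pos i := by rw [k6]; exact v7 i
    rw [← e1, ← e2] at h3
    exact h3
  · have e : lengthInside S' H = ∑ i, cn (Ins H) T' pos' i :=
      Finset.sum_congr rfl fun i _ => cn_ncard (Ins H) T' pos' i
    rw [e]
    have h1 : ∑ i, (cA S H S.T i + cB S H S.T i) ≤ 2 * k := by
      calc _ ≤ ∑ _i : Fin k, 2 := Finset.sum_le_sum fun i _ => by
            have := cAle i; have := cBle i; omega
        _ = 2 * k := by simp [mul_comm]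
    have h2 : 8 * k ^ 3 * ((∑ i, (cA S H S.T i + cB S H S.T i)) + 0) ≤ 8 * k ^ 3 * (2 * k) :=
      Nat.mul_le_mul_left _ (by omega)
    have h3 : 8 * k ^ 3 ≤ 8 * k ^ 3 * k := Nat.le_mul_of_pos_right _ (by omega)
    calc _ ≤ 8 * k ^ 3 * (2 * k) + 8 * k ^ 3 * k := by omega
      _ = 24 * k ^ 4 := by ring

end

end HavenProof

/-- **haven simplification.** There is a universal constant `c > 0` such
that: for every GCMP instance with `k` robots, every nice vertex `v` with haven `H`, and
every schedule `S`, there is a schedule `S'` such that (1) each robot enters `H` at most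
once and leaves `H` at most once, and a robot starting in `H` never (re-)enters `H`;
(2) the total traveled length outside `H` in `S'` is at most that of `S`; and
(3) the total traveled length inside `H` in `S'` is at most `c * k ^ 4`. -/
theorem simplify_haven :
    ∃ c : ℕ, 0 < c ∧
      ∀ (V : Type) (G : SimpleGraph V) (k : ℕ) (I : Inst V G k) (v : V) (H : Set V),
        IsNice G k v → IsHaven G k v H →
        ∀ S : Sched I, ∃ S' : Sched I,
          ((∀ i : Fin k, entersCount S' H i ≤ 1 ∧ leavesCount S' H i ≤ 1) ∧
            (∀ i : Fin k, S'.pos 0 i ∈ H → entersCount S' H i = 0)) ∧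
          lengthOutside S' H ≤ lengthOutside S H ∧
          lengthInside S' H ≤ c * k ^ 4 := by
  refine ⟨24, by norm_num, ?_⟩
  intro V G k I v H _ hH S
  rcases Nat.eq_zero_or_pos k with rfl | hk
  · exact ⟨S, ⟨fun i => i.elim0, fun i => i.elim0⟩, le_rfl, by simp [lengthInside]⟩
  · obtain ⟨x, y1, y2, hv⟩ := HavenProof.exists_hv hk hH
    exact HavenProof.main S hv hk
end

section
/- There is a universal constant c > 0 such that the following holds. Let I be a GCMP instance with k robots, let v be a nice vertex of G, and let H_v be a haven for v. Then in any schedule opt(I) for I of minimum total traveled length, the total traveled length of all robots inside H_v, as well as the total number of vertices of H_v visited by the robots, is at most c·k⁴. -/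
open SimpleGraph

namespace HavenPf

def Mv {V : Type} {k : ℕ} (G : SimpleGraph V) (H : Set V) (f g : Fin k → V) : Prop :=
  ∃ i u, f i ∈ H ∧ u ∈ H ∧ G.Adj (f i) u ∧ u ∉ Set.range f ∧ g = Function.update f i u

inductive Reach {V : Type} {k : ℕ} (G : SimpleGraph V) (H : Set V) :
    ℕ → (Fin k → V) → (Fin k → V) → Prop
  | refl (n : ℕ) (f : Fin k → V) : Reach G H n f f
  | step {n : ℕ} {f g h : Fin k → V} : Reach G H n f g → Mv G H g h → Reach G H (n + 1) f h

section basic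
variable {V : Type} {k : ℕ} {G : SimpleGraph V} {H : Set V} {f g h : Fin k → V} {m n : ℕ}

theorem Mv.inj (hm : Mv G H f g) (hf : Function.Injective f) : Function.Injective g := by
  obtain ⟨i, u, h1, h2, h3, h4, rfl⟩ := hm
  intro a b hab
  simp only [Set.mem_range, not_exists] at h4
  have := @hf a b
  have ha := h4 a
  have hb := h4 b
  simp only [Function.update_apply] at hab
  grind

theorem Mv.symm (hm : Mv G H f g) (hf : Function.Injective f) : Mv G H g f := by
  obtain ⟨i, u, h1, h2, h3, h4, rfl⟩ := hm
  refine ⟨i, f i, by simpa using h2, h1, by simpa using h3.symm, ?_, by simp⟩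
  rintro ⟨a, ha⟩
  simp only [Function.update_apply] at ha
  split_ifs at ha with hai
  · exact h3.ne ha.symm
  · exact hai (hf ha)

theorem Reach.mono (hr : Reach G H n f g) : ∀ {m : ℕ}, n ≤ m → Reach G H m f g := by
  induction hr with
  | refl n f => intro m _; exact Reach.refl _ _
  | step h1 h2 ih =>
    intro m hm
    obtain ⟨m, rfl⟩ : ∃ m', m = m' + 1 := ⟨m - 1, by omega⟩
    exact Reach.step (ih (by omega)) h2

theorem Reach.trans (h1 : Reach G H n f g) (h2 : Reach G H m g h) : Reach G H (n + m) f h := by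
  induction h2 with
  | refl m f => exact h1.mono (by omega)
  | step h3 h4 ih => exact Reach.step (ih h1) h4

theorem Mv.reach (hm : Mv G H f g) : Reach G H 1 f g := Reach.step (Reach.refl 0 f) hm

theorem Reach.inj (hr : Reach G H n f g) (hf : Function.Injective f) : Function.Injective g := by
  induction hr with
  | refl => exact hf
  | step h1 h2 ih => exact h2.inj (ih hf)

theorem Reach.symm (hr : Reach G H n f g) (hf : Function.Injective f) : Reach G H n g f := by
  induction hr with
  | refl => exact Reach.refl _ _
  | step h1 h2 ih =>
    have := (h2.symm (h1.inj hf)).reach.trans (ih hf)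
    exact this.mono (by omega)

theorem Reach.off (hr : Reach G H n f g) (i : Fin k) : f i ∉ H → g i = f i := by
  induction hr with
  | refl => intro _; rfl
  | step h1 h2 ih =>
    intro hi
    have := ih hi
    obtain ⟨a, u, h1, h2, h3, h4, rfl⟩ := h2
    rw [Function.update_of_ne, this]
    rintro rfl
    exact hi (this ▸ h1)

theorem Reach.on (hr : Reach G H n f g) (i : Fin k) : f i ∈ H → g i ∈ H := by
  induction hr with
  | refl => intro h; exact h
  | step h1 h2 ih =>
    intro hi
    have := ih hi
    obtain ⟨a, u, h1, h2, h3, h4, rfl⟩ := h2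
    rw [Function.update_apply]
    split_ifs <;> assumption

/-- shifting along a walk -/
theorem shift {a b : V} (p : G.Walk a b) : ∀ (f : Fin k → V), Function.Injective f →
    (∀ u ∈ p.support, u ∈ H) → a ∈ Set.range f → b ∉ Set.range f →
    ∃ g, Reach G H p.length f g ∧ Set.range g = insert b (Set.range f \ {a}) := by
  induction p with
  | nil => intro f _ _ h1 h2; exact absurd h1 h2
  | @cons a c b hac p ih =>
    intro f hf hH ha hb
    have hHp : ∀ u ∈ p.support, u ∈ H := fun u hu => hH u (by simp [hu])
    have haH : a ∈ H := hH a (by simp)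
    have hcH : c ∈ H := hHp c (by simp)
    have key : ∀ (f : Fin k → V), Function.Injective f → a ∈ Set.range f → c ∉ Set.range f →
        ∃ g, Mv G H f g ∧ Set.range g = insert c (Set.range f \ {a}) := by
      rintro f hf ⟨i, rfl⟩ hc
      refine ⟨_, ⟨i, c, haH, hcH, hac, hc, rfl⟩, ?_⟩
      ext u
      simp only [Set.mem_range, Set.mem_insert_iff, Set.mem_sdiff, Set.mem_singleton_iff,
        Function.update_apply]
      constructor
      · rintro ⟨j, hj⟩
        split_ifs at hj with hji
        · exact Or.inl hj.symm
        · exact Or.inr ⟨⟨j, hj⟩, fun hu => hji (hf (hj.trans hu))⟩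
      · rintro (rfl | ⟨⟨j, rfl⟩, hj⟩)
        · exact ⟨i, by simp⟩
        · refine ⟨j, ?_⟩
          rw [if_neg]
          rintro rfl
          exact hj rfl
    have hne : a ≠ c := hac.ne
    by_cases hc : c ∈ Set.range f
    · obtain ⟨g, hg1, hg2⟩ := ih f hf hHp hc hb
      have hcb : c ≠ b := by rintro rfl; exact hb hc
      obtain ⟨g', hg3, hg4⟩ := key g (hg1.inj hf) (by rw [hg2]; right; exact ⟨ha, hne⟩)
        (by rw [hg2]; simp [hcb])
      refine ⟨g', by simpa using hg1.step hg3, ?_⟩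
      rw [hg4, hg2]
      ext u
      simp only [Set.mem_insert_iff, Set.mem_sdiff, Set.mem_singleton_iff]
      have hab : a ≠ b := by rintro rfl; exact hb ha
      grind
    · obtain ⟨g, hg1, hg2⟩ := key f hf ha hc
      by_cases hcb : c = b
      · subst hcb
        exact ⟨g, hg1.reach.mono (by simp), hg2⟩
      · obtain ⟨g', hg3, hg4⟩ := ih g (hg1.inj hf) hHp (by rw [hg2]; simp)
          (by rw [hg2]; simp [Ne.symm hcb, hb])
        refine ⟨g', (hg1.reach.trans hg3).mono (by simp; omega), ?_⟩
        rw [hg4, hg2]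
        ext u
        simp only [Set.mem_insert_iff, Set.mem_sdiff, Set.mem_singleton_iff]
        grind

end basic

structure Hv {V : Type} (G : SimpleGraph V) (H : Set V) (k : ℕ) (w x : V) (v1 v2 : ℕ → V) :
    Prop where
  z1 : v1 0 = w
  z2 : v2 0 = w
  inj1 : ∀ i j, i ≤ k → j ≤ k → v1 i = v1 j → i = j
  inj2 : ∀ i j, i ≤ k → j ≤ k → v2 i = v2 j → i = j
  dis : ∀ i j, i ≤ k → j ≤ k → v1 i = v2 j → i = 0 ∧ j = 0
  mem1 : ∀ j, j ≤ k → v1 j ∈ H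
  mem2 : ∀ j, j ≤ k → v2 j ∈ H
  xH : x ∈ H
  adj : G.Adj w x
  x1 : ∀ j, j ≤ k → v1 j ≠ x
  x2 : ∀ j, j ≤ k → v2 j ≠ x
  par1 : ∀ j, 0 < j → j ≤ k → ∃ p, p < j ∧ G.Adj (v1 j) (v1 p)
  par2 : ∀ j, 0 < j → j ≤ k → ∃ p, p < j ∧ G.Adj (v2 j) (v2 p)
  walk : ∀ u ∈ H, ∃ p : G.Walk u w, p.length ≤ k ∧ ∀ y ∈ p.support, y ∈ H

def Stk {V : Type} {k : ℕ} (v : ℕ → V) (f : Fin k → V) : List (Fin k) → Prop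
  | [] => True
  | a :: L => f a = v (k - L.length) ∧ Stk v f L

structure St {V : Type} {k : ℕ} (H : Set V) (w x : V) (v1 v2 : ℕ → V) (f : Fin k → V)
    (L1 L2 : List (Fin k)) (o hd : Option (Fin k)) : Prop where
  s1 : Stk v1 f L1
  s2 : Stk v2 f L2
  so : ∀ r, o = some r → f r = x
  sh : ∀ r, hd = some r → f r = w
  cov : ∀ i, f i ∈ H → i ∈ L1 ∨ i ∈ L2 ∨ o = some i ∨ hd = some i

section stk
variable {V : Type} {k : ℕ} {G : SimpleGraph V} {H : Set V} {w x : V} {v1 v2 : ℕ → V}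
  {f : Fin k → V} {L1 L2 : List (Fin k)} {o hd : Option (Fin k)} {a : Fin k}

theorem Hv.swap (hv : Hv G H k w x v1 v2) : Hv G H k w x v2 v1 :=
  ⟨hv.z2, hv.z1, hv.inj2, hv.inj1, fun i j hi hj h => (hv.dis j i hj hi h.symm).symm, hv.mem2,
    hv.mem1, hv.xH, hv.adj, hv.x2, hv.x1, hv.par2, hv.par1, hv.walk⟩

theorem St.swap (h : St H w x v1 v2 f L1 L2 o hd) : St H w x v2 v1 f L2 L1 o hd :=
  ⟨h.s2, h.s1, h.so, h.sh, fun i hi => by have := h.cov i hi; tauto⟩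

theorem Stk.pos {v : ℕ → V} : ∀ {L : List (Fin k)}, Stk v f L → L.length ≤ k → ∀ i ∈ L,
    ∃ j, k - L.length < j ∧ j ≤ k ∧ f i = v j := by
  intro L
  induction L with
  | nil => intro _ _ i hi; simp at hi
  | cons b L ih =>
    intro hs hl i hi
    simp only [List.length_cons] at hl ⊢
    rcases List.mem_cons.1 hi with rfl | hi
    · exact ⟨k - L.length, by omega, by omega, hs.1⟩
    · obtain ⟨j, h1, h2, h3⟩ := ih hs.2 (by omega) i hi
      exact ⟨j, by omega, h2, h3⟩

theorem Stk.update {v : ℕ → V} {t : V} : ∀ {L : List (Fin k)}, Stk v f L → a ∉ L →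
    Stk v (Function.update f a t) L := by
  intro L
  induction L with
  | nil => intro _ _; trivial
  | cons b L ih =>
    intro hs ha
    simp only [List.mem_cons, not_or] at ha
    exact ⟨by rw [Function.update_of_ne (Ne.symm ha.1)]; exact hs.1, ih hs.2 ha.2⟩

theorem walkIn {v : ℕ → V} (inj : ∀ i j, i ≤ k → j ≤ k → v i = v j → i = j)
    (mem : ∀ j, j ≤ k → v j ∈ H)
    (par : ∀ j, 0 < j → j ≤ k → ∃ p, p < j ∧ G.Adj (v j) (v p)) :
    ∀ (j : ℕ) (f : Fin k → V), j ≤ k → f a = v j → (∀ j' < j, v j' ∉ Set.range f) →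
      Reach G H j f (Function.update f a (v 0)) := by
  intro j
  induction j using Nat.strong_induction_on with
  | _ j ih =>
    intro f hj hf hvac
    rcases Nat.eq_zero_or_pos j with rfl | hpos
    · rw [← hf, Function.update_eq_self]
      exact Reach.refl _ _
    · obtain ⟨p, hp, hadj⟩ := par j hpos hj
      have hm : Mv G H f (Function.update f a (v p)) :=
        ⟨a, v p, hf ▸ mem j hj, mem p (by omega), hf ▸ hadj, hvac p hp, rfl⟩
      have := ih p hp (Function.update f a (v p)) (by omega) (by simp) ?_
      · rw [Function.update_idem] at this
        exact (hm.reach.trans this).mono (by omega)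
      · rintro j' hj' ⟨i, hi⟩
        rw [Function.update_apply] at hi
        split_ifs at hi with hia
        · have := inj _ _ (by omega) (by omega) hi
          omega
        · exact hvac j' (by omega) ⟨i, hi⟩

theorem St.loc (hs : St H w x v1 v2 f L1 L2 o hd) (h1 : L1.length ≤ k) (h2 : L2.length ≤ k)
    (i : Fin k) (hi : f i ∈ H) :
    (∃ j, k - L1.length < j ∧ j ≤ k ∧ f i = v1 j) ∨
    (∃ j, k - L2.length < j ∧ j ≤ k ∧ f i = v2 j) ∨ (o = some i ∧ f i = x) ∨
    (hd = some i ∧ f i = w) := by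
  rcases hs.cov i hi with h | h | h | h
  · exact Or.inl (hs.s1.pos h1 i h)
  · exact Or.inr (Or.inl (hs.s2.pos h2 i h))
  · exact Or.inr (Or.inr (Or.inl ⟨h, hs.so _ h⟩))
  · exact Or.inr (Or.inr (Or.inr ⟨h, hs.sh _ h⟩))

theorem pop1 (hv : Hv G H k w x v1 v2) (hs : St H w x v1 v2 f (a :: L1) L2 o none)
    (h1 : L1.length + 1 ≤ k) (h2 : L2.length ≤ k) :
    ∃ g, Reach G H k f g ∧ St H w x v1 v2 g L1 L2 o (some a) := by
  have hfa : f a = v1 (k - L1.length) := hs.s1.1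
  have hs1 := hs.s1.2
  have hvac : ∀ j' < k - L1.length, v1 j' ∉ Set.range f := by
    rintro j hj ⟨i, hi⟩
    have hiH : f i ∈ H := hi ▸ hv.mem1 j (by omega)
    rcases hs.loc (by simpa using h1) h2 i hiH with h | h | h | h
    · obtain ⟨j', ha, hb, hc⟩ := h
      have := hv.inj1 _ _ (by omega) hb (hi.symm.trans hc)
      simp only [List.length_cons] at ha
      omega
    · obtain ⟨j', ha, hb, hc⟩ := h
      have := hv.dis _ _ (by omega) hb (hi.symm.trans hc)
      omega
    · exact hv.x1 j (by omega) (hi.symm.trans h.2)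
    · simp at h
  have hr := walkIn (a := a) (G := G) (H := H) hv.inj1 hv.mem1 hv.par1 (k - L1.length) f (by omega)
    hfa hvac
  refine ⟨_, hr.mono (by omega), ?_⟩
  have n1 : a ∉ L1 := by
    intro h
    obtain ⟨j', ha, hb, hc⟩ := hs1.pos (by omega) a h
    have := hv.inj1 _ _ (by omega) hb (hfa.symm.trans hc)
    omega
  have n2 : a ∉ L2 := by
    intro h
    obtain ⟨j', ha, hb, hc⟩ := hs.s2.pos (by omega) a h
    have := hv.dis _ _ (by omega) hb (hfa.symm.trans hc)
    omega
  refine ⟨hs1.update n1, hs.s2.update n2, ?_, ?_, ?_⟩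
  · intro r hro
    rw [Function.update_of_ne, hs.so r hro]
    rintro rfl
    exact hv.x1 _ (by omega) (hfa.symm.trans (hs.so _ hro))
  · rintro r hr
    simp only [Option.some.injEq] at hr
    subst hr
    simp [hv.z1]
  · intro i hi
    by_cases hia : i = a
    · simp [hia]
    · rw [Function.update_of_ne hia] at hi
      have := hs.cov i hi
      simp only [List.mem_cons] at this
      simp at this
      tauto

theorem push1 (hv : Hv G H k w x v1 v2) (hf : Function.Injective f)
    (hs : St H w x v1 v2 f L1 L2 o (some a))
    (h1 : L1.length + 1 ≤ k) (h2 : L2.length ≤ k) :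
    ∃ g, Reach G H k f g ∧ St H w x v1 v2 g (a :: L1) L2 o none := by
  have hfa : f a = w := hs.sh a rfl
  have hvac : ∀ j', 0 < j' → j' ≤ k - L1.length → v1 j' ∉ Set.range f := by
    rintro j hj0 hj ⟨i, hi⟩
    have hiH : f i ∈ H := hi ▸ hv.mem1 j (by omega)
    rcases hs.loc (by omega) h2 i hiH with h | h | h | h
    · obtain ⟨j', ha, hb, hc⟩ := h
      have := hv.inj1 _ _ (by omega) hb (hi.symm.trans hc)
      omega
    · obtain ⟨j', ha, hb, hc⟩ := h
      have := hv.dis _ _ (by omega) hb (hi.symm.trans hc)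
      omega
    · exact hv.x1 j (by omega) (hi.symm.trans h.2)
    · have := hv.inj1 j 0 (by omega) (by omega) ((hi.symm.trans h.2).trans hv.z1.symm)
      omega
  set g := Function.update f a (v1 (k - L1.length)) with hg
  have hgf : Function.update g a (v1 0) = f := by
    rw [hg, Function.update_idem, hv.z1, ← hfa, Function.update_eq_self]
  have hginj : Function.Injective g := by
    have hh := hvac (k - L1.length) (by omega) le_rfl
    simp only [Set.mem_range, not_exists] at hh
    intro b c hbc
    have := @hf b c
    have hb := hh b
    have hc := hh c
    simp only [hg, Function.update_apply] at hbc
    grind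
  have hr := walkIn (a := a) (G := G) (H := H) hv.inj1 hv.mem1 hv.par1 (k - L1.length) g (by omega)
    (by simp [hg]) (by
      rintro j' hj' ⟨i, hi⟩
      rw [hg, Function.update_apply] at hi
      split_ifs at hi with hia
      · have := hv.inj1 _ _ (by omega) (by omega) hi
        omega
      · rcases Nat.eq_zero_or_pos j' with rfl | h0
        · exact hia (hf (hi.trans (hv.z1.trans hfa.symm)))
        · exact hvac j' h0 (by omega) ⟨i, hi⟩)
  rw [hgf] at hr
  refine ⟨g, (hr.symm hginj).mono (by omega), ?_⟩
  have n1 : a ∉ L1 := by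
    intro h
    obtain ⟨j', ha, hb, hc⟩ := hs.s1.pos (by omega) a h
    have := hv.inj1 _ _ hb (by omega) (hc.symm.trans (hfa.trans hv.z1.symm))
    omega
  have n2 : a ∉ L2 := by
    intro h
    obtain ⟨j', ha, hb, hc⟩ := hs.s2.pos (by omega) a h
    have := hv.inj2 _ _ hb (by omega) (hc.symm.trans (hfa.trans hv.z2.symm))
    omega
  refine ⟨⟨by simp [hg], hs.s1.update n1⟩, hs.s2.update n2, ?_, ?_, ?_⟩
  · intro r hro
    rw [hg, Function.update_of_ne, hs.so r hro]
    rintro rfl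
    exact hv.adj.ne (hfa.symm.trans (hs.so _ hro))
  · rintro r hr
    simp at hr
  · intro i hi
    by_cases hia : i = a
    · simp [hia]
    · rw [hg, Function.update_of_ne hia] at hi
      have := hs.cov i hi
      simp only [List.mem_cons]
      simp [Ne.symm hia] at this
      tauto

theorem toX (hv : Hv G H k w x v1 v2)
    (hs : St H w x v1 v2 f L1 L2 none (some a))
    (h1 : L1.length + 1 ≤ k) (h2 : L2.length ≤ k) :
    ∃ g, Reach G H 1 f g ∧ St H w x v1 v2 g L1 L2 (some a) none := by
  have hfa : f a = w := hs.sh a rfl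
  have hwH : w ∈ H := hv.z1 ▸ hv.mem1 0 (by omega)
  have hm : Mv G H f (Function.update f a x) := by
    refine ⟨a, x, hfa ▸ hwH, hv.xH, hfa ▸ hv.adj, ?_, rfl⟩
    rintro ⟨i, hi⟩
    rcases hs.loc (by omega) h2 i (hi ▸ hv.xH) with h | h | h | h
    · obtain ⟨j', ha, hb, hc⟩ := h
      exact hv.x1 _ hb (hc.symm.trans hi)
    · obtain ⟨j', ha, hb, hc⟩ := h
      exact hv.x2 _ hb (hc.symm.trans hi)
    · simp at h
    · exact hv.adj.ne (h.2.symm.trans hi)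
  refine ⟨_, hm.reach, ?_⟩
  have n1 : a ∉ L1 := by
    intro h
    obtain ⟨j', ha, hb, hc⟩ := hs.s1.pos (by omega) a h
    have := hv.inj1 _ _ hb (by omega) (hc.symm.trans (hfa.trans hv.z1.symm))
    omega
  have n2 : a ∉ L2 := by
    intro h
    obtain ⟨j', ha, hb, hc⟩ := hs.s2.pos (by omega) a h
    have := hv.inj2 _ _ hb (by omega) (hc.symm.trans (hfa.trans hv.z2.symm))
    omega
  refine ⟨hs.s1.update n1, hs.s2.update n2, ?_, ?_, ?_⟩
  · rintro r hr
    simp only [Option.some.injEq] at hr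
    subst hr
    simp
  · rintro r hr
    simp at hr
  · intro i hi
    by_cases hia : i = a
    · simp [hia]
    · rw [Function.update_of_ne hia] at hi
      have := hs.cov i hi
      simp [Ne.symm hia] at this
      tauto

theorem fromX (hv : Hv G H k w x v1 v2)
    (hs : St H w x v1 v2 f L1 L2 (some a) none)
    (h1 : L1.length + 1 ≤ k) (h2 : L2.length ≤ k) :
    ∃ g, Reach G H 1 f g ∧ St H w x v1 v2 g L1 L2 none (some a) := by
  have hfa : f a = x := hs.so a rfl
  have hwH : w ∈ H := hv.z1 ▸ hv.mem1 0 (by omega)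
  have hm : Mv G H f (Function.update f a w) := by
    refine ⟨a, w, hfa ▸ hv.xH, hwH, hfa ▸ hv.adj.symm, ?_, rfl⟩
    rintro ⟨i, hi⟩
    rcases hs.loc (by omega) h2 i (hi ▸ hwH) with h | h | h | h
    · obtain ⟨j', ha, hb, hc⟩ := h
      have := hv.inj1 _ _ hb (by omega) (hc.symm.trans (hi.trans hv.z1.symm))
      omega
    · obtain ⟨j', ha, hb, hc⟩ := h
      have := hv.inj2 _ _ hb (by omega) (hc.symm.trans (hi.trans hv.z2.symm))
      omega
    · exact hv.adj.ne (hi.symm.trans h.2)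
    · simp at h
  refine ⟨_, hm.reach, ?_⟩
  have n1 : a ∉ L1 := by
    intro h
    obtain ⟨j', ha, hb, hc⟩ := hs.s1.pos (by omega) a h
    exact hv.x1 _ hb (hc.symm.trans hfa)
  have n2 : a ∉ L2 := by
    intro h
    obtain ⟨j', ha, hb, hc⟩ := hs.s2.pos (by omega) a h
    exact hv.x2 _ hb (hc.symm.trans hfa)
  refine ⟨hs.s1.update n1, hs.s2.update n2, ?_, ?_, ?_⟩
  · rintro r hr
    simp at hr
  · rintro r hr
    simp only [Option.some.injEq] at hr
    subst hr
    simp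
  · intro i hi
    by_cases hia : i = a
    · simp [hia]
    · rw [Function.update_of_ne hia] at hi
      have := hs.cov i hi
      simp [Ne.symm hia] at this
      tauto

theorem transfer (hv : Hv G H k w x v1 v2) (hf : Function.Injective f)
    (hs : St H w x v1 v2 f (a :: L1) L2 o none)
    (h : L1.length + L2.length + 1 ≤ k) :
    ∃ g, Reach G H (2 * k) f g ∧ St H w x v1 v2 g L1 (a :: L2) o none := by
  obtain ⟨g, hg, hs1⟩ := pop1 hv hs (by omega) (by omega)
  obtain ⟨g', hg', hs2⟩ := push1 hv.swap (hg.inj hf) hs1.swap (by omega) (by omega)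
  exact ⟨g', (hg.trans hg').mono (by omega), hs2.swap⟩

theorem transfer' (hv : Hv G H k w x v1 v2) (hf : Function.Injective f)
    (hs : St H w x v1 v2 f L1 (a :: L2) o none)
    (h : L1.length + L2.length + 1 ≤ k) :
    ∃ g, Reach G H (2 * k) f g ∧ St H w x v1 v2 g (a :: L1) L2 o none := by
  obtain ⟨g, hg, hs1⟩ := transfer hv.swap hf hs.swap (by omega)
  exact ⟨g, hg, hs1.swap⟩

/-- swap the two top elements, moving one to the other stack -/
theorem sel {r : Fin k} {Q : List (Fin k)} (hv : Hv G H k w x v1 v2) :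
    ∀ (P L1 : List (Fin k)) (f : Fin k → V), Function.Injective f →
    St H w x v1 v2 f L1 (P ++ r :: Q) none none → L1.length + (P.length + Q.length + 1) ≤ k →
    ∃ g, Reach G H (8 * k * (P.length + 1)) f g ∧
      St H w x v1 v2 g (r :: L1) (P ++ Q) none none := by
  intro P
  induction P with
  | nil =>
    intro L1 f hf hs hl
    simp only [List.nil_append, List.length_nil] at hs hl ⊢
    obtain ⟨g, hg, hs'⟩ := transfer' hv hf hs (by omega)
    exact ⟨g, hg.mono (by omega), hs'⟩
  | cons p P ih =>
    intro L1 f hf hs hl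
    simp only [List.cons_append, List.length_cons] at hs hl ⊢
    obtain ⟨g1, hg1, hs1⟩ := transfer' hv hf hs (by simp; omega)
    have i1 := hg1.inj hf
    obtain ⟨g2, hg2, hs2⟩ := ih _ _ i1 hs1 (by simp; omega)
    have i2 := hg2.inj i1
    obtain ⟨g3, hg3, hs3⟩ := pop1 hv hs2 (by simp; omega) (by simp; omega)
    have i3 := hg3.inj i2
    obtain ⟨g4, hg4, hs4⟩ := toX hv hs3 (by simp; omega) (by simp; omega)
    have i4 := hg4.inj i3
    obtain ⟨g5, hg5, hs5⟩ := transfer hv i4 hs4 (by simp; omega)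
    have i5 := hg5.inj i4
    obtain ⟨g6, hg6, hs6⟩ := fromX hv hs5 (by omega) (by simp; omega)
    have i6 := hg6.inj i5
    obtain ⟨g7, hg7, hs7⟩ := push1 hv i6 hs6 (by omega) (by simp; omega)
    refine ⟨g7, ((((((hg1.trans hg2).trans hg3).trans hg4).trans hg5).trans hg6).trans hg7).mono ?_,
      hs7⟩
    have : 8 * k * (P.length + 1 + 1) = 8 * k * (P.length + 1) + 8 * k := by ring
    rw [this]
    omega

theorem sortSt (hv : Hv G H k w x v1 v2) :
    ∀ (M L1 L2 : List (Fin k)) (f : Fin k → V), Function.Injective f → L2.Perm M →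
    St H w x v1 v2 f L1 L2 none none → L1.length + L2.length ≤ k →
    ∃ g, Reach G H (8 * k * k * M.length) f g ∧
      St H w x v1 v2 g (M.reverse ++ L1) [] none none := by
  intro M
  induction M with
  | nil =>
    intro L1 L2 f hf hp hs hl
    have := hp.eq_nil
    subst this
    exact ⟨f, Reach.refl _ _, by simpa using hs⟩
  | cons r M ih =>
    intro L1 L2 f hf hp hs hl
    have hr : r ∈ L2 := hp.mem_iff.2 (by simp)
    obtain ⟨P, Q, rfl⟩ := List.append_of_mem hr
    simp only [List.length_append, List.length_cons] at hl
    obtain ⟨g1, hg1, hs1⟩ := sel hv P L1 f hf hs (by omega)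
    have hp' : (P ++ Q).Perm M := by
      have h1 := List.perm_middle (a := r) (l₁ := P) (l₂ := Q)
      exact (List.perm_cons r).1 (h1.symm.trans hp)
    obtain ⟨g2, hg2, hs2⟩ := ih _ _ g1 (hg1.inj hf) hp' hs1 (by simp; omega)
    refine ⟨g2, (hg1.trans hg2).mono ?_, by simpa using hs2⟩
    have : 8 * k * (P.length + 1) ≤ 8 * k * k := Nat.mul_le_mul_left _ (by omega)
    simp only [List.length_cons]
    nlinarith

end stk

section recon
variable {V : Type} {k : ℕ} {G : SimpleGraph V} {H : Set V} {w x : V} {v1 v2 : ℕ → V}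

theorem gather (hv : Hv G H k w x v1 v2) : ∀ (d n : ℕ) (f : Fin k → V), n + d = k →
    Function.Injective f → (∀ j, k - n < j → j ≤ k → v2 j ∈ Set.range f) →
    ∃ g m, m ≤ k ∧ Reach G H (2 * k * d) f g ∧ (∀ j, k - m < j → j ≤ k → v2 j ∈ Set.range g) ∧
      ∀ i, g i ∈ H → ∃ j, k - m < j ∧ j ≤ k ∧ g i = v2 j := by
  intro d
  induction d with
  | zero =>
    intro n f hn hf hocc
    refine ⟨f, n, by omega, Reach.refl _ _, hocc, ?_⟩
    intro i _
    by_contra hcon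
    push Not at hcon
    classical
    have hsub : insert (f i) ((Finset.Ioc (k - n) k).image v2) ⊆ Finset.univ.image f := by
      intro u hu
      simp only [Finset.mem_insert, Finset.mem_image, Finset.mem_Ioc, Finset.mem_univ,
        true_and] at hu ⊢
      rcases hu with rfl | ⟨j, ⟨h1, h2⟩, rfl⟩
      · exact ⟨i, rfl⟩
      · exact hocc j h1 h2
    have hc := Finset.card_le_card hsub
    rw [Finset.card_insert_of_notMem, Finset.card_image_of_injOn,
      Finset.card_image_of_injective _ hf] at hc
    · simp at hc
      omega
    · intro a ha b hb hab
      simp only [Finset.coe_Ioc, Set.mem_Ioc] at ha hb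
      exact hv.inj2 a b ha.2 hb.2 hab
    · simp only [Finset.mem_image, Finset.mem_Ioc, not_exists, not_and]
      rintro j ⟨h1, h2⟩ h3
      exact hcon j h1 h2 h3.symm
  | succ d ih =>
    intro n f hn hf hocc
    by_cases hdone : ∀ i, f i ∈ H → ∃ j, k - n < j ∧ j ≤ k ∧ f i = v2 j
    · exact ⟨f, n, by omega, Reach.refl _ _, hocc, hdone⟩
    push Not at hdone
    obtain ⟨i, hiH, hi⟩ := hdone
    by_cases hb : v2 (k - n) ∈ Set.range f
    · obtain ⟨g, m, h1, h2, h3⟩ := ih (n + 1) f (by omega) hf (by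
        intro j hj1 hj2
        rcases Nat.lt_or_ge (k - n) j with h | h
        · exact hocc j h hj2
        · obtain rfl : j = k - n := by omega
          exact hb)
      exact ⟨g, m, h1, h2.mono (Nat.mul_le_mul_left _ (by omega)), h3⟩
    · obtain ⟨p, hp1, hp2⟩ := hv.walk _ hiH
      obtain ⟨q, hq1, hq2⟩ := hv.walk _ (hv.mem2 (k - n) (by omega))
      obtain ⟨g, hg1, hg2⟩ := shift (H := H) (p.append q.reverse) f hf (by
        intro u hu
        rw [SimpleGraph.Walk.mem_support_append_iff, SimpleGraph.Walk.support_reverse,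
          List.mem_reverse] at hu
        exact hu.elim (hp2 u) (hq2 u)) ⟨i, rfl⟩ hb
      obtain ⟨g', m, h1, h2, h3⟩ := ih (n + 1) g (by omega) (hg1.inj hf) (by
        intro j hj1 hj2
        rw [hg2]
        rcases Nat.lt_or_ge (k - n) j with h | h
        · right
          exact ⟨hocc j h hj2, fun hh => hi j h hj2 hh.symm⟩
        · obtain rfl : j = k - n := by omega
          left; rfl)
      refine ⟨g', m, h1, (hg1.trans h2).mono ?_, h3⟩
      rw [SimpleGraph.Walk.length_append, SimpleGraph.Walk.length_reverse]
      have : 2 * k * (d + 1) = 2 * k * d + 2 * k := by ring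
      omega

theorem mkList {g : Fin k → V} {v : ℕ → V} {m : ℕ} (hm : m ≤ k)
    (h : ∀ j, k - m < j → j ≤ k → v j ∈ Set.range g) :
    ∀ n ≤ m, ∃ L : List (Fin k), L.length = n ∧ Stk v g L ∧
      ∀ j, k - n < j → j ≤ k → ∃ i ∈ L, g i = v j := by
  intro n
  induction n with
  | zero => intro _; exact ⟨[], rfl, trivial, fun j h1 h2 => by omega⟩
  | succ n ih =>
    intro hn
    obtain ⟨L, hl, hs, hj⟩ := ih (by omega)
    obtain ⟨i, hi⟩ := h (k - n) (by omega) (by omega)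
    refine ⟨i :: L, by simp [hl], ⟨by rw [hl, hi], hs⟩, ?_⟩
    intro j h1 h2
    rcases Nat.lt_or_ge (k - n) j with h' | h'
    · obtain ⟨a, ha, hb⟩ := hj j h' h2
      exact ⟨a, by simp [ha], hb⟩
    · obtain rfl : j = k - n := by omega
      exact ⟨i, by simp, hi⟩

theorem Stk.nodup {g : Fin k → V} {v : ℕ → V}
    (inj : ∀ i j, i ≤ k → j ≤ k → v i = v j → i = j) :
    ∀ {L : List (Fin k)}, Stk v g L → L.length ≤ k → L.Nodup := by
  intro L
  induction L with
  | nil => intros; exact List.nodup_nil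
  | cons a L ih =>
    intro hs hl
    simp only [List.length_cons] at hl
    refine List.nodup_cons.2 ⟨?_, ih hs.2 (by omega)⟩
    intro ha
    obtain ⟨j, h1, h2, h3⟩ := hs.2.pos (by omega) a ha
    have := inj _ _ (by omega) h2 (hs.1.symm.trans h3)
    omega

theorem Stk.unique {g g' : Fin k → V} {v : ℕ → V} :
    ∀ {L : List (Fin k)}, Stk v g L → Stk v g' L → ∀ i ∈ L, g i = g' i := by
  intro L
  induction L with
  | nil => intro _ _ i hi; simp at hi
  | cons a L ih =>
    intro h1 h2 i hi
    rcases List.mem_cons.1 hi with rfl | hi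
    · exact h1.1.trans h2.1.symm
    · exact ih h1.2 h2.2 i hi

theorem canon (hv : Hv G H k w x v1 v2) (A : Finset (Fin k)) (f : Fin k → V)
    (hf : Function.Injective f) (hA : ∀ i, i ∈ A ↔ f i ∈ H) :
    ∃ g, Reach G H (10 * k ^ 3) f g ∧ Stk v1 g (A.toList.reverse) := by
  obtain ⟨g, m, hm, hr, h1, h2⟩ := gather hv k 0 f (by omega) hf (by intro j h1 h2; omega)
  have hg := hr.inj hf
  obtain ⟨L, hl, hs, hj⟩ := mkList hm h1 m le_rfl
  have hLH : ∀ i, i ∈ L ↔ g i ∈ H := by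
    intro i
    constructor
    · intro hi
      obtain ⟨j, a, b, c⟩ := hs.pos (by omega) i hi
      rw [c]; exact hv.mem2 j b
    · intro hi
      obtain ⟨j, a, b, c⟩ := h2 i hi
      obtain ⟨i', ha, hb⟩ := hj j a b
      rwa [hg (c.trans hb.symm)]
  have hst : St H w x v1 v2 g [] L none none :=
    ⟨trivial, hs, by simp, by simp, fun i hi => Or.inr (Or.inl ((hLH i).2 hi))⟩
  have hp : L.Perm A.toList := by
    rw [List.perm_ext_iff_of_nodup (hs.nodup hv.inj2 (by omega)) A.nodup_toList]
    intro i
    rw [hLH, Finset.mem_toList, hA]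
    constructor
    · intro h
      by_contra hc
      exact hc (hr.off i hc ▸ h)
    · exact hr.on i
  obtain ⟨g', hr', hs'⟩ := sortSt hv A.toList [] L g hg hp hst (by simp; omega)
  refine ⟨g', (hr.trans hr').mono ?_, by simpa using hs'.s1⟩
  have hle : A.toList.length ≤ k := by rw [← hp.length_eq]; omega
  have h3 : 8 * k * k * A.toList.length ≤ 8 * k * k * k := Nat.mul_le_mul_left _ hle
  rcases Nat.eq_zero_or_pos k with h0 | h0
  · simp [h0]
  · have : 2 * k * k * 1 ≤ 2 * k * k * k := Nat.mul_le_mul_left _ h0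
    have h4 : 10 * k ^ 3 = 2 * k * k * k + 8 * k * k * k := by ring
    omega

theorem recon (hv : Hv G H k w x v1 v2) (f g : Fin k → V)
    (hf : Function.Injective f) (hg : Function.Injective g)
    (hH : ∀ i, f i ∈ H ↔ g i ∈ H) (hoff : ∀ i, f i ∉ H → g i = f i) :
    Reach G H (20 * k ^ 3) f g := by
  classical
  obtain ⟨f', hf1, hf2⟩ := canon hv (Finset.univ.filter fun i => f i ∈ H) f hf (by simp)
  obtain ⟨g', hg1, hg2⟩ := canon hv (Finset.univ.filter fun i => f i ∈ H) g hg (by simp [hH])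
  have : f' = g' := by
    funext i
    by_cases hi : f i ∈ H
    · exact hf2.unique hg2 i (by simpa using hi)
    · rw [hf1.off i hi, hg1.off i (by rwa [← hH]), hoff i hi]
  subst this
  exact (hf1.trans (hg1.symm hg)).mono (by omega)

end recon

section haven
variable {V : Type} {k : ℕ} {G : SimpleGraph V} {H : Set V} {w x : V}

theorem exists_seq (C : G.Subgraph) (hC : C.Connected) (hw : w ∈ C.verts)
    (hcard : k + 1 ≤ C.verts.ncard) : ∀ n ≤ k, ∃ v : ℕ → V, v 0 = w ∧
      (∀ i j, i ≤ n → j ≤ n → v i = v j → i = j) ∧ (∀ j, j ≤ n → v j ∈ C.verts) ∧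
      (∀ j, 0 < j → j ≤ n → ∃ p, p < j ∧ G.Adj (v j) (v p)) := by
  intro n
  induction n with
  | zero =>
    intro _
    exact ⟨fun _ => w, rfl, fun i j h1 h2 _ => by omega, fun _ _ => hw,
      fun j h1 h2 => by omega⟩
  | succ n ih =>
    intro hn
    obtain ⟨v, h0, hinj, hmem, hpar⟩ := ih (by omega)
    have hfin : (v '' Set.Iic n).Finite := (Set.finite_Iic n).image v
    have hlt : (v '' Set.Iic n).ncard < C.verts.ncard := by
      have h1 := Set.ncard_image_le (f := v) (Set.finite_Iic n)
      have h2 : (Set.Iic n).ncard = n + 1 := by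
        rw [← Finset.coe_Iic, Set.ncard_coe_finset, Nat.card_Iic]
      omega
    obtain ⟨u, huC, hu⟩ := Set.exists_mem_notMem_of_ncard_lt_ncard hlt hfin
    obtain ⟨p⟩ := hC.coe.preconnected ⟨w, hw⟩ ⟨u, huC⟩
    obtain ⟨d, -, hd1, hd2⟩ := p.exists_boundary_dart {y | (y : V) ∈ v '' Set.Iic n}
      ⟨0, by simp, h0⟩ hu
    obtain ⟨q, hq, hqe⟩ := hd1
    have hd2' : ∀ j ≤ n, v j ≠ d.snd := fun j hj he => hd2 ⟨j, hj, he⟩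
    have hadj : G.Adj (d.snd : V) (d.fst : V) := (C.adj_sub d.adj).symm
    have hq' : q ≤ n := hq
    refine ⟨fun j => if j ≤ n then v j else d.snd, by simp [h0], ?_, ?_, ?_⟩
    · intro i j hi hj hij
      simp only at hij
      split_ifs at hij with h1 h2 h2
      · exact hinj i j h1 h2 hij
      · exact absurd hij (hd2' i h1)
      · exact absurd hij.symm (hd2' j h2)
      · omega
    · intro j hj
      simp only
      split_ifs with h1
      · exact hmem j h1
      · exact d.snd.2
    · intro j hj0 hj
      by_cases h1 : j ≤ n
      · obtain ⟨p, hp, hpa⟩ := hpar j hj0 h1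
        exact ⟨p, hp, by simpa [h1, show p ≤ n by omega] using hpa⟩
      · exact ⟨q, by omega, by simpa [h1, hq', hqe] using hadj⟩

theorem walkMap {S : Set V} {a b : S} (p : (G.induce S).Walk a b) :
    ∃ q : G.Walk b.1 a.1, q.length = p.length ∧ ∀ y ∈ q.support, ∃ y' ∈ p.support, y'.1 = y := by
  induction p with
  | @nil a => exact ⟨SimpleGraph.Walk.nil, rfl, by simp⟩
  | @cons a c b hac p ih =>
    obtain ⟨q, h1, h2⟩ := ih
    have ha : G.Adj c.1 a.1 := (show G.Adj a.1 c.1 from hac).symm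
    refine ⟨q.concat ha, by simp [h1], ?_⟩
    intro y hy
    rw [SimpleGraph.Walk.support_concat, List.mem_append] at hy
    rcases hy with hy | hy
    · obtain ⟨y', h3, h4⟩ := h2 y hy
      exact ⟨y', by simp [h3], h4⟩
    · simp only [List.mem_singleton] at hy
      exact ⟨a, by simp, hy.symm⟩

theorem exists_hv (hk : 0 < k) (hH : IsHaven G k w H) : ∃ x v1 v2, Hv G H k w x v1 v2 := by
  obtain ⟨C1, C2, C3, x, hC1, hC2, hC3, h12, h13, h23, n1, n2, n3, hx3, hadj, hw, hHe⟩ := hH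
  have hw1 : w ∈ C1.verts := (h12.symm ▸ rfl : w ∈ C1.verts ∩ C2.verts).1
  have hw2 : w ∈ C2.verts := (h12.symm ▸ rfl : w ∈ C1.verts ∩ C2.verts).2
  have hx1 : x ∉ C1.verts := fun h =>
    hadj.ne (show x ∈ ({w} : Set V) from h13 ▸ ⟨h, hx3⟩).symm
  have hx2 : x ∉ C2.verts := fun h =>
    hadj.ne (show x ∈ ({w} : Set V) from h23 ▸ ⟨h, hx3⟩).symm
  obtain ⟨v1, z1, inj1, mem1, par1⟩ := exists_seq C1 hC1 hw1 n1 k le_rfl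
  obtain ⟨v2, z2, inj2, mem2, par2⟩ := exists_seq C2 hC2 hw2 n2 k le_rfl
  set S : Set V := {x} ∪ C1.verts ∪ C2.verts with hS
  have s1 : C1.verts ⊆ S := fun u hu => Or.inl (Or.inr hu)
  have s2 : C2.verts ⊆ S := fun u hu => Or.inr hu
  have hxS : x ∈ S := Or.inl (Or.inl rfl)
  have reach1 : ∀ C : G.Subgraph, C.Connected → w ∈ C.verts → ∀ hs : C.verts ⊆ S,
      ∀ u, ∀ hu : u ∈ C.verts, (G.induce S).Reachable ⟨w, hw⟩ ⟨u, hs hu⟩ := by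
    intro C hC hwC hs u hu
    let φ : C.coe →g G.induce S := ⟨fun y => ⟨y.1, hs y.2⟩, fun {a b} hab => C.adj_sub hab⟩
    exact (hC.coe.preconnected ⟨w, hwC⟩ ⟨u, hu⟩).map φ
  have hreach : ∀ u : S, (G.induce S).Reachable ⟨w, hw⟩ u := by
    rintro ⟨u, hu⟩
    rcases hu with (hu | hu) | hu
    · obtain rfl : u = x := hu
      exact SimpleGraph.Adj.reachable (by simpa using hadj)
    · exact reach1 C1 hC1 hw1 s1 u hu
    · exact reach1 C2 hC2 hw2 s2 u hu
  have memH : ∀ (u : S) (p : (G.induce S).Walk ⟨w, hw⟩ u), p.length ≤ k → (u : V) ∈ H := by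
    intro u p hp
    rw [hHe]
    exact ⟨u.2, (SimpleGraph.dist_le p).trans hp⟩
  have hseq : ∀ v : ℕ → V, v 0 = w → ∀ hm : (∀ j, j ≤ k → v j ∈ S),
      (∀ j, 0 < j → j ≤ k → ∃ p, p < j ∧ G.Adj (v j) (v p)) →
      ∀ j, ∀ hj : j ≤ k, ∃ p : (G.induce S).Walk ⟨w, hw⟩ ⟨v j, hm j hj⟩, p.length ≤ j := by
    intro v hz hm hpar j
    induction j using Nat.strong_induction_on with
    | _ j ih =>
      intro hj
      rcases Nat.eq_zero_or_pos j with rfl | hpos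
      · subst hz
        exact ⟨SimpleGraph.Walk.nil, by simp⟩
      · obtain ⟨p, hp, hpa⟩ := hpar j hpos hj
        obtain ⟨q, hq⟩ := ih p hp (by omega)
        have ha : (G.induce S).Adj ⟨v p, hm p (by omega)⟩ ⟨v j, hm j hj⟩ := hpa.symm
        exact ⟨q.concat ha, by rw [SimpleGraph.Walk.length_concat]; omega⟩
  have mH : ∀ v : ℕ → V, v 0 = w → (∀ j, j ≤ k → v j ∈ S) →
      (∀ j, 0 < j → j ≤ k → ∃ p, p < j ∧ G.Adj (v j) (v p)) → ∀ j, j ≤ k → v j ∈ H := by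
    intro v hz hm hpar j hj
    obtain ⟨p, hp⟩ := hseq v hz hm hpar j hj
    exact memH _ p (by omega)
  refine ⟨x, v1, v2, z1, z2, inj1, inj2, ?_, mH v1 z1 (fun j hj => s1 (mem1 j hj)) par1,
    mH v2 z2 (fun j hj => s2 (mem2 j hj)) par2, ?_, hadj, ?_, ?_, par1, par2, ?_⟩
  · intro i j hi hj hij
    have : v1 i ∈ ({w} : Set V) := h12 ▸ ⟨mem1 i hi, hij ▸ mem2 j hj⟩
    have e1 : v1 i = w := this
    exact ⟨inj1 i 0 hi (by omega) (e1.trans z1.symm),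
      inj2 j 0 hj (by omega) ((hij.symm.trans e1).trans z2.symm)⟩
  · have ha : (G.induce S).Adj ⟨w, hw⟩ ⟨x, hxS⟩ := hadj
    exact memH ⟨x, hxS⟩ (SimpleGraph.Walk.cons ha SimpleGraph.Walk.nil) (by simp; omega)
  · intro j hj he
    exact hx1 (he ▸ mem1 j hj)
  · intro j hj he
    exact hx2 (he ▸ mem2 j hj)
  · intro u hu
    rw [hHe] at hu
    obtain ⟨huS, hd⟩ := hu
    obtain ⟨p, hp⟩ := (hreach ⟨u, huS⟩).exists_walk_length_eq_dist
    have hd' : (G.induce S).dist ⟨w, hw⟩ ⟨u, huS⟩ ≤ k := hd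
    obtain ⟨q, hq1, hq2⟩ := walkMap p
    classical
    refine ⟨q, by omega, ?_⟩
    intro y hy
    obtain ⟨y', hy', rfl⟩ := hq2 y hy
    exact memH y' (p.takeUntil y' hy') ((p.length_takeUntil_le_length hy').trans (by omega))

end haven

def GStep {V : Type} {k : ℕ} (G : SimpleGraph V) (f g : Fin k → V) : Prop :=
  (∀ i, g i = f i ∨ G.Adj (f i) (g i)) ∧ Function.Injective g ∧
    ∀ i i', i ≠ i' → ¬(g i = f i' ∧ g i' = f i)

open Classical in
noncomputable def cost {V : Type} {k : ℕ} (f g : Fin k → V) : ℕ :=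
  ∑ i, if f i ≠ g i then 1 else 0

inductive SR {V : Type} {k : ℕ} (G : SimpleGraph V) :
    ℕ → (Fin k → V) → (Fin k → V) → Prop
  | refl (n : ℕ) (f : Fin k → V) : SR G n f f
  | step {n : ℕ} {f g h : Fin k → V} : SR G n f g → GStep G g h → SR G (n + cost g h) f h

section sched
variable {V : Type} {k : ℕ} {G : SimpleGraph V} {H : Set V} {f g h : Fin k → V} {m n : ℕ}

theorem SR.mono (hr : SR G n f g) : ∀ {m : ℕ}, n ≤ m → SR G m f g := by
  induction hr with
  | refl n f => intro m _; exact SR.refl _ _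
  | @step n f g h h1 h2 ih =>
    intro m hm
    have := SR.step (ih (m := m - cost g h) (by omega)) h2
    rwa [Nat.sub_add_cancel (by omega)] at this

theorem Mv.gstep (hm : Mv G H f g) (hf : Function.Injective f) : GStep G f g ∧ cost f g ≤ 1 := by
  have hinj := hm.inj hf
  obtain ⟨i, u, h1, h2, h3, h4, rfl⟩ := hm
  refine ⟨⟨?_, hinj, ?_⟩, ?_⟩
  · intro a
    by_cases ha : a = i
    · subst ha; right; simpa using h3
    · left; simp [ha]
  · rintro a b hab ⟨e1, e2⟩
    by_cases ha : a = i
    · subst ha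
      simp only [Function.update_self] at e1
      exact h4 ⟨b, e1.symm⟩
    · rw [Function.update_of_ne ha] at e1
      exact hab (hf e1)
  · classical
    unfold cost
    rw [← Finset.card_filter]
    rw [Finset.card_le_one]
    intro a ha b hb
    have key : ∀ a, a ∈ Finset.univ.filter (fun j => f j ≠ Function.update f i u j) → a = i := by
      intro a ha
      by_contra hc
      simp [hc] at ha
    exact (key a (by simpa using ha)).trans (key b (by simpa using hb)).symm

theorem Reach.sr (hr : Reach G H m g h) (h0 : SR G n f g) (hg : Function.Injective g) :
    SR G (n + m) f h := by
  induction hr with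
  | refl m g => exact h0.mono (by omega)
  | step h1 h2 ih =>
    have h3 := h2.gstep (h1.inj hg)
    exact (SR.step (ih h0 hg) h3.1).mono (by omega)

theorem SR.toSeq (hr : SR G n f g) (hf : Function.Injective f) : ∃ (T : ℕ) (pos : ℕ → Fin k → V),
    pos 0 = f ∧ pos T = g ∧ (∀ j ≤ T, Function.Injective (pos j)) ∧
    (∀ j < T, GStep G (pos j) (pos (j + 1))) ∧
    ∑ j ∈ Finset.range T, cost (pos j) (pos (j + 1)) ≤ n := by
  induction hr with
  | refl n f =>
    exact ⟨0, fun _ => f, rfl, rfl, fun _ _ => hf, fun j hj => by omega, by simp⟩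
  | @step n f g h h1 h2 ih =>
    obtain ⟨T, pos, e0, eT, hi, hs, hc⟩ := ih hf
    refine ⟨T + 1, fun j => if j ≤ T then pos j else h, by simp [e0], by simp, ?_, ?_, ?_⟩
    · intro j hj
      by_cases hjT : j ≤ T
      · simpa [hjT] using hi j hjT
      · simpa [hjT] using h2.2.1
    · intro j hj
      by_cases hjT : j + 1 ≤ T
      · simpa [hjT, show j ≤ T by omega] using hs j (by omega)
      · obtain rfl : j = T := by omega
        simpa [eT] using h2
    · rw [Finset.sum_range_succ]
      refine Nat.add_le_add (le_trans (le_of_eq ?_) hc) (by simp [eT])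
      refine Finset.sum_congr rfl fun j hj => ?_
      have := Finset.mem_range.1 hj
      simp [show j + 1 ≤ T by omega, show j ≤ T by omega]

open Classical in
theorem ncard_eq (T : ℕ) (P : ℕ → Prop) :
    {j : ℕ | j < T ∧ P j}.ncard = ∑ j ∈ Finset.range T, if P j then 1 else 0 := by
  rw [← Finset.card_filter, ← Set.ncard_coe_finset]
  congr 1
  ext j
  simp

theorem SR.toSched {I : Inst V G k} (hr : SR G n I.start g) (hg : ∀ i, I.isM i → g i = I.dest i) :
    ∃ S : Sched I, totalLength S ≤ n := by
  obtain ⟨T, pos, e0, eT, hi, hs, hc⟩ := hr.toSeq I.start_inj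
  refine ⟨⟨T, pos, fun i => by rw [e0], fun i hM => by rw [eT, hg i hM],
    fun j hj i => (hs j hj).1 i, hi, fun j hj => (hs j hj).2.2⟩, ?_⟩
  refine le_trans (le_of_eq ?_) hc
  unfold totalLength routeLength
  simp only [ncard_eq]
  rw [Finset.sum_comm]
  refine Finset.sum_congr rfl fun j _ => ?_
  unfold cost
  refine Finset.sum_congr rfl fun i _ => ?_
  congr

end sched

def act {V : Type} {k : ℕ} {G : SimpleGraph V} {I : Inst V G k} (S : Sched I) (H : Set V)
    (i : Fin k) (j : ℕ) : Prop :=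
  (∃ j1 ≤ j, S.pos j1 i ∈ H) ∧ ∃ j2, j ≤ j2 ∧ j2 ≤ S.T ∧ S.pos j2 i ∈ H

def both {V : Type} {k : ℕ} {G : SimpleGraph V} {I : Inst V G k} (S : Sched I) (H : Set V)
    (i : Fin k) (j : ℕ) : Prop := act S H i j ∧ act S H i (j + 1)

def newMv {V : Type} {k : ℕ} {G : SimpleGraph V} {I : Inst V G k} (S : Sched I) (H : Set V)
    (i : Fin k) (j : ℕ) : Prop := ¬ both S H i j ∧ S.pos j i ≠ S.pos (j + 1) i

def event {V : Type} {k : ℕ} {G : SimpleGraph V} {I : Inst V G k} (S : Sched I) (H : Set V)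
    (j : ℕ) : Prop := ∃ i, ¬ (act S H i j ↔ act S H i (j + 1))

section main
open Classical
variable {V : Type} {k : ℕ} {G : SimpleGraph V} {H : Set V} {w x : V} {v1 v2 : ℕ → V}
  {I : Inst V G k} {S : Sched I}

theorem act_of_mem {i : Fin k} {j : ℕ} (hj : j ≤ S.T) (h : S.pos j i ∈ H) : act S H i j :=
  ⟨⟨j, le_rfl, h⟩, ⟨j, le_rfl, hj, h⟩⟩

theorem exists_place (hv : Hv G H k w x v1 v2) (F : Finset V) (hF : F.card ≤ k) :
    ∃ p : Fin k → V, Function.Injective p ∧ ∀ i, p i ∈ H ∧ p i ∉ F := by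
  let A : Finset V := (Finset.Ioc 0 k).image v1 ∪ (Finset.Ioc 0 k).image v2
  have hA : A.card = 2 * k := by
    rw [Finset.card_union_of_disjoint, Finset.card_image_of_injOn, Finset.card_image_of_injOn]
    · simp; omega
    · intro a ha b hb hab
      simp only [Finset.coe_Ioc, Set.mem_Ioc] at ha hb
      exact hv.inj2 a b ha.2 hb.2 hab
    · intro a ha b hb hab
      simp only [Finset.coe_Ioc, Set.mem_Ioc] at ha hb
      exact hv.inj1 a b ha.2 hb.2 hab
    · rw [Finset.disjoint_left]
      intro u h1 h2
      simp only [Finset.mem_image, Finset.mem_Ioc] at h1 h2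
      obtain ⟨a, ha, rfl⟩ := h1
      obtain ⟨b, hb, hab⟩ := h2
      have := hv.dis a b ha.2 hb.2 hab.symm
      omega
  have hAH : ∀ u ∈ A, u ∈ H := by
    intro u hu
    simp only [A, Finset.mem_union, Finset.mem_image, Finset.mem_Ioc] at hu
    rcases hu with ⟨a, ha, rfl⟩ | ⟨a, ha, rfl⟩
    · exact hv.mem1 a ha.2
    · exact hv.mem2 a ha.2
  have hc : k ≤ (A \ F).card := by
    have := Finset.le_card_sdiff F A
    omega
  obtain ⟨B, hB, hBc⟩ := Finset.exists_subset_card_eq hc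
  let e := (Finset.equivFinOfCardEq hBc).symm
  refine ⟨fun i => (e i).1, fun a b hab => e.injective (Subtype.ext hab), fun i => ?_⟩
  have := Finset.mem_sdiff.1 (hB (e i).2)
  exact ⟨hAH _ this.1, this.2⟩

/-- preparation before a step -/
theorem prep (hv : Hv G H k w x v1 v2) {j : ℕ} (hj : j < S.T) (c : Fin k → V)
    (hc : Function.Injective c) (hin : ∀ i, act S H i j → c i ∈ H)
    (hout : ∀ i, ¬ act S H i j → c i = S.pos j i) :
    ∃ c', Reach G H ((if event S H j then 1 else 0) * (20 * k ^ 3)) c c' ∧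
      (∀ i, ¬ both S H i j → c' i = S.pos j i) ∧ (∀ i, both S H i j → c' i ∈ H) ∧
      ∀ i i', both S H i j → ¬ act S H i' j → act S H i' (j + 1) → c' i ≠ S.pos (j + 1) i' := by
  have hpin : ∀ i, S.pos j i ∈ H → act S H i j := fun i h => act_of_mem hj.le h
  by_cases he : event S H j
  · obtain ⟨p, hp, hpF⟩ := exists_place hv (Finset.univ.image fun i =>
      if act S H i j then S.pos j i else S.pos (j + 1) i) (by
        refine Finset.card_image_le.trans ?_
        simp)
    have hF1 : ∀ i i', act S H i' j → p i ≠ S.pos j i' := by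
      intro i i' h1 h2
      exact (hpF i).2 (Finset.mem_image.2 ⟨i', Finset.mem_univ _, by rw [if_pos h1, h2]⟩)
    have hF2 : ∀ i i', ¬ act S H i' j → p i ≠ S.pos (j + 1) i' := by
      intro i i' h1 h2
      exact (hpF i).2 (Finset.mem_image.2 ⟨i', Finset.mem_univ _, by rw [if_neg h1, h2]⟩)
    have hleave : ∀ i, act S H i j → ¬ both S H i j → S.pos j i ∈ H := by
      intro i h1 h2
      obtain ⟨⟨j1, a1, a2⟩, ⟨j2, b1, b2, b3⟩⟩ := h1
      rcases Nat.eq_or_lt_of_le b1 with rfl | hlt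
      · exact b3
      · exact absurd ⟨⟨⟨j1, a1, a2⟩, ⟨j2, b1, b2, b3⟩⟩, ⟨⟨j1, by omega, a2⟩, ⟨j2, hlt, b2, b3⟩⟩⟩ h2
    let c' : Fin k → V := fun i => if both S H i j then p i else S.pos j i
    have hpp : ∀ i i', ¬ both S H i' j → p i ≠ S.pos j i' := by
      intro i i' _ h2
      by_cases h3 : act S H i' j
      · exact hF1 i i' h3 h2
      · exact h3 (hpin i' (h2 ▸ (hpF i).1))
    have hc' : Function.Injective c' := by
      intro a b hab
      simp only [c'] at hab
      split_ifs at hab with h1 h2 h2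
      · exact hp hab
      · exact absurd hab (hpp a b h2)
      · exact absurd hab.symm (hpp b a h1)
      · exact S.noVertexConflict j hj.le hab
    have hcin : ∀ i, act S H i j → c' i ∈ H := by
      intro i hi
      simp only [c']
      split_ifs with h1
      · exact (hpF i).1
      · exact hleave i hi h1
    have hcout : ∀ i, ¬ act S H i j → c' i = S.pos j i := by
      intro i hi
      simp only [c']
      rw [if_neg (fun h => hi h.1)]
    refine ⟨c', ?_, ?_, ?_, ?_⟩
    · rw [if_pos he, one_mul]
      refine recon hv c c' hc hc' ?_ ?_
      · intro i
        by_cases hi : act S H i j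
        · simp [hin i hi, hcin i hi]
        · rw [hout i hi, hcout i hi]
      · intro i hi
        have hi' : ¬ act S H i j := fun h => hi (hin i h)
        rw [hout i hi', hcout i hi']
    · intro i hi
      simp [c', hi]
    · intro i hi
      simp only [c', if_pos hi]
      exact (hpF i).1
    · intro i i' h1 h2 _
      simp only [c', if_pos h1]
      exact hF2 i i' h2
  · have he' : ∀ i, act S H i j ↔ act S H i (j + 1) := by
      intro i
      by_contra h
      exact he ⟨i, h⟩
    refine ⟨c, Reach.refl _ _, ?_, fun i hi => hin i hi.1, ?_⟩
    · intro i hi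
      exact hout i fun h => hi ⟨h, (he' i).1 h⟩
    · intro i i' _ h1 h2
      exact absurd ((he' i').2 h2) h1

theorem mainInd (hv : Hv G H k w x v1 v2) : ∀ j ≤ S.T, ∃ c : Fin k → V,
    SR G ((∑ t ∈ Finset.range j, ∑ i, if newMv S H i t then 1 else 0) +
      (∑ t ∈ Finset.range j, if event S H t then 1 else 0) * (20 * k ^ 3)) I.start c ∧
    Function.Injective c ∧ (∀ i, act S H i j → c i ∈ H) ∧
    (∀ i, ¬ act S H i j → c i = S.pos j i) := by
  intro j
  induction j with
  | zero =>
    intro _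
    refine ⟨I.start, SR.refl _ _, I.start_inj, ?_, fun i _ => (S.init i).symm⟩
    rintro i ⟨⟨j1, h1, h2⟩, -⟩
    obtain rfl : j1 = 0 := by omega
    rwa [S.init i] at h2
  | succ j ih =>
    intro hj
    obtain ⟨c, hsr, hc, hin, hout⟩ := ih (by omega)
    have hjT : j < S.T := hj
    obtain ⟨c', hr, h1, h2, h3⟩ := prep hv hjT c hc hin hout
    have hc' := hr.inj hc
    let d : Fin k → V := fun i => if both S H i j then c' i else S.pos (j + 1) i
    have hmix : ∀ i i', both S H i j → ¬ both S H i' j → c' i ≠ S.pos (j + 1) i' := by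
      intro i i' hi hi' heq
      have ha : act S H i' (j + 1) := act_of_mem hj (heq ▸ h2 i hi)
      exact h3 i i' hi (fun h => hi' ⟨h, ha⟩) ha heq
    have hd : Function.Injective d := by
      intro a b hab
      simp only [d] at hab
      split_ifs at hab with g1 g2 g2
      · exact hc' hab
      · exact absurd hab (hmix a b g1 g2)
      · exact absurd hab.symm (hmix b a g2 g1)
      · exact S.noVertexConflict (j + 1) hj hab
    have hstep : GStep G c' d := by
      refine ⟨?_, hd, ?_⟩
      · intro i
        by_cases hi : both S H i j
        · left; simp [d, hi]
        · simp only [d, if_neg hi, h1 i hi]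
          exact S.step j hjT i
      · rintro a b hab ⟨e1, e2⟩
        by_cases ha : both S H a j
        · simp only [d, if_pos ha] at e1
          exact hab (hc' e1)
        by_cases hb : both S H b j
        · simp only [d, if_pos hb] at e2
          exact hab (hc' e2).symm
        simp only [d, if_neg ha, if_neg hb, h1 a ha, h1 b hb] at e1 e2
        exact S.noSwap j hjT a b hab ⟨e1, e2⟩
    have hcost : cost c' d ≤ ∑ i, if newMv S H i j then 1 else 0 := by
      unfold cost
      refine Finset.sum_le_sum fun i _ => ?_
      by_cases hi : c' i = d i
      · simp [hi]
      · have : newMv S H i j := by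
          have hnb : ¬ both S H i j := by
            intro hb
            simp [d, hb] at hi
          refine ⟨hnb, ?_⟩
          simpa [d, hnb, h1 i hnb] using hi
        rw [if_pos this]
        split_ifs <;> omega
    refine ⟨d, (SR.step (hr.sr hsr hc) hstep).mono ?_, hd, ?_, ?_⟩
    · rw [Finset.sum_range_succ, Finset.sum_range_succ, add_mul]
      omega
    · intro i hi
      by_cases hb : both S H i j
      · simp only [d, if_pos hb]; exact h2 i hb
      · simp only [d, if_neg hb]
        have hna : ¬ act S H i j := fun h => hb ⟨h, hi⟩
        obtain ⟨⟨j1, a1, a2⟩, ⟨j2, b1, b2, b3⟩⟩ := hi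
        rcases Nat.eq_or_lt_of_le a1 with rfl | hlt
        · exact a2
        · exact absurd ⟨⟨j1, by omega, a2⟩, ⟨j2, by omega, b2, b3⟩⟩ hna
    · intro i hi
      have hb : ¬ both S H i j := fun h => hi h.2
      simp only [d, if_neg hb]

theorem sum_le_one (T : ℕ) (P : ℕ → Prop) [DecidablePred P]
    (hP : ∀ a b, a < T → b < T → P a → P b → a < b → False) :
    ∑ j ∈ Finset.range T, (if P j then 1 else 0) ≤ 1 := by
  rw [← Finset.card_filter, Finset.card_le_one]
  intro a ha b hb
  simp only [Finset.mem_filter, Finset.mem_range] at ha hb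
  rcases lt_trichotomy a b with h | h | h
  · exact (hP a b ha.1 hb.1 ha.2 hb.2 h).elim
  · exact h
  · exact (hP b a hb.1 ha.1 hb.2 ha.2 h).elim

theorem events_le : (∑ t ∈ Finset.range S.T, if event S H t then 1 else 0) ≤ 2 * k := by
  have h1 : (∑ t ∈ Finset.range S.T, if event S H t then 1 else 0) ≤
      ∑ t ∈ Finset.range S.T, ∑ i, ((if ¬ act S H i t ∧ act S H i (t + 1) then 1 else 0) +
        (if act S H i t ∧ ¬ act S H i (t + 1) then 1 else 0)) := by
    refine Finset.sum_le_sum fun t _ => ?_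
    split_ifs with he
    · obtain ⟨i, hi⟩ := he
      refine le_trans ?_ (Finset.single_le_sum (fun _ _ => Nat.zero_le _) (Finset.mem_univ i))
      by_cases h1 : act S H i t <;> by_cases h2 : act S H i (t + 1) <;> simp_all
    · exact Nat.zero_le _
  refine h1.trans ?_
  rw [Finset.sum_comm]
  have h2 : ∀ i : Fin k, ∑ t ∈ Finset.range S.T,
      ((if ¬ act S H i t ∧ act S H i (t + 1) then 1 else 0) +
        (if act S H i t ∧ ¬ act S H i (t + 1) then 1 else 0)) ≤ 2 := by
    intro i
    rw [Finset.sum_add_distrib]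
    refine Nat.add_le_add (sum_le_one _ _ ?_) (sum_le_one _ _ ?_)
    · rintro a b ha hb ⟨-, ⟨j1, p1, p2⟩, -⟩ ⟨q1, -, j2, p3, p4, p5⟩ hab
      exact q1 ⟨⟨j1, by omega, p2⟩, ⟨j2, by omega, p4, p5⟩⟩
    · rintro a b ha hb ⟨⟨⟨j1, p1, p2⟩, -⟩, q1⟩ ⟨⟨-, j2, p3, p4, p5⟩, -⟩ hab
      exact q1 ⟨⟨j1, by omega, p2⟩, ⟨j2, by omega, p4, p5⟩⟩
  refine (Finset.sum_le_sum fun i _ => h2 i).trans ?_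
  simp; omega

theorem bound (hv : Hv G H k w x v1 v2) (hk : 0 < k) (hopt : Optimal S) :
    ∑ i, ∑ t ∈ Finset.range S.T,
      (if S.pos t i ≠ S.pos (t + 1) i ∧ S.pos (t + 1) i ∈ H then 1 else 0) ≤ 61 * k ^ 4 := by
  obtain ⟨c, hsr, hc, hin, hout⟩ := mainInd hv S.T le_rfl (S := S)
  have hr : Reach G H (20 * k ^ 3) c (S.pos S.T) := by
    have hact : ∀ i, act S H i S.T → S.pos S.T i ∈ H := by
      rintro i ⟨-, j2, h1, h2, h3⟩
      obtain rfl : j2 = S.T := by omega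
      exact h3
    refine recon hv _ _ hc (S.noVertexConflict S.T le_rfl) ?_ ?_
    · intro i
      by_cases hi : act S H i S.T
      · simp [hin i hi, hact i hi]
      · rw [hout i hi]
    · intro i hi
      exact (hout i fun h => hi (hin i h)).symm
  obtain ⟨S', hS'⟩ := (hr.sr hsr hc).toSched S.final
  have hle := (hopt S').trans hS'
  have hev := events_le (S := S) (H := H)
  have hev2 : (∑ t ∈ Finset.range S.T, if event S H t then 1 else 0) * (20 * k ^ 3) ≤
      2 * k * (20 * k ^ 3) := Nat.mul_le_mul_right _ hev
  have htot : totalLength S = ∑ i, ∑ t ∈ Finset.range S.T,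
      if S.pos t i ≠ S.pos (t + 1) i then 1 else 0 := by
    unfold totalLength routeLength
    simp only [ncard_eq]
    refine Finset.sum_congr rfl fun i _ => Finset.sum_congr rfl fun t _ => ?_
    congr
  rw [htot] at hle
  have key : (∑ i, ∑ t ∈ Finset.range S.T, if newMv S H i t then 1 else 0) +
      ∑ i, ∑ t ∈ Finset.range S.T,
      (if S.pos t i ≠ S.pos (t + 1) i ∧ S.pos (t + 1) i ∈ H then 1 else 0) ≤
      (∑ i, ∑ t ∈ Finset.range S.T, if S.pos t i ≠ S.pos (t + 1) i then 1 else 0) + ∑ i : Fin k, 1 := by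
    rw [← Finset.sum_add_distrib, ← Finset.sum_add_distrib]
    refine Finset.sum_le_sum fun i _ => ?_
    have hone := sum_le_one S.T (fun t => newMv S H i t ∧ S.pos (t + 1) i ∈ H) (by
      rintro a b ha hb ⟨-, p2⟩ ⟨⟨q1, -⟩, q2⟩ hab
      exact q1 ⟨⟨⟨a + 1, hab, p2⟩, ⟨b + 1, by omega, hb, q2⟩⟩, act_of_mem hb q2⟩)
    refine le_trans ?_ (Nat.add_le_add_left hone _)
    rw [← Finset.sum_add_distrib, ← Finset.sum_add_distrib]
    refine Finset.sum_le_sum fun t _ => ?_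
    by_cases a1 : S.pos t i ≠ S.pos (t + 1) i <;> by_cases a2 : S.pos (t + 1) i ∈ H <;>
      by_cases a3 : both S H i t <;> simp [newMv, a1, a2, a3]
  have hcomm : (∑ i, ∑ t ∈ Finset.range S.T, if newMv S H i t then 1 else 0) =
      ∑ t ∈ Finset.range S.T, ∑ i, if newMv S H i t then 1 else 0 := Finset.sum_comm
  have hk' : ∑ i : Fin k, 1 = k := by simp
  rw [hcomm, hk'] at key
  have e1 : 2 * k * (20 * k ^ 3) = 40 * k ^ 4 := by ring
  have e2 : 20 * k ^ 3 ≤ 20 * k ^ 4 :=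
    Nat.mul_le_mul_left _ (Nat.pow_le_pow_right hk (by omega))
  have e3 : k ≤ k ^ 4 := Nat.le_self_pow (by omega) k
  omega

theorem visited_le (hv : Hv G H k w x v1 v2) (hk : 0 < k) (hopt : Optimal S) :
    {u : V | u ∈ H ∧ ∃ i : Fin k, ∃ j ≤ S.T, S.pos j i = u}.ncard ≤ 62 * k ^ 4 := by
  have hb := bound hv hk hopt
  let A : Finset V := Finset.univ.image (S.pos 0) ∪ Finset.univ.biUnion fun i =>
    ((Finset.range S.T).filter fun t =>
      S.pos t i ≠ S.pos (t + 1) i ∧ S.pos (t + 1) i ∈ H).image fun t => S.pos (t + 1) i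
  have hsub : {u : V | u ∈ H ∧ ∃ i : Fin k, ∃ j ≤ S.T, S.pos j i = u} ⊆ A := by
    rintro u ⟨huH, i, j, hj, rfl⟩
    simp only [A, Finset.coe_union, Set.mem_union, Finset.mem_coe]
    induction j with
    | zero => left; simp
    | succ j ih =>
      by_cases h : S.pos j i = S.pos (j + 1) i
      · rw [← h] at huH ⊢
        exact ih (by omega) huH
      · right
        refine Finset.mem_biUnion.2 ⟨i, Finset.mem_univ _, Finset.mem_image.2 ⟨j, ?_, rfl⟩⟩
        simp only [Finset.mem_filter, Finset.mem_range]
        exact ⟨by omega, h, huH⟩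
  have h1 := Set.ncard_le_ncard hsub A.finite_toSet
  rw [Set.ncard_coe_finset] at h1
  have h2 : A.card ≤ k + 61 * k ^ 4 := by
    refine (Finset.card_union_le _ _).trans (Nat.add_le_add ?_ ?_)
    · refine Finset.card_image_le.trans ?_
      simp
    · refine Finset.card_biUnion_le.trans (le_trans ?_ hb)
      refine Finset.sum_le_sum fun i _ => ?_
      rw [← Finset.card_filter]
      exact Finset.card_image_le
  have e3 : k ≤ k ^ 4 := Nat.le_self_pow (by omega) k
  omega

theorem inside_le (hv : Hv G H k w x v1 v2) (hk : 0 < k) (hopt : Optimal S) :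
    lengthInside S H ≤ 62 * k ^ 4 := by
  have hb := bound hv hk hopt
  have : lengthInside S H ≤ ∑ i, ∑ t ∈ Finset.range S.T,
      (if S.pos t i ≠ S.pos (t + 1) i ∧ S.pos (t + 1) i ∈ H then 1 else 0) := by
    unfold lengthInside
    simp only [ncard_eq]
    refine Finset.sum_le_sum fun i _ => Finset.sum_le_sum fun t _ => ?_
    by_cases a1 : S.pos t i ≠ S.pos (t + 1) i <;> by_cases a2 : S.pos (t + 1) i ∈ H <;>
      simp [a1, a2]
    split_ifs <;> omega
  omega

end main

end HavenPf

/-- There is a universal constant `c > 0` such that: for every GCMP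
instance with `k` robots, every nice vertex `v` with haven `H`, and every optimal
schedule `S`, the total traveled length of all robots inside `H`, as well as the number
of vertices of `H` visited by the robots, is at most `c * k ^ 4`. -/
theorem haven_freebound :
    ∃ c : ℕ, 0 < c ∧
      ∀ (V : Type) (G : SimpleGraph V) (k : ℕ) (I : Inst V G k) (v : V) (H : Set V),
        IsNice G k v → IsHaven G k v H →
        ∀ S : Sched I, Optimal S →
          lengthInside S H ≤ c * k ^ 4 ∧
          {u : V | u ∈ H ∧ ∃ i : Fin k, ∃ j ≤ S.T, S.pos j i = u}.ncard ≤ c * k ^ 4 := by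
  refine ⟨62, by norm_num, ?_⟩
  intro V G k I v H _ hH S hopt
  rcases Nat.eq_zero_or_pos k with rfl | hk
  · have he : {u : V | u ∈ H ∧ ∃ i : Fin 0, ∃ j ≤ S.T, S.pos j i = u} = ∅ := by
      ext u
      simp
    rw [he]
    simp [lengthInside]
  · obtain ⟨x, v1, v2, hv⟩ := HavenPf.exists_hv hk hH
    exact ⟨HavenPf.inside_le hv hk hopt, HavenPf.visited_le hv hk hopt⟩
end
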